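/- arXiv:2012.15509 — 7 statements merged into one kernel-verified Lean document; each statement's English description precedes it below -/
import Mathlib

section
/- Let G be a finite abelian group with exponent n, let R₁, …, R_m be commutative indecomposable rings, and let R = R₁ × ⋯ × R_m. Assume that n (as an element of R) is a unit of R. Then the group ring R[G] is clean if and only if the group ring R[C_n] is clean. -/
/-- A ring is *clean* if every element is the sum of a unit and an idempotent. -/
def IsCleanRing (R : Type*) [Ring R] : Prop :=
  ∀ r : R, ∃ u e : R, IsUnit u ∧ IsIdempotentElem e ∧ r = u + e

/-- A commutative ring is *indecomposable* if it is nonzero and its only idempotents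
are `0` and `1`. -/
def IsIndecomposableRing (R : Type*) [CommRing R] : Prop :=
  Nontrivial R ∧ ∀ e : R, IsIdempotentElem e → e = 0 ∨ e = 1

/-- An element `f` is good if every element becomes clean after localizing at `f`. -/
def GoodIdem {A : Type*} [CommRing A] (f : A) : Prop :=
  f * f = f ∧ ∀ a : A, ∃ e v : A, e * e = e ∧ (a - e) * v * f = f

theorem GoodIdem.sup {A : Type*} [CommRing A] {f g : A} (hf : GoodIdem f) (hg : GoodIdem g) :
    GoodIdem (f + g - f * g) := by
  obtain ⟨hff, hf⟩ := hf
  obtain ⟨hgg, hg⟩ := hg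
  refine ⟨by linear_combination (1 - 2 * g + g * g) * hff + (1 - f) * hgg, fun a => ?_⟩
  obtain ⟨e₁, v₁, he₁, h₁⟩ := hf a
  obtain ⟨e₂, v₂, he₂, h₂⟩ := hg a
  refine ⟨f * e₁ + (1 - f) * e₂, f * v₁ + (1 - f) * v₂, ?_, ?_⟩
  · linear_combination (e₁ - e₂) * (e₁ - e₂) * hff + f * he₁ + (1 - f) * he₂
  · have e1 : f * (1 - f) = 0 := by linear_combination - hff
    have e2 : (1 - f) * (1 - f) = 1 - f := by linear_combination hff
    have k1 : (a - (f * e₁ + (1 - f) * e₂)) * (f * v₁ + (1 - f) * v₂) * f = f := by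
      have s1 : (a - (f * e₁ + (1 - f) * e₂)) * f = (a - e₁) * f := by
        linear_combination (e₂ - e₁) * hff
      have s2 : (f * v₁ + (1 - f) * v₂) * f = v₁ * f := by
        linear_combination (v₁ - v₂) * hff
      linear_combination (f * v₁ + (1 - f) * v₂) * s1 + (a - e₁) * s2 + h₁
    have k2 : (a - (f * e₁ + (1 - f) * e₂)) * (f * v₁ + (1 - f) * v₂) * (1 - f)
        = (a - e₂) * v₂ * (1 - f) := by
      have s1 : (a - (f * e₁ + (1 - f) * e₂)) * (1 - f) = (a - e₂) * (1 - f) := by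
        linear_combination (e₁ - e₂) * hff
      have s2 : (f * v₁ + (1 - f) * v₂) * (1 - f) = v₂ * (1 - f) := by
        linear_combination (v₂ - v₁) * hff
      linear_combination (f * v₁ + (1 - f) * v₂) * s1 + (a - e₂) * s2
    linear_combination k1 + g * k2 + (1 - f) * h₂

/-- The ideal of elements supported on a good idempotent. -/
def goodIdeal (A : Type*) [CommRing A] : Ideal A where
  carrier := {x | ∃ f, GoodIdem f ∧ x * f = x}
  zero_mem' := ⟨0, ⟨by simp, fun a => ⟨0, 0, by simp, by simp⟩⟩, by simp⟩
  add_mem' := by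
    rintro x y ⟨f, hf, hx⟩ ⟨g, hg, hy⟩
    exact ⟨_, hf.sup hg, by linear_combination (1 - g) * hx + (1 - f) * hy⟩
  smul_mem' := by
    rintro c x ⟨f, hf, hx⟩
    exact ⟨f, hf, by simp only [smul_eq_mul]; linear_combination c * hx⟩

theorem clean_of_goodIdeal {A : Type*} [CommRing A] (h : goodIdeal A = ⊤) : IsCleanRing A := by
  obtain ⟨f, hf, h1⟩ := (Ideal.eq_top_iff_one _).1 h
  rw [one_mul] at h1
  subst h1
  intro a
  obtain ⟨e, v, he, hv⟩ := hf.2 a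
  exact ⟨a - e, e, IsUnit.of_mul_eq_one v (by simpa using hv), he, by ring⟩

theorem clean_of_surjective {A B : Type*} [Ring A] [Ring B] (φ : A →+* B)
    (hφ : Function.Surjective φ) (h : IsCleanRing A) : IsCleanRing B := by
  intro b
  obtain ⟨a, rfl⟩ := hφ b
  obtain ⟨u, e, hu, he, rfl⟩ := h a
  exact ⟨φ u, φ e, hu.map φ, he.map φ, map_add _ _ _⟩

theorem isUnit_natCast_of_primes {R : Type*} [CommRing R] {n : ℕ} (hu : IsUnit (n : R)) (d : ℕ) :
    d ≠ 0 → (∀ p, p.Prime → p ∣ d → p ∣ n) → IsUnit (d : R) := by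
  induction d using induction_on_primes with
  | zero => simp
  | one => simp
  | prime_mul p a hp ih =>
    intro h0 h
    push_cast
    refine IsUnit.mul ?_ (ih (by rintro rfl; simp at h0) fun q hq hqa => h q hq (hqa.mul_left p))
    exact isUnit_of_dvd_unit (Nat.cast_dvd_cast (h p hp (dvd_mul_right _ _))) hu

/-- the subgroup idempotent is good when the quotient by the subgroup is cyclic -/
theorem good_avg {R G : Type*} [CommRing R] [CommGroup G] [Fintype G] {n : ℕ}
    (hn : Monoid.exponent G = n)
    (hC : IsCleanRing (MonoidAlgebra R (Multiplicative (ZMod n))))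
    (N : Subgroup G) [Fintype N] (g : G) (hg : ∀ x : G, ∃ k : ℤ, ∃ h ∈ N, x = g ^ k * h)
    (c : R) (hc : c * (Fintype.card N : R) = 1) :
    GoodIdem (c • ∑ h : N, MonoidAlgebra.of R G h) := by
  set s : MonoidAlgebra R G := ∑ h : N, MonoidAlgebra.of R G h with hs
  have hNs : ∀ h ∈ N, MonoidAlgebra.of R G h * s = s := by
    intro h hh
    rw [hs, Finset.mul_sum]
    refine Fintype.sum_equiv (Equiv.mulLeft (⟨h, hh⟩ : N)) _ _ fun x => ?_
    rw [← map_mul]; rfl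
  have hss : s * s = (Fintype.card N : R) • s := by
    conv_lhs => rw [hs, Finset.sum_mul]
    rw [Finset.sum_congr rfl fun (h : N) _ => hNs h h.2]
    simp [Nat.cast_smul_eq_nsmul]
  have hgn : g ^ n = 1 := by rw [← hn]; exact Monoid.pow_exponent_eq_one g
  let γ : Multiplicative (ZMod n) →* G :=
    AddMonoidHom.toMultiplicativeLeft (ZMod.lift n ⟨zmultiplesHom (Additive G) (Additive.ofMul g), by
      simp [← ofMul_pow, hgn]⟩)
  have hγ : ∀ k : ℤ, γ (Multiplicative.ofAdd (k : ZMod n)) = g ^ k := by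
    intro k
    simp [γ]
  let φ : MonoidAlgebra R (Multiplicative (ZMod n)) →ₐ[R] MonoidAlgebra R G :=
    MonoidAlgebra.lift R _ _ ((MonoidAlgebra.of R G).comp γ)
  have hφ : ∀ a, ∃ b, φ b * s = a * s := by
    intro a
    induction a using MonoidAlgebra.induction_on with
    | of x =>
      obtain ⟨k, h, hh, rfl⟩ := hg x
      refine ⟨MonoidAlgebra.of R _ (Multiplicative.ofAdd (k : ZMod n)), ?_⟩
      simp only [φ, MonoidAlgebra.lift_of, MonoidHom.comp_apply, hγ]
      rw [map_mul, mul_assoc, hNs h hh]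
    | add x y hx hy =>
      obtain ⟨b, hb⟩ := hx
      obtain ⟨b', hb'⟩ := hy
      exact ⟨b + b', by rw [map_add, add_mul, add_mul, hb, hb']⟩
    | smul r x hx =>
      obtain ⟨b, hb⟩ := hx
      exact ⟨r • b, by rw [map_smul, smul_mul_assoc, smul_mul_assoc, hb]⟩
  refine ⟨?_, fun a => ?_⟩
  · rw [smul_mul_smul_comm, hss, smul_smul, mul_assoc, hc, mul_one]
  · obtain ⟨b, hb⟩ := hφ a
    obtain ⟨u, e, hu, he, rfl⟩ := hC b
    obtain ⟨v, hv⟩ := hu.exists_right_inv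
    refine ⟨φ e, φ v, by rw [← map_mul, he.eq], ?_⟩
    have h1 : φ u * φ v = 1 := by rw [← map_mul, hv, map_one]
    rw [mul_smul_comm]
    congr 1
    rw [map_add] at hb
    linear_combination - φ v * hb + s * h1

theorem clean_of_cyclic {R G : Type*} [CommRing R] [CommGroup G] [Fintype G] {n : ℕ}
    (hn : Monoid.exponent G = n) (hu : IsUnit (n : R))
    (hC : IsCleanRing (MonoidAlgebra R (Multiplicative (ZMod n)))) :
    IsCleanRing (MonoidAlgebra R G) := by
  classical
  apply clean_of_goodIdeal
  by_contra hne
  obtain ⟨M, hM, hle⟩ := Ideal.exists_le_maximal _ hne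
  let π := Ideal.Quotient.mk M
  letI : Field (MonoidAlgebra R G ⧸ M) := Ideal.Quotient.field M
  let ψ : G →* (MonoidAlgebra R G ⧸ M)ˣ :=
    ((π : MonoidAlgebra R G →* _).comp (MonoidAlgebra.of R G)).toHomUnits
  have hψ : ∀ x, ((ψ x : (MonoidAlgebra R G ⧸ M)ˣ) : MonoidAlgebra R G ⧸ M)
      = π (MonoidAlgebra.of R G x) := fun x => rfl
  haveI : Finite ψ.range := inferInstance
  have hcyc : IsCyclic ψ.range := isCyclic_subgroup_units _
  obtain ⟨⟨_, g, rfl⟩, hgen⟩ := hcyc.exists_generator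
  have hg : ∀ x : G, ∃ k : ℤ, ∃ h ∈ ψ.ker, x = g ^ k * h := by
    intro x
    obtain ⟨k, hk⟩ := Subgroup.mem_zpowers_iff.1 (hgen ⟨ψ x, x, rfl⟩)
    have hk' : ψ g ^ k = ψ x := congrArg Subtype.val hk
    refine ⟨k, (g ^ k)⁻¹ * x, ?_, by group⟩
    rw [MonoidHom.mem_ker, map_mul, map_inv, map_zpow, hk', inv_mul_cancel]
  have hcard : IsUnit ((Fintype.card ψ.ker : ℕ) : R) := by
    refine isUnit_natCast_of_primes hu _ Fintype.card_ne_zero fun p hp hd => ?_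
    haveI := Fact.mk hp
    obtain ⟨x, hx⟩ := exists_prime_orderOf_dvd_card p hd
    rw [← hn, ← hx, ← Subgroup.orderOf_coe]
    exact Monoid.order_dvd_exponent _
  obtain ⟨c, hc⟩ := hcard.exists_left_inv
  have hgood := good_avg hn hC ψ.ker g hg c hc
  have hmem := hle (show _ ∈ goodIdeal _ from ⟨_, hgood, hgood.1⟩)
  rw [← Ideal.Quotient.eq_zero_iff_mem] at hmem
  have h1 : ∀ h : ψ.ker, π (MonoidAlgebra.of R G h) = 1 := by
    intro h
    rw [← hψ, (MonoidHom.mem_ker).1 h.2, Units.val_one]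
  have h2 : π (c • ∑ h : ψ.ker, MonoidAlgebra.of R G h) = 1 := by
    rw [Algebra.smul_def, map_mul, map_sum, Finset.sum_congr rfl fun h _ => h1 h]
    have := congrArg (fun r => π (algebraMap R (MonoidAlgebra R G) r)) hc
    simp only [map_mul, map_natCast, map_one] at this
    simpa using this
  exact one_ne_zero (h2.symm.trans hmem)

theorem exists_surj_cyclic (G : Type*) [CommGroup G] [Fintype G] :
    ∃ f : G →* Multiplicative (ZMod (Monoid.exponent G)), Function.Surjective f := by
  set n := Monoid.exponent G with hn
  have hn0 : n ≠ 0 := Monoid.exponent_ne_zero_of_finite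
  haveI : NeZero n := ⟨hn0⟩
  haveI : NeZero (Monoid.exponent G) := ⟨hn0⟩
  obtain ⟨E⟩ := CommGroup.monoidHom_mulEquiv_of_hasEnoughRootsOfUnity G ℂ
  obtain ⟨g, hg⟩ := Monoid.exists_orderOf_eq_exponent (G := G) Monoid.ExponentExists.of_finite
  set χ := E.symm g
  have hχ : orderOf χ = n := by rw [MulEquiv.orderOf_eq, hg]
  haveI : Finite χ.range := inferInstance
  haveI : IsCyclic χ.range := isCyclic_subgroup_units _
  have hcard : Nat.card χ.range = n := by
    rw [← IsCyclic.exponent_eq_card]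
    apply Nat.dvd_antisymm
    · rw [Monoid.exponent_dvd_iff_forall_pow_eq_one]
      rintro ⟨_, x, rfl⟩
      apply Subtype.ext
      change χ x ^ n = 1
      rw [← map_pow, hn, Monoid.pow_exponent_eq_one, map_one]
    · rw [← hχ]
      apply orderOf_dvd_of_pow_eq_one
      ext1 x
      have := Monoid.pow_exponent_eq_one (⟨χ x, x, rfl⟩ : χ.range)
      exact congrArg Subtype.val this
  have e : χ.range ≃* Multiplicative (ZMod n) := mulEquivOfCyclicCardEq (by rw [hcard]; simp)
  exact ⟨e.toMonoidHom.comp χ.rangeRestrict, e.surjective.comp χ.rangeRestrict_surjective⟩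

theorem clean_cyclic_of_clean {R G H : Type*} [CommRing R] [CommGroup G] [CommGroup H]
    (f : G →* H) (hf : Function.Surjective f) (hC : IsCleanRing (MonoidAlgebra R G)) :
    IsCleanRing (MonoidAlgebra R H) := by
  refine clean_of_surjective
    (MonoidAlgebra.lift R _ _ ((MonoidAlgebra.of R H).comp f)).toRingHom ?_ hC
  intro a
  induction a using MonoidAlgebra.induction_on with
  | of x =>
    obtain ⟨y, rfl⟩ := hf x
    exact ⟨MonoidAlgebra.of R G y, MonoidAlgebra.lift_of _ _⟩
  | add x y hx hy =>
    obtain ⟨b, hb⟩ := hx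
    obtain ⟨b', hb'⟩ := hy
    exact ⟨b + b', by rw [map_add, hb, hb']⟩
  | smul r x hx =>
    obtain ⟨b, hb⟩ := hx
    exact ⟨r • b, (map_smul (MonoidAlgebra.lift R _ _ ((MonoidAlgebra.of R H).comp f)) r b).trans
      (congrArg (r • ·) hb)⟩

/-- If `R = R₁ × ⋯ × R_m` is a finite product of commutative indecomposable rings, `G` is a
finite abelian group with exponent `n`, and `n` is a unit of `R`, then the group ring `R[G]`
is clean iff the group ring `R[Cₙ]` is clean. -/
theorem clean_monoidAlgebra_iff_clean_monoidAlgebra_cyclic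
    (m : ℕ) (R : Fin m → Type*) [∀ i, CommRing (R i)]
    (hind : ∀ i, IsIndecomposableRing (R i))
    (G : Type*) [CommGroup G] [Fintype G]
    (n : ℕ) (hn : Monoid.exponent G = n)
    (hu : IsUnit (n : ∀ i, R i)) :
    IsCleanRing (MonoidAlgebra (∀ i, R i) G) ↔
      IsCleanRing (MonoidAlgebra (∀ i, R i) (Multiplicative (ZMod n))) := by
  constructor
  · intro h
    subst hn
    obtain ⟨f, hf⟩ := exists_surj_cyclic G
    exact clean_cyclic_of_clean f hf h
  · exact clean_of_cyclic hn hu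
end

section
/- Let (R, 𝔪) be a commutative local domain whose residue field R/𝔪 is finite, let G be a finite abelian group whose exponent n is a unit in R, and for each divisor d of n let φ_d(x) be a monic irreducible divisor of the d-th cyclotomic polynomial Φ_d(x) over R. Then: (i) for each divisor d of n, the ring R[x]/(φ_d(x)) is clean if and only if deg(φ_d(x)) = ord_d(|R/𝔪|); and (ii) the group ring R[G] is clean if and only if deg(φ_d(x)) = ord_d(|R/𝔪|) for all divisors d of n. -/
open Polynomial IsLocalRing

theorem aux_card {K : Type*} [Field K] [Fintype K] {d : ℕ} (hd : (d : K) ≠ 0) :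
    ∃ p f : ℕ, p.Prime ∧ Fintype.card K = p ^ f ∧ p.Coprime d := by
  obtain ⟨p, hp⟩ := CharP.exists K
  obtain ⟨f, hpp, hc⟩ := FiniteField.card K p
  refine ⟨p, f, hpp, hc, ?_⟩
  rw [Nat.Prime.coprime_iff_not_dvd hpp]
  intro h
  exact hd ((CharP.cast_eq_zero_iff K p d).2 h)

theorem aux_deg {K : Type*} [Field K] [Finite K] {d : ℕ} (hd : (d : K) ≠ 0) {P : K[X]}
    (hP : P ∣ cyclotomic d K) (hi : Irreducible P) :
    P.natDegree = orderOf ((Nat.card K : ZMod d)) := by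
  have := Fintype.ofFinite K
  obtain ⟨p, f, hp, hc, hcop⟩ := aux_card hd
  have : Fact p.Prime := ⟨hp⟩
  rw [natDegree_of_dvd_cyclotomic_of_irreducible hc hcop hP hi, ← orderOf_units]
  simp [hc]

theorem aux_irr {K : Type*} [Field K] [Finite K] {d : ℕ} (hd : (d : K) ≠ 0) {P : K[X]}
    (hP : P ∣ cyclotomic d K) (h : P.natDegree = orderOf ((Nat.card K : ZMod d))) :
    Irreducible P := by
  have := Fintype.ofFinite K
  obtain ⟨p, f, hp, hc, hcop⟩ := aux_card hd
  have : Fact p.Prime := ⟨hp⟩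
  refine irreducible_of_dvd_cyclotomic_of_natDegree hc hcop hP ?_
  rw [h, ← orderOf_units]
  simp [hc]

/-- commutative clean criterion -/
theorem aux_clean {A : Type*} [CommRing A] [Finite (MaximalSpectrum A)]
    (h : ∀ M N : Ideal A, M.IsMaximal → N.IsMaximal → M ≠ N →
      ∃ e : A, IsIdempotentElem e ∧ e ∈ M ∧ e ∉ N) : IsCleanRing A := by
  classical
  have := Fintype.ofFinite (MaximalSpectrum A)
  have h1 : ∀ M : MaximalSpectrum A, ∃ e : A, IsIdempotentElem e ∧ e ∉ M.asIdeal ∧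
      ∀ N : MaximalSpectrum A, N ≠ M → e ∈ N.asIdeal := by
    intro M
    have h2 : ∀ N : MaximalSpectrum A, ∃ e : A, IsIdempotentElem e ∧ e ∉ M.asIdeal ∧
        (N ≠ M → e ∈ N.asIdeal) := by
      intro N
      by_cases hN : N = M
      · exact ⟨1, IsIdempotentElem.one, (Ideal.ne_top_iff_one _).1 M.isMaximal.ne_top,
          fun h => absurd hN h⟩
      · obtain ⟨e, h1, h2, h3⟩ := h N.asIdeal M.asIdeal N.isMaximal M.isMaximal
          (fun h => hN (MaximalSpectrum.ext h))
        exact ⟨e, h1, h3, fun _ => h2⟩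
    choose e he using h2
    refine ⟨∏ N, e N, ?_, ?_, ?_⟩
    · rw [IsIdempotentElem, ← Finset.prod_mul_distrib]
      exact Finset.prod_congr rfl fun N _ => (he N).1
    · have := M.isMaximal.isPrime
      rw [Ideal.IsPrime.prod_mem_iff]
      rintro ⟨N, _, hN⟩
      exact (he N).2.1 hN
    · intro N hN
      exact Ideal.mem_of_dvd _ (Finset.dvd_prod_of_mem e (Finset.mem_univ N)) ((he N).2.2 hN)
  choose e he using h1
  intro a
  set s : Finset (MaximalSpectrum A) := Finset.univ.filter (fun M => a ∈ M.asIdeal) with hs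
  set f : A := ∏ M ∈ s, (1 - e M) with hf
  have hfi : IsIdempotentElem f := by
    rw [IsIdempotentElem, hf, ← Finset.prod_mul_distrib]
    exact Finset.prod_congr rfl fun N _ => (he N).1.one_sub
  refine ⟨a - (1 - f), 1 - f, ?_, hfi.one_sub, by ring⟩
  by_contra hu
  obtain ⟨M, hM, haM⟩ := exists_max_ideal_of_mem_nonunits hu
  set M' : MaximalSpectrum A := ⟨M, hM⟩
  have hp := hM.isPrime
  by_cases ha : a ∈ M
  · have h2 : f ∈ M := by
      refine Ideal.mem_of_dvd _ (Finset.dvd_prod_of_mem _ (a := M') (by simp [hs, M', ha])) ?_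
      have := (he M').1.mul_one_sub_self
      have h3 : e M' * (1 - e M') ∈ M := by rw [this]; exact M.zero_mem
      exact (hp.mem_or_mem h3).resolve_left (he M').2.1
    have : (1 : A) ∈ M := by
      have := M.add_mem (M.sub_mem ha haM) h2
      ring_nf at this
      exact this
    exact hM.ne_top ((Ideal.eq_top_iff_one _).2 this)
  · have h2 : f ∉ M := by
      rw [hf, Ideal.IsPrime.prod_mem_iff]
      rintro ⟨N, hN, hN2⟩
      have hNM : M' ≠ N := by
        rintro rfl
        simp [hs, M'] at hN
        exact ha hN
      have h3 := (he N).2.2 M' hNM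
      have : (1 : A) ∈ M := by
        have := M.add_mem hN2 h3
        ring_nf at this
        exact this
      exact hM.ne_top ((Ideal.eq_top_iff_one _).2 this)
    have h3 : f * (1 - f) ∈ M := by rw [hfi.mul_one_sub_self]; exact M.zero_mem
    have h4 := (hp.mem_or_mem h3).resolve_left h2
    apply ha
    have := M.add_mem haM h4
    ring_nf at this
    exact this

theorem aux_clean_image {A B : Type*} [CommRing A] [CommRing B] (f : A →+* B)
    (hf : Function.Surjective f) (h : IsCleanRing A) : IsCleanRing B := by
  intro b
  obtain ⟨a, rfl⟩ := hf b
  obtain ⟨u, e, hu, he, rfl⟩ := h a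
  exact ⟨f u, f e, hu.map f, he.map f, by simp⟩

theorem aux_clean_local {A : Type*} [CommRing A] [IsLocalRing A] : IsCleanRing A := by
  intro a
  rcases IsLocalRing.isUnit_or_isUnit_one_sub_self a with h | h
  · exact ⟨a, 0, h, IsIdempotentElem.zero, by simp⟩
  · exact ⟨a - 1, 1, by simpa using h.neg, IsIdempotentElem.one, by simp⟩

theorem aux_local_of_clean {A : Type*} [CommRing A] [Nontrivial A] (h : IsCleanRing A)
    (hi : ∀ e : A, IsIdempotentElem e → e = 0 ∨ e = 1) : IsLocalRing A := by
  refine IsLocalRing.of_isUnit_or_isUnit_one_sub_self fun a => ?_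
  obtain ⟨u, e, hu, he, rfl⟩ := h a
  rcases hi e he with rfl | rfl
  · left; simpa using hu
  · right; simpa using hu.neg

/-- maximal ideals lie over the maximal ideal -/
theorem aux_max {R A : Type*} [CommRing R] [IsLocalRing R] [CommRing A] [Algebra R A]
    [Algebra.IsIntegral R A] (M : Ideal A) (hM : M.IsMaximal) :
    M.comap (algebraMap R A) = maximalIdeal R :=
  IsLocalRing.eq_maximalIdeal (Ideal.isMaximal_comap_of_isIntegral_of_isMaximal (R := R) M)

theorem aux_finite_max {R A : Type*} [CommRing R] [IsLocalRing R] [CommRing A] [Algebra R A]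
    [Module.Finite R A] [Finite (ResidueField R)] : Finite (MaximalSpectrum A) := by
  set I : Ideal A := (maximalIdeal R).map (algebraMap R A) with hI
  have h1 : Module.Finite (R ⧸ maximalIdeal R) (A ⧸ I) :=
    Module.Finite.of_restrictScalars_finite R _ _
  have : Finite (R ⧸ maximalIdeal R) := inferInstanceAs (Finite (ResidueField R))
  have h2 : Finite (A ⧸ I) := Module.finite_of_finite (R ⧸ maximalIdeal R)
  have h3 : Finite (Set (A ⧸ I)) := inferInstance
  let F : MaximalSpectrum A → Set (A ⧸ I) := fun M => (Ideal.Quotient.mk I) '' (M.asIdeal : Set A)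
  refine Finite.of_injective F ?_
  have key : ∀ M N : MaximalSpectrum A, F M = F N → M.asIdeal ≤ N.asIdeal := by
    intro M N h a ha
    have : Ideal.Quotient.mk I a ∈ F N := h ▸ ⟨a, ha, rfl⟩
    obtain ⟨b, hb, hab⟩ := this
    have h4 : I ≤ N.asIdeal := by
      rw [hI, Ideal.map_le_iff_le_comap, aux_max N.asIdeal N.isMaximal]
    have := h4 ((Ideal.Quotient.eq).1 hab)
    have := N.asIdeal.sub_mem hb this
    simpa using this
  intro M N h
  exact MaximalSpectrum.ext (le_antisymm (key M N h) (key N M h.symm))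

theorem aux_finrank {R : Type*} [CommRing R] [Nontrivial R] {P : R[X]} (hP : P.Monic) :
    Module.finrank R (AdjoinRoot P) = P.natDegree := by
  rw [(AdjoinRoot.powerBasis' hP).finrank, AdjoinRoot.powerBasis'_dim]

theorem aux_charpoly {R S : Type*} [CommRing R] [CommRing S] [Algebra R S]
    [Module.Free R S] [Module.Finite R S] (x : S) :
    aeval x (LinearMap.charpoly (Algebra.lsmul R R S x)) = 0 := by
  have h := LinearMap.aeval_self_charpoly (Algebra.lsmul R R S x)
  rw [aeval_algHom_apply] at h
  have := congrArg (fun f => f (1 : S)) h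
  simpa using this

theorem aux_dvd {R S : Type*} [CommRing R] [Nontrivial R] [CommRing S] [Algebra R S]
    [Module.Free R S] [Module.Finite R S] {x : S} (hx : Algebra.adjoin R {x} = ⊤)
    {P F : R[X]} (hP : P.Monic) (hPx : aeval x P = 0) (hd : P.natDegree = Module.finrank R S)
    (hF : aeval x F = 0) : P ∣ F := by
  have := hP.free_adjoinRoot
  have := hP.finite_adjoinRoot
  let f : AdjoinRoot P →ₐ[R] S := AdjoinRoot.liftAlgHom P (Algebra.ofId R S) x (by
    simpa [aeval_def] using hPx)
  have hfr : f (AdjoinRoot.root P) = x := by simp [f]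
  have hf : Function.Surjective f := by
    rw [← AlgHom.range_eq_top, ← top_le_iff, ← hx]
    apply Algebra.adjoin_le
    rintro _ rfl
    exact ⟨_, hfr⟩
  let e : S ≃ₗ[R] AdjoinRoot P := LinearEquiv.ofFinrankEq _ _ (by rw [aux_finrank hP, hd])
  have hinj : Function.Injective (e.toLinearMap ∘ₗ f.toLinearMap) :=
    OrzechProperty.injective_of_surjective_endomorphism _ (e.surjective.comp hf)
  have : f (aeval (AdjoinRoot.root P) F) = 0 := by
    rw [← aeval_algHom_apply, hfr, hF]
  rw [AdjoinRoot.aeval_eq] at this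
  rw [← AdjoinRoot.mk_eq_zero]
  apply hinj
  simp [this]

theorem aux_lift {R F : Type*} [CommRing R] [IsLocalRing R] [Finite (ResidueField R)]
    [Field F] [Algebra (ResidueField R) F] {d : ℕ} (hd : IsUnit (d : R)) {φ : R[X]}
    (hm : φ.Monic) (hdvd : φ ∣ cyclotomic d R)
    (hdeg : φ.natDegree = orderOf ((Nat.card (ResidueField R) : ZMod d)))
    {α : F} (hα : IsPrimitiveRoot α d) :
    ∃ P : R[X], P.Monic ∧ P ∣ X ^ d - 1 ∧ P.map (residue R) = minpoly (ResidueField R) α := by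
  have hdk : (d : ResidueField R) ≠ 0 := by
    have := (hd.map (residue R)).ne_zero
    simpa using this
  have hdF : (d : F) ≠ 0 := by
    have := (map_ne_zero (algebraMap (ResidueField R) F)).2 hdk
    simpa using this
  have : NeZero (d : F) := ⟨hdF⟩
  have : NeZero d := ⟨by rintro rfl; simp at hdk⟩
  have hαint : IsIntegral (ResidueField R) α :=
    ⟨X ^ d - 1, monic_X_pow_sub_C 1 (NeZero.ne d), by simp [hα.pow_eq_one]⟩
  have hmp : minpoly (ResidueField R) α ∣ cyclotomic d (ResidueField R) := by
    apply minpoly.dvd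
    rw [aeval_def, eval₂_eq_eval_map, map_cyclotomic]
    exact isRoot_cyclotomic_iff.2 hα
  have hmpd := aux_deg hdk hmp (minpoly.irreducible hαint)
  -- a root of `φ` in `F`
  set ι : R →+* F := (algebraMap (ResidueField R) F).comp (residue R) with hι
  have hφF : φ.map ι ∣ cyclotomic d F := by
    have := Polynomial.map_dvd ι hdvd
    rwa [map_cyclotomic] at this
  have hspl : (cyclotomic d F).Splits := by
    rw [cyclotomic_eq_prod_X_sub_primitiveRoots hα]
    exact Splits.prod fun i _ => Splits.X_sub_C i
  have hdeg0 : (φ.map ι).degree ≠ 0 := by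
    rw [hm.degree_map, degree_eq_natDegree hm.ne_zero, hdeg, ← hmpd]
    exact_mod_cast (minpoly.natDegree_pos hαint).ne'
  obtain ⟨β, hβ⟩ := (hspl.of_dvd (cyclotomic_ne_zero d F) hφF).exists_eval_eq_zero hdeg0
  have hβp : IsPrimitiveRoot β d := isRoot_cyclotomic_iff.1 (IsRoot.dvd hβ hφF)
  obtain ⟨j, -, hj⟩ := hβp.eq_pow_of_pow_eq_one hα.pow_eq_one
  obtain ⟨i, -, hi⟩ := hα.eq_pow_of_pow_eq_one hβp.pow_eq_one
  have := hm.free_adjoinRoot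
  have := hm.finite_adjoinRoot
  set ζ := AdjoinRoot.root φ with hζ
  have hζd : ζ ^ d = 1 := by
    have h1 : φ ∣ X ^ d - 1 := hdvd.trans (cyclotomic.dvd_X_pow_sub_one d R)
    have h2 := AdjoinRoot.mk_eq_zero.2 h1
    simp only [map_sub, map_pow, AdjoinRoot.mk_X, map_one] at h2
    exact sub_eq_zero.1 h2
  have hij : ζ ^ (j * i) = ζ := by
    have h1 : β ^ (j * i) = β ^ 1 := by rw [pow_mul, hj, hi, pow_one]
    have h2 : j * i ≡ 1 [MOD d] := by
      have hfo : IsOfFinOrder β :=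
        isOfFinOrder_iff_pow_eq_one.mpr ⟨d, Nat.pos_of_ne_zero (NeZero.ne d), hβp.pow_eq_one⟩
      rwa [hfo.pow_eq_pow_iff_modEq, ← hβp.eq_orderOf] at h1
    calc ζ ^ (j * i) = ζ ^ 1 := pow_eq_pow_of_modEq h2 hζd
      _ = ζ := pow_one _
  let P := LinearMap.charpoly (Algebra.lsmul R R (AdjoinRoot φ) (ζ ^ j))
  have hPm : P.Monic := LinearMap.charpoly_monic _
  have hPd : P.natDegree = Module.finrank R (AdjoinRoot φ) := LinearMap.charpoly_natDegree _
  have hP0 : aeval (ζ ^ j) P = 0 := aux_charpoly _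
  refine ⟨P, hPm, ?_, ?_⟩
  · refine aux_dvd (x := ζ ^ j) ?_ hPm hP0 hPd ?_
    · rw [← top_le_iff, ← AdjoinRoot.adjoinRoot_eq_top (f := φ)]
      apply Algebra.adjoin_le
      rintro _ rfl
      have : ζ = (ζ ^ j) ^ i := by rw [← pow_mul, hij]
      rw [SetLike.mem_coe, ← hζ]
      nth_rw 2 [this]
      exact pow_mem (Algebra.self_mem_adjoin_singleton R _) i
    · have : (ζ ^ j) ^ d = 1 := by rw [← pow_mul, mul_comm j d, pow_mul, hζd, one_pow]
      simp [this]
  · refine eq_of_monic_of_dvd_of_natDegree_le (minpoly.monic hαint) (hPm.map _) ?_ ?_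
    · apply minpoly.dvd
      let ψ : AdjoinRoot φ →+* F := AdjoinRoot.lift ι β (by rw [eval₂_eq_eval_map, hβ])
      have hψ : ψ (ζ ^ j) = α := by
        rw [map_pow, hζ, AdjoinRoot.lift_root, hj]
      have h1 := congrArg ψ hP0
      rw [map_zero, aeval_def, hom_eval₂, hψ] at h1
      rw [aeval_def, eval₂_map, ← h1]
      congr 1
      ext r
      simp [ψ, ι]
    · rw [hPm.natDegree_map, hPd, aux_finrank hm, hmpd, hdeg]

theorem aux_small {R A : Type*} [CommRing R] [IsLocalRing R] [CommRing A] [Algebra R A]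
    [Algebra.IsIntegral R A] {N : Ideal A} (hN : N.IsMaximal) (a : A) {D : R[X]}
    (hD : D.map (residue R) = 0) : aeval a D ∈ N := by
  rw [aeval_eq_sum_range]
  refine N.sum_mem fun i _ => ?_
  rw [Algebra.smul_def]
  apply N.mul_mem_right
  rw [← Ideal.mem_comap, aux_max N hN, ← residue_eq_zero_iff, ← coeff_map, hD, coeff_zero]

theorem aux_key {R A : Type*} [CommRing R] [IsLocalRing R] [Finite (ResidueField R)]
    [CommRing A] [Algebra R A] [Algebra.IsIntegral R A] {n : ℕ} (hn : IsUnit (n : R))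
    (hφ : ∀ d, d ∣ n → ∃ φ : R[X], φ.Monic ∧ φ ∣ cyclotomic d R ∧
      φ.natDegree = orderOf ((Nat.card (ResidueField R) : ZMod d)))
    {M N : Ideal A} (hM : M.IsMaximal) (hN : N.IsMaximal)
    (h : ∀ e : A, IsIdempotentElem e → e ∈ M → e ∈ N)
    {a : A} (ha : a ^ n = 1) {F : R[X]} (hF : aeval a F ∈ M) : aeval a F ∈ N := by
  let _ : Field (A ⧸ M) := Ideal.Quotient.field M
  let ψ : R →+* A ⧸ M := (Ideal.Quotient.mk M).comp (algebraMap R A)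
  have hloc : IsLocalHom ψ := by
    refine ⟨fun r hr => ?_⟩
    by_contra hnu
    have h1 : r ∈ M.comap (algebraMap R A) := by
      rw [aux_max M hM]
      exact (mem_maximalIdeal r).2 hnu
    have h2 : ψ r = 0 := Ideal.Quotient.eq_zero_iff_mem.2 h1
    exact hr.ne_zero h2
  let _ : Algebra (ResidueField R) (A ⧸ M) := (ResidueField.lift ψ).toAlgebra
  set α : A ⧸ M := Ideal.Quotient.mk M a with hα
  have hev : ∀ P : R[X], Ideal.Quotient.mk M (aeval a P) = aeval α (P.map (residue R)) := by
    intro P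
    rw [aeval_def, aeval_def, hom_eval₂, eval₂_map]
    rfl
  have hαn : α ^ n = 1 := by rw [hα, ← map_pow, ha, map_one]
  have hdn : orderOf α ∣ n := orderOf_dvd_of_pow_eq_one hαn
  obtain ⟨φ, hφ1, hφ2, hφ3⟩ := hφ _ hdn
  have hdu : IsUnit ((orderOf α : ℕ) : R) :=
    isUnit_of_dvd_unit (Nat.cast_dvd_cast hdn) hn
  obtain ⟨P, hPm, hPd, hPmin⟩ := aux_lift hdu hφ1 hφ2 hφ3 (IsPrimitiveRoot.orderOf α)
  have hPn : P ∣ X ^ n - 1 := hPd.trans (by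
    obtain ⟨c, rfl⟩ := hdn
    rw [pow_mul]
    exact sub_one_dvd_pow_sub_one _ _)
  obtain ⟨Q, hQ⟩ := hPn
  have hsep : (X ^ n - 1 : R[X]).Separable := by
    have := separable_X_pow_sub_C_unit (1 : Rˣ) hn
    simpa using this
  rw [hQ] at hsep
  obtain ⟨u, v, huv⟩ := hsep.isCoprime
  have hPQ : aeval a P * aeval a Q = 0 := by
    rw [← map_mul, ← hQ]
    simp [ha]
  have huv' : aeval a u * aeval a P + aeval a v * aeval a Q = 1 := by
    rw [← map_mul, ← map_mul, ← map_add, huv, map_one]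
  have hPM : aeval a P ∈ M := by
    rw [← Ideal.Quotient.eq_zero_iff_mem, hev, hPmin, minpoly.aeval]
  have he : IsIdempotentElem (aeval a u * aeval a P) := by
    rw [IsIdempotentElem]
    linear_combination (aeval a u * aeval a P) * huv' - aeval a u * aeval a v * hPQ
  have heN := h _ he (M.mul_mem_left _ hPM)
  have hPN : aeval a P ∈ N := by
    have h0 : aeval a P * aeval a Q ∈ N := by rw [hPQ]; exact N.zero_mem
    refine (hN.isPrime.mem_or_mem h0).resolve_right fun hq => ?_
    exact hN.ne_top ((Ideal.eq_top_iff_one _).2 (huv' ▸ N.add_mem heN (N.mul_mem_left _ hq)))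
  have hdv : minpoly (ResidueField R) α ∣ F.map (residue R) := by
    apply minpoly.dvd
    rw [← hev, Ideal.Quotient.eq_zero_iff_mem]
    exact hF
  obtain ⟨H', hH'⟩ := hdv
  obtain ⟨H, rfl⟩ := Polynomial.map_surjective (residue R) residue_surjective H'
  have h1 : (F - P * H).map (residue R) = 0 := by
    rw [Polynomial.map_sub, Polynomial.map_mul, hPmin, hH', sub_self]
  have h2 := N.add_mem (aux_small hN a h1) (N.mul_mem_right (aeval a H) hPN)
  simpa using h2

theorem aux_cyc {G F : Type*} [CommGroup G] [Finite G] [Field F] (χ : G →* F) :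
    ∃ g₀ : G, ∀ g, ∃ i : ℕ, χ g = χ g₀ ^ i := by
  let χ' := χ.toHomUnits
  have : Finite χ'.range := Set.finite_range χ'
  have : IsCyclic χ'.range := inferInstance
  obtain ⟨⟨_, g₀, rfl⟩, hg⟩ := IsCyclic.exists_generator (α := χ'.range)
  refine ⟨g₀, fun g => ?_⟩
  have h1 := hg ⟨χ' g, g, rfl⟩
  rw [← mem_powers_iff_mem_zpowers] at h1
  obtain ⟨i, hi⟩ := h1
  refine ⟨i, ?_⟩
  have := congrArg (fun x : χ'.range => ((x : Fˣ) : F)) hi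
  simpa [χ'] using this.symm

theorem aux_sep {R G : Type*} [CommRing R] [IsLocalRing R] [Finite (ResidueField R)]
    [CommGroup G] [Finite G] {n : ℕ} (hn : IsUnit (n : R)) (hG : ∀ g : G, g ^ n = 1)
    (hφ : ∀ d, d ∣ n → ∃ φ : R[X], φ.Monic ∧ φ ∣ cyclotomic d R ∧
      φ.natDegree = orderOf ((Nat.card (ResidueField R) : ZMod d)))
    [Algebra.IsIntegral R (MonoidAlgebra R G)]
    {M N : Ideal (MonoidAlgebra R G)} (hM : M.IsMaximal) (hN : N.IsMaximal)
    (h : ∀ e : MonoidAlgebra R G, IsIdempotentElem e → e ∈ M → e ∈ N) : M ≤ N := by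
  let o := MonoidAlgebra.of R G
  have ho : ∀ g, o g ^ n = 1 := fun g => by rw [← map_pow, hG, map_one]
  have key : ∀ (g : G) (F : R[X]), aeval (o g) F ∈ M → aeval (o g) F ∈ N :=
    fun g F => aux_key hn hφ hM hN h (ho g)
  let _ : Field (MonoidAlgebra R G ⧸ M) := Ideal.Quotient.field M
  obtain ⟨g₀, hg₀⟩ := aux_cyc ((Ideal.Quotient.mk M).toMonoidHom.comp o)
  have h1 : ∀ x : MonoidAlgebra R G, ∃ F : R[X], x - aeval (o g₀) F ∈ M ∧
      x - aeval (o g₀) F ∈ N := by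
    intro x
    induction x using MonoidAlgebra.induction_on with
    | of g => ?_
    | add x y hx hy => ?_
    | smul r x hx => ?_
    · obtain ⟨i, hi⟩ := hg₀ g
      have hi' : o g - o g₀ ^ i ∈ M := by
        rw [← Ideal.Quotient.eq_zero_iff_mem, map_sub, map_pow, sub_eq_zero]
        exact hi
      refine ⟨X ^ i, by rw [map_pow, aeval_X]; exact hi', ?_⟩
      have e1 : o (g * (g₀ ^ i)⁻¹) * o g₀ ^ i = o g := by
        rw [← map_pow, ← map_mul]; simp
      have e2 : o (g * (g₀ ^ i)⁻¹) = o g * o (g₀ ^ i)⁻¹ := map_mul _ _ _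
      have e3 : o g₀ ^ i * o (g₀ ^ i)⁻¹ = 1 := by
        rw [← map_pow, ← map_mul]; simp
      have hk : aeval (o (g * (g₀ ^ i)⁻¹)) (X - 1 : R[X]) ∈ M := by
        have := M.mul_mem_right (o (g₀ ^ i)⁻¹) hi'
        rw [sub_mul, e3, ← e2] at this
        simpa using this
      have := N.mul_mem_right (o g₀ ^ i) (key _ _ hk)
      simp only [map_sub, aeval_X, map_one, sub_mul, one_mul, e1] at this
      rw [map_pow, aeval_X]
      exact this
    · obtain ⟨F, hF⟩ := hx
      obtain ⟨F', hF'⟩ := hy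
      refine ⟨F + F', ?_⟩
      rw [map_add, add_sub_add_comm]
      exact ⟨M.add_mem hF.1 hF'.1, N.add_mem hF.2 hF'.2⟩
    · obtain ⟨F, hF⟩ := hx
      refine ⟨r • F, ?_⟩
      rw [map_smul, ← smul_sub, Algebra.smul_def]
      exact ⟨M.mul_mem_left _ hF.1, N.mul_mem_left _ hF.2⟩
  intro x hx
  obtain ⟨F, hF1, hF2⟩ := h1 x
  have h2 : aeval (o g₀) F ∈ M := by
    have := M.sub_mem hx hF1
    simpa using this
  have := N.add_mem hF2 (key _ _ h2)
  simpa using this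

theorem aux_group_clean {R G : Type*} [CommRing R] [IsLocalRing R] [Finite (ResidueField R)]
    [CommGroup G] [Finite G] {n : ℕ} (hn : IsUnit (n : R)) (hG : ∀ g : G, g ^ n = 1)
    (hφ : ∀ d, d ∣ n → ∃ φ : R[X], φ.Monic ∧ φ ∣ cyclotomic d R ∧
      φ.natDegree = orderOf ((Nat.card (ResidueField R) : ZMod d))) :
    IsCleanRing (MonoidAlgebra R G) := by
  have hfin : Module.Finite R (MonoidAlgebra R G) := inferInstance
  have : Finite (MaximalSpectrum (MonoidAlgebra R G)) := aux_finite_max (R := R)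
  apply aux_clean
  intro M N hM hN hMN
  by_contra hcon
  push Not at hcon
  exact hMN (hM.eq_of_le hN.ne_top (aux_sep hn hG hφ hM hN hcon))

/-- surjection from the group ring -/
theorem aux_surj {R S G : Type*} [CommRing R] [CommRing S] [Algebra R S] [CommGroup G] [Finite G]
    {x : S} (hx : Algebra.adjoin R {x} = ⊤) (hxn : x ^ Monoid.exponent G = 1) :
    ∃ f : MonoidAlgebra R G →ₐ[R] S, Function.Surjective f := by
  have hex := Monoid.ExponentExists.of_finite (G := G)
  have hne : NeZero (Monoid.exponent G) := ⟨Monoid.exponent_ne_zero.2 hex⟩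
  obtain ⟨E⟩ := CommGroup.monoidHom_mulEquiv_of_hasEnoughRootsOfUnity G ℂ
  obtain ⟨g, hg⟩ := Monoid.exists_orderOf_eq_exponent hex
  set χ : G →* ℂˣ := E.symm g with hχ
  have hχo : orderOf χ = Monoid.exponent G := by rw [hχ, MulEquiv.orderOf_eq, hg]
  have : Finite χ.range := Set.finite_range χ
  obtain ⟨⟨_, g₀, rfl⟩, hgen⟩ := IsCyclic.exists_generator (α := χ.range)
  set t : χ.range := ⟨χ g₀, g₀, rfl⟩ with ht
  have hto : Monoid.exponent G ∣ orderOf t := by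
    rw [← hχo]
    apply orderOf_dvd_of_pow_eq_one
    ext g
    have h1 : (⟨χ g, g, rfl⟩ : χ.range) ^ orderOf t = 1 := by
      obtain ⟨i, hi⟩ := hgen ⟨χ g, g, rfl⟩
      rw [← hi]
      simp only
      rw [← zpow_natCast, zpow_comm, zpow_natCast, pow_orderOf_eq_one, one_zpow]
    have := congrArg (fun x : χ.range => ((x : ℂˣ) : ℂ)) h1
    simpa using this
  have hu : IsUnit x := IsUnit.of_pow_eq_one hxn hne.out
  obtain ⟨y, rfl⟩ := hu
  have hy : orderOf y ∣ orderOf t := by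
    refine dvd_trans (orderOf_dvd_of_pow_eq_one ?_) hto
    ext
    simpa using hxn
  let θ : χ.range →* Sˣ := monoidHomOfForallMemZpowers hgen hy
  have hθ : θ t = y := monoidHomOfForallMemZpowers_apply_gen hgen hy
  let f := MonoidAlgebra.lift R S G ((Units.coeHom S).comp (θ.comp χ.rangeRestrict))
  refine ⟨f, ?_⟩
  rw [← AlgHom.range_eq_top, ← top_le_iff, ← hx]
  apply Algebra.adjoin_le
  rintro _ rfl
  refine ⟨MonoidAlgebra.of R G g₀, ?_⟩
  have : χ.rangeRestrict g₀ = t := rfl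
  simp [f, this, hθ]

theorem aux_mem_span {S : Type*} [CommRing S] {e : S} (he : IsIdempotentElem e)
    {a : S} (ha : a ∈ Ideal.span {e}) : a * e = a := by
  obtain ⟨c, rfl⟩ := Ideal.mem_span_singleton'.1 ha
  rw [mul_assoc, he.eq]

/-- projection onto the ideal generated by an idempotent -/
noncomputable def auxProj (R : Type*) {S : Type*} [CommRing R] [CommRing S] [Algebra R S] (e : S) :
    S →ₗ[R] (Ideal.span {e} : Ideal S) :=
  (LinearMap.toSpanSingleton S (Ideal.span {e} : Ideal S)
    ⟨e, Ideal.mem_span_singleton_self e⟩).restrictScalars R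

theorem auxProj_coe (R : Type*) {S : Type*} [CommRing R] [CommRing S] [Algebra R S] (e s : S) :
    ((auxProj R e s : (Ideal.span {e} : Ideal S)) : S) = s * e := by
  simp [auxProj]

theorem aux_span_finite {R S : Type*} [CommRing R] [CommRing S] [Algebra R S]
    [Module.Finite R S] {e : S} (he : IsIdempotentElem e) :
    Module.Finite R (Ideal.span {e} : Ideal S) := by
  refine Module.Finite.of_surjective (auxProj R e) ?_
  rintro ⟨a, ha⟩
  exact ⟨a, Subtype.ext (by rw [auxProj_coe, aux_mem_span he ha])⟩

theorem aux_span_free {R S : Type*} [CommRing R] [IsLocalRing R] [CommRing S] [Algebra R S]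
    [Module.Finite R S] [Module.Free R S] {e : S} (he : IsIdempotentElem e) :
    Module.Free R (Ideal.span {e} : Ideal S) := by
  have := aux_span_finite (R := R) he
  have : Module.Projective R (Ideal.span {e} : Ideal S) := by
    refine Module.Projective.of_split
      ((Submodule.subtype (Ideal.span {e} : Ideal S)).restrictScalars R) (auxProj R e) ?_
    ext ⟨a, ha⟩
    simp [auxProj_coe, aux_mem_span he ha]
  exact Module.free_of_flat_of_isLocalRing

theorem aux_span_poly {R S : Type*} [CommRing R] [IsLocalRing R] [CommRing S] [Algebra R S]
    [Module.Finite R S] [Module.Free R S] {e : S} (he : IsIdempotentElem e) (x : S) :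
    ∃ g : R[X], g.Monic ∧ g.natDegree = Module.finrank R (Ideal.span {e} : Ideal S) ∧
      aeval x g * e = 0 := by
  have := aux_span_finite (R := R) he
  have := aux_span_free (R := R) he
  refine ⟨LinearMap.charpoly (Algebra.lsmul R R (Ideal.span {e} : Ideal S) x),
    LinearMap.charpoly_monic _, LinearMap.charpoly_natDegree _, ?_⟩
  have h := LinearMap.aeval_self_charpoly (Algebra.lsmul R R (Ideal.span {e} : Ideal S) x)
  rw [aeval_algHom_apply] at h
  have := congrArg (fun f => ((f ⟨e, Ideal.mem_span_singleton_self e⟩ :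
    (Ideal.span {e} : Ideal S)) : S)) h
  simpa using this

theorem aux_span_rank {R S : Type*} [CommRing R] [IsLocalRing R] [CommRing S] [Algebra R S]
    [Module.Finite R S] [Module.Free R S] {e : S} (he : IsIdempotentElem e) :
    Module.finrank R (Ideal.span {e} : Ideal S) +
      Module.finrank R (Ideal.span {1 - e} : Ideal S) = Module.finrank R S := by
  have := aux_span_finite (R := R) he
  have := aux_span_free (R := R) he
  have := aux_span_finite (R := R) he.one_sub
  have := aux_span_free (R := R) he.one_sub
  rw [← Module.finrank_prod]
  symm
  refine LinearEquiv.finrank_eq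
    (LinearEquiv.ofBijective ((auxProj R e).prod (auxProj R (1 - e))) ⟨?_, ?_⟩)
  · rw [← LinearMap.ker_eq_bot, LinearMap.ker_eq_bot']
    intro s hs
    have h1 := congrArg (fun p => (p.1 : S)) hs
    have h2 := congrArg (fun p => (p.2 : S)) hs
    change ((auxProj R e s : (Ideal.span {e} : Ideal S)) : S) = 0 at h1
    change ((auxProj R (1 - e) s : (Ideal.span {1 - e} : Ideal S)) : S) = 0 at h2
    rw [auxProj_coe] at h1 h2
    linear_combination h1 + h2
  · rintro ⟨⟨a, ha⟩, ⟨b, hb⟩⟩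
    have ha' := aux_mem_span he ha
    have hb' := aux_mem_span he.one_sub hb
    refine ⟨a + b, Prod.ext (Subtype.ext ?_) (Subtype.ext ?_)⟩
    · change ((auxProj R e (a + b) : (Ideal.span {e} : Ideal S)) : S) = a
      rw [auxProj_coe]
      linear_combination ha' - hb'
    · change ((auxProj R (1 - e) (a + b) : (Ideal.span {1 - e} : Ideal S)) : S) = b
      rw [auxProj_coe]
      linear_combination hb' - ha'

theorem aux_span_zero {R S : Type*} [CommRing R] [IsLocalRing R] [CommRing S] [Algebra R S]
    [Module.Finite R S] [Module.Free R S] {e : S} (x : S)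
    {g : R[X]} (hg : g.Monic) (hge : aeval x g * e = 0) (hu : IsUnit g) : e = 0 := by
  rw [hg.isUnit_iff] at hu
  simpa [hu] using hge

theorem aux_idem {R : Type*} [CommRing R] [IsLocalRing R] {φ : R[X]} (hm : φ.Monic)
    (hi : Irreducible φ) (e : AdjoinRoot φ) (he : IsIdempotentElem e) : e = 0 ∨ e = 1 := by
  have := hm.free_adjoinRoot
  have := hm.finite_adjoinRoot
  obtain ⟨g, hg, hgd, hge⟩ := aux_span_poly (R := R) he (AdjoinRoot.root φ)
  obtain ⟨h, hh, hhd, hhe⟩ := aux_span_poly (R := R) he.one_sub (AdjoinRoot.root φ)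
  have hr := aux_span_rank (R := R) he
  rw [← hgd, ← hhd, aux_finrank hm] at hr
  have hdvd : φ ∣ g * h := by
    rw [← AdjoinRoot.mk_eq_zero, ← AdjoinRoot.aeval_eq, map_mul]
    linear_combination aeval (AdjoinRoot.root φ) h * hge + aeval (AdjoinRoot.root φ) g * hhe
  have heq : g * h = φ := eq_of_monic_of_dvd_of_natDegree_le hm (hg.mul hh) hdvd
    (by rw [hg.natDegree_mul hh, hr])
  rcases hi.isUnit_or_isUnit heq.symm with hu | hu
  · left; exact aux_span_zero _ hg hge hu
  · right
    have := aux_span_zero _ hh hhe hu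
    exact (sub_eq_zero.1 this).symm

theorem aux_local {R : Type*} [CommRing R] [IsDomain R] [IsLocalRing R] {φ : R[X]} (hm : φ.Monic)
    (hi : Irreducible (φ.map (residue R))) : IsLocalRing (AdjoinRoot φ) := by
  have := hm.finite_adjoinRoot
  have hnt : Nontrivial (AdjoinRoot φ) := by
    have hd : φ.degree ≠ 0 := by
      rw [← hm.degree_map (residue R)]
      exact (degree_pos_of_irreducible hi).ne'
    exact AdjoinRoot.nontrivial φ hd
  have key : ∀ M N : Ideal (AdjoinRoot φ), M.IsMaximal → N.IsMaximal → M ≤ N := by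
    intro M N hM hN x hx
    obtain ⟨F, rfl⟩ := AdjoinRoot.mk_surjective x
    rw [← AdjoinRoot.aeval_eq] at hx ⊢
    have hφ0 : aeval (AdjoinRoot.root φ) φ = 0 := by simp
    rcases hi.isCoprime_or_dvd (F.map (residue R)) with h | h
    · obtain ⟨u, v, huv⟩ := h
      obtain ⟨u, rfl⟩ := Polynomial.map_surjective (residue R) residue_surjective u
      obtain ⟨v, rfl⟩ := Polynomial.map_surjective (residue R) residue_surjective v
      have h1 : (1 - (u * φ + v * F)).map (residue R) = 0 := by
        simp [huv]
      have h2 := aux_small hM (AdjoinRoot.root φ) h1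
      simp only [map_sub, map_add, map_mul, map_one, hφ0, mul_zero, zero_add] at h2
      have h3 := M.add_mem h2 (M.mul_mem_left (aeval (AdjoinRoot.root φ) v) hx)
      rw [sub_add_cancel] at h3
      exact absurd ((Ideal.eq_top_iff_one _).2 h3) hM.ne_top
    · obtain ⟨H, hH⟩ := h
      obtain ⟨H, rfl⟩ := Polynomial.map_surjective (residue R) residue_surjective H
      have h1 : (F - φ * H).map (residue R) = 0 := by
        simp [hH]
      have h2 := aux_small hN (AdjoinRoot.root φ) h1
      simpa only [map_sub, map_mul, hφ0, zero_mul, sub_zero] using h2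
  obtain ⟨M, hM⟩ := Ideal.exists_maximal (AdjoinRoot φ)
  exact IsLocalRing.of_unique_max_ideal ⟨M, hM, fun N hN =>
    le_antisymm (key N M hN hM) (key M N hM hN)⟩

theorem aux_unit {R : Type*} [CommRing R] [IsLocalRing R] {φ P : R[X]} {g h : (ResidueField R)[X]}
    (hgh : φ.map (residue R) = g * h) (hP : P.map (residue R) = g)
    (hu : IsUnit (AdjoinRoot.mk φ P)) : IsUnit g := by
  obtain ⟨y, hy⟩ := hu.exists_right_inv
  obtain ⟨Y, rfl⟩ := AdjoinRoot.mk_surjective y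
  rw [← map_mul, ← sub_eq_zero, ← map_one (AdjoinRoot.mk φ), ← map_sub, AdjoinRoot.mk_eq_zero] at hy
  obtain ⟨c, hc⟩ := hy
  have h1 := congrArg (Polynomial.map (residue R)) hc
  simp only [Polynomial.map_sub, Polynomial.map_mul, hP, Polynomial.map_one, hgh] at h1
  refine IsUnit.of_mul_eq_one (Y.map (residue R) - h * c.map (residue R)) ?_
  linear_combination h1

theorem aux_irr_of_local {R : Type*} [CommRing R] [IsLocalRing R] {φ : R[X]} (hm : φ.Monic)
    (hnu : ¬ IsUnit φ) [IsLocalRing (AdjoinRoot φ)]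
    (hs : (φ.map (residue R)).Separable) : Irreducible (φ.map (residue R)) := by
  have := hm.finite_adjoinRoot
  refine ⟨fun hu => hnu ?_, fun g h hgh => ?_⟩
  · have h1 := (hm.map (residue R)).isUnit_iff.1 hu
    have h2 : φ.natDegree = 0 := by rw [← hm.natDegree_map (residue R), h1, natDegree_one]
    rw [hm.natDegree_eq_zero.1 h2]
    exact isUnit_one
  · rw [hgh] at hs
    obtain ⟨u, v, huv⟩ := hs.isCoprime
    obtain ⟨P, hP⟩ := Polynomial.map_surjective (residue R) residue_surjective g
    obtain ⟨Q, hQ⟩ := Polynomial.map_surjective (residue R) residue_surjective h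
    obtain ⟨u, rfl⟩ := Polynomial.map_surjective (residue R) residue_surjective u
    obtain ⟨v, rfl⟩ := Polynomial.map_surjective (residue R) residue_surjective v
    have h1 : (1 - (u * P + v * Q)).map (residue R) = 0 := by
      simp [huv, hP, hQ]
    have h2 := aux_small (maximalIdeal.isMaximal (AdjoinRoot φ)) (AdjoinRoot.root φ) h1
    rw [AdjoinRoot.aeval_eq] at h2
    by_contra hcon
    push Not at hcon
    have hPn : AdjoinRoot.mk φ P ∈ maximalIdeal (AdjoinRoot φ) :=
      (mem_maximalIdeal _).2 fun hu => hcon.1 (aux_unit hgh hP hu)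
    have hQn : AdjoinRoot.mk φ Q ∈ maximalIdeal (AdjoinRoot φ) :=
      (mem_maximalIdeal _).2 fun hu => hcon.2 (aux_unit (hgh.trans (mul_comm g h)) hQ hu)
    refine (maximalIdeal.isMaximal (AdjoinRoot φ)).ne_top ((Ideal.eq_top_iff_one _).2 ?_)
    have h3 := Ideal.add_mem _ h2 (Ideal.add_mem _ (Ideal.mul_mem_left _ (AdjoinRoot.mk φ u) hPn)
      (Ideal.mul_mem_left _ (AdjoinRoot.mk φ v) hQn))
    simp at h3

theorem aux_part_one {R : Type*} [CommRing R] [IsDomain R] [IsLocalRing R] [Finite (ResidueField R)]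
    {d : ℕ} (hd : IsUnit (d : R)) {φ : R[X]} (hm : φ.Monic) (hi : Irreducible φ)
    (hdvd : φ ∣ cyclotomic d R) :
    IsCleanRing (AdjoinRoot φ) ↔
      φ.natDegree = orderOf ((Nat.card (ResidueField R) : ZMod d)) := by
  have hdk : (d : ResidueField R) ≠ 0 := by
    have := (hd.map (residue R)).ne_zero
    simpa using this
  have : NeZero (d : ResidueField R) := ⟨hdk⟩
  have hdv : φ.map (residue R) ∣ cyclotomic d (ResidueField R) := by
    have := Polynomial.map_dvd (residue R) hdvd
    rwa [map_cyclotomic] at this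
  constructor
  · intro hc
    have hnt : Nontrivial (AdjoinRoot φ) := by
      refine AdjoinRoot.nontrivial φ fun h => hi.not_isUnit ?_
      rw [hm.natDegree_eq_zero.1 (natDegree_eq_zero_iff_degree_le_zero.2 h.le)]
      exact isUnit_one
    have hl := aux_local_of_clean hc (aux_idem hm hi)
    have hirr := aux_irr_of_local hm hi.not_isUnit
      ((separable_cyclotomic d (ResidueField R)).of_dvd hdv)
    rw [← aux_deg hdk hdv hirr, hm.natDegree_map]
  · intro h
    have hirr := aux_irr hdk hdv (by rw [hm.natDegree_map, h])
    have := aux_local hm hirr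
    exact aux_clean_local

/-- Let `(R, 𝔪)` be a commutative local domain with finite residue field, `G` a finite
abelian group whose exponent `n` is a unit in `R`, and for each divisor `d` of `n` let
`φd d` be a monic irreducible divisor of the `d`-th cyclotomic polynomial over `R`.
Then (i) `R[x]/(φd d)` is clean iff `deg (φd d) = ord_d |R/𝔪|`, and
(ii) `R[G]` is clean iff `deg (φd d) = ord_d |R/𝔪|` for all divisors `d` of `n`. -/
theorem clean_quotient_and_clean_monoidAlgebra_iff
    (R : Type*) [CommRing R] [IsDomain R] [IsLocalRing R]
    [Finite (IsLocalRing.ResidueField R)]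
    (G : Type*) [CommGroup G] [Fintype G]
    (n : ℕ) (hn : Monoid.exponent G = n) (hu : IsUnit (n : R))
    (φd : ℕ → Polynomial R)
    (hφ : ∀ d, d ∣ n → (φd d).Monic ∧ Irreducible (φd d) ∧ φd d ∣ Polynomial.cyclotomic d R) :
    (∀ d, d ∣ n →
      (IsCleanRing (Polynomial R ⧸ Ideal.span {φd d}) ↔
        (φd d).natDegree = orderOf ((Nat.card (IsLocalRing.ResidueField R) : ZMod d)))) ∧
    (IsCleanRing (MonoidAlgebra R G) ↔
      ∀ d, d ∣ n →
        (φd d).natDegree = orderOf ((Nat.card (IsLocalRing.ResidueField R) : ZMod d))) := by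
  have hdu : ∀ d, d ∣ n → IsUnit ((d : ℕ) : R) := fun d hd =>
    isUnit_of_dvd_unit (Nat.cast_dvd_cast hd) hu
  have h1 : ∀ d, d ∣ n → (IsCleanRing (AdjoinRoot (φd d)) ↔
        (φd d).natDegree = orderOf ((Nat.card (IsLocalRing.ResidueField R) : ZMod d))) :=
    fun d hd => aux_part_one (hdu d hd) (hφ d hd).1 (hφ d hd).2.1 (hφ d hd).2.2
  refine ⟨h1, fun hc d hd => ?_, fun h => ?_⟩
  · rw [← h1 d hd]
    obtain ⟨f, hf⟩ := aux_surj (R := R) (G := G) (AdjoinRoot.adjoinRoot_eq_top (f := φd d)) (by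
      have h2 : φd d ∣ X ^ n - 1 := by
        refine ((hφ d hd).2.2.trans (cyclotomic.dvd_X_pow_sub_one d R)).trans ?_
        obtain ⟨c, rfl⟩ := hd
        rw [pow_mul]
        exact sub_one_dvd_pow_sub_one _ _
      have h3 := AdjoinRoot.mk_eq_zero.2 h2
      simp only [map_sub, map_pow, AdjoinRoot.mk_X, map_one] at h3
      rw [hn]
      exact sub_eq_zero.1 h3)
    exact aux_clean_image f.toRingHom hf hc
  · exact aux_group_clean hu (fun g => hn ▸ Monoid.pow_exponent_eq_one g)
      fun d hd => ⟨φd d, (hφ d hd).1, (hφ d hd).2.2, h d hd⟩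
end

section
/- Let (R, 𝔪) be a commutative local domain whose residue field R/𝔪 is finite, let G be a finite abelian group whose exponent n is a unit in R, assume 2 is a unit in R, and for each divisor d of n let φ_d(x) be a monic irreducible divisor of the d-th cyclotomic polynomial Φ_d(x) over R. Then: (i) for each divisor d of n, the ring R[x]/(φ_d(x)) is feebly clean but not clean if and only if deg(φ_d(x)) = 2·ord_d(|R/𝔪|); and (ii) the group ring R[G] is feebly clean if and only if deg(φ_d(x)) ≤ 2·ord_d(|R/𝔪|) for all divisors d of n. -/
/-- A ring is *feebly clean* if every element can be written as `u + e₁ - e₂` with `u`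
a unit and `e₁`, `e₂` orthogonal idempotents. -/
def IsFeeblyCleanRing (R : Type*) [Ring R] : Prop :=
  ∀ r : R, ∃ u e₁ e₂ : R, IsUnit u ∧ IsIdempotentElem e₁ ∧ IsIdempotentElem e₂ ∧
    e₁ * e₂ = 0 ∧ r = u + e₁ - e₂

section
open Polynomial


lemma FC.finite_span {R A : Type*} [CommRing R] [CommRing A] [Algebra R A] [Module.Finite R A] (e : A) :
    Module.Finite R (Ideal.span {e} : Ideal A) := by
  let f : A →ₗ[R] (Ideal.span {e} : Ideal A) :=
    (LinearMap.mulRight R e).codRestrict ((Ideal.span {e} : Ideal A).restrictScalars R)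
      (fun c => by simpa using Ideal.mul_mem_left _ c (Ideal.mem_span_singleton_self e))
  refine Module.Finite.of_surjective f ?_
  rintro ⟨y, hy⟩
  obtain ⟨a, rfl⟩ := Ideal.mem_span_singleton'.1 hy
  exact ⟨a, rfl⟩

lemma FC.free_span {R A : Type*} [CommRing R] [IsLocalRing R] [CommRing A] [Algebra R A]
    [Module.Finite R A] [Module.Free R A] (e : A) (he : e * e = e) :
    Module.Free R (Ideal.span {e} : Ideal A) := by
  have := FC.finite_span (R := R) e
  let f : A →ₗ[R] (Ideal.span {e} : Ideal A) :=
    (LinearMap.mulRight R e).codRestrict ((Ideal.span {e} : Ideal A).restrictScalars R)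
      (fun c => by simpa using Ideal.mul_mem_left _ c (Ideal.mem_span_singleton_self e))
  have : Module.Projective R (Ideal.span {e} : Ideal A) := by
    refine Module.Projective.of_split (((Ideal.span {e} : Ideal A).restrictScalars R).subtype) f ?_
    ext ⟨y, hy⟩
    obtain ⟨a, rfl⟩ := Ideal.mem_span_singleton'.1 hy
    change a * e * e = a * e
    rw [mul_assoc, he]
  exact Module.free_of_flat_of_isLocalRing

lemma FC.finrank_add {R A : Type*} [CommRing R] [IsDomain R] [CommRing A] [Algebra R A]
    [Module.Finite R A] (f g : A) (hf : f * f = f) (hg : g * g = g) (hfg : f * g = 0) :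
    Module.finrank R (Ideal.span {f + g} : Ideal A) =
      Module.finrank R (Ideal.span {f} : Ideal A) + Module.finrank R (Ideal.span {g} : Ideal A) := by
  have := FC.finite_span (R := R) f
  have := FC.finite_span (R := R) g
  have := FC.finite_span (R := R) (f + g)
  have h := Submodule.rank_sup_add_rank_inf_eq ((Ideal.span {f} : Ideal A).restrictScalars R)
    ((Ideal.span {g} : Ideal A).restrictScalars R)
  have h1 : ((Ideal.span {f} : Ideal A).restrictScalars R) ⊓
    ((Ideal.span {g} : Ideal A).restrictScalars R) = ⊥ := by
    rw [eq_bot_iff]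
    rintro x ⟨hx, hx'⟩
    obtain ⟨a, rfl⟩ := Ideal.mem_span_singleton'.1 hx
    obtain ⟨b, hb⟩ := Ideal.mem_span_singleton'.1 hx'
    simp only [Submodule.mem_bot]
    linear_combination -a * hf - f * hb + b * hfg
  have h2 : ((Ideal.span {f} : Ideal A).restrictScalars R) ⊔
    ((Ideal.span {g} : Ideal A).restrictScalars R) = (Ideal.span {f+g} : Ideal A).restrictScalars R := by
    apply le_antisymm
    · apply sup_le
      · rintro x hx
        obtain ⟨a, rfl⟩ := Ideal.mem_span_singleton'.1 hx
        exact Ideal.mem_span_singleton'.2 ⟨a * f, by linear_combination a * hf + a * hfg⟩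
      · rintro x hx
        obtain ⟨a, rfl⟩ := Ideal.mem_span_singleton'.1 hx
        exact Ideal.mem_span_singleton'.2 ⟨a * g, by linear_combination a * hg + a * hfg⟩
    · rintro x hx
      obtain ⟨a, rfl⟩ := Ideal.mem_span_singleton'.1 hx
      rw [mul_add]
      exact Submodule.add_mem_sup (Ideal.mem_span_singleton'.2 ⟨a, rfl⟩)
        (Ideal.mem_span_singleton'.2 ⟨a, rfl⟩)
  rw [h1, h2, rank_bot, add_zero] at h
  change Module.rank R (Ideal.span {f + g} : Ideal A) = Module.rank R (Ideal.span {f} : Ideal A) +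
    Module.rank R (Ideal.span {g} : Ideal A) at h
  rw [← Module.finrank_eq_rank, ← Module.finrank_eq_rank, ← Module.finrank_eq_rank] at h
  exact_mod_cast h

lemma FC.charpoly_kill {R A : Type*} [CommRing R] [IsDomain R] [IsLocalRing R] [CommRing A] [Algebra R A]
    [Module.Finite R A] [Module.Free R A] (x e : A) (he : e * e = e) :
    ∃ p : R[X], p.Monic ∧ p.natDegree = Module.finrank R (Ideal.span {e} : Ideal A) ∧
      aeval x p * e = 0 := by
  have := FC.finite_span (R := R) e
  have := FC.free_span (R := R) e he
  let F : A →ₐ[R] Module.End R (Ideal.span {e} : Ideal A) := Algebra.lsmul R R _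
  refine ⟨(F x).charpoly, LinearMap.charpoly_monic _, LinearMap.charpoly_natDegree _, ?_⟩
  have h := LinearMap.aeval_self_charpoly (F x)
  rw [Polynomial.aeval_algHom_apply] at h
  have := congrArg Subtype.val (LinearMap.congr_fun h ⟨e, Ideal.mem_span_singleton_self e⟩)
  simpa [F] using this

lemma FC.span_eq_zero {R A : Type*} [CommRing R] [IsDomain R] [IsLocalRing R] [CommRing A] [Algebra R A]
    [Module.Finite R A] [Module.Free R A] (e : A) (he : e * e = e)
    (h : Module.finrank R (Ideal.span {e} : Ideal A) = 0) : e = 0 := by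
  have := FC.finite_span (R := R) e
  have := FC.free_span (R := R) e he
  have := (Module.finrank_eq_zero_iff_of_free R _).1 h
  simpa using congrArg Subtype.val (Subsingleton.elim (⟨e, Ideal.mem_span_singleton_self e⟩ : (Ideal.span {e} : Ideal A)) 0)

lemma FC.connected {R : Type*} [CommRing R] [IsDomain R] [IsLocalRing R] (φ : R[X]) (hm : φ.Monic)
    (hi : Irreducible φ) (e : R[X] ⧸ Ideal.span {φ}) (he : e * e = e) : e = 0 ∨ e = 1 := by
  have := hm.free_quotient
  have := hm.finite_quotient
  set x : R[X] ⧸ Ideal.span {φ} := Ideal.Quotient.mk _ X with hx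
  have hae : ∀ p : R[X], aeval x p = Ideal.Quotient.mk _ p := by
    intro p
    have : (aeval x : R[X] →ₐ[R] _) = Ideal.Quotient.mkₐ R (Ideal.span {φ}) := by
      ext; simp [x]
    rw [this]; rfl
  have he' : (1 - e) * (1 - e) = 1 - e := by linear_combination he
  obtain ⟨p, hp, hpd, hp0⟩ := FC.charpoly_kill (R := R) x e he
  obtain ⟨q, hq, hqd, hq0⟩ := FC.charpoly_kill (R := R) x (1 - e) he'
  have hadd := FC.finrank_add (R := R) e (1 - e) he he' (by linear_combination -he)
  have hdeg : Module.finrank R (Ideal.span {e + (1 - e)} : Ideal (R[X] ⧸ Ideal.span {φ})) = φ.natDegree := by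
    rw [add_sub_cancel, Ideal.span_singleton_one]
    rw [show Module.finrank R (⊤ : Ideal (R[X] ⧸ Ideal.span {φ})) = Module.finrank R (R[X] ⧸ Ideal.span {φ}) from
      (Submodule.topEquiv (R := R)).finrank_eq]
    exact (AdjoinRoot.powerBasis' hm).finrank
  have hdvd : φ ∣ p * q := by
    rw [← Ideal.mem_span_singleton, ← Ideal.Quotient.eq_zero_iff_mem, ← hae, map_mul]
    linear_combination (aeval x q) * hp0 + (aeval x p) * hq0
  have heq : φ = p * q := by
    refine (Polynomial.eq_of_monic_of_dvd_of_natDegree_le hm (hp.mul hq) hdvd ?_).symm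
    rw [hp.natDegree_mul hq]; omega
  rcases hi.isUnit_or_isUnit heq with h | h
  · left
    apply FC.span_eq_zero (R := R) e he
    rw [← hpd, hp.eq_one_of_isUnit h, natDegree_one]
  · right
    have := FC.span_eq_zero (R := R) (1 - e) he' (by rw [← hqd, hq.eq_one_of_isUnit h, natDegree_one])
    linear_combination -this

lemma FC.isUnit_iff {R : Type*} [CommRing R] [IsLocalRing R] (φ : R[X]) (hm : φ.Monic) (p : R[X]) :
    IsUnit (Ideal.Quotient.mk (Ideal.span {φ}) p) ↔
      IsCoprime (φ.map (IsLocalRing.residue R)) (p.map (IsLocalRing.residue R)) := by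
  constructor
  · intro h
    obtain ⟨b, hb⟩ := isUnit_iff_exists_inv.1 h
    obtain ⟨q, rfl⟩ := Ideal.Quotient.mk_surjective b
    rw [← map_mul, ← map_one (Ideal.Quotient.mk _), Ideal.Quotient.eq, Ideal.mem_span_singleton'] at hb
    obtain ⟨a, ha⟩ := hb
    have := congrArg (Polynomial.map (IsLocalRing.residue R)) ha
    simp only [Polynomial.map_mul, Polynomial.map_sub, Polynomial.map_one] at this
    exact ⟨-a.map _, q.map _, by linear_combination -this⟩
  · intro h
    by_contra hn
    obtain ⟨M, hM, hpM⟩ := exists_max_ideal_of_mem_nonunits hn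
    have := hm.finite_quotient
    have hc := Ideal.isMaximal_comap_of_isIntegral_of_isMaximal (R := R) M
    have hc' := IsLocalRing.eq_maximalIdeal hc
    let F : R →+* (R[X] ⧸ Ideal.span {φ}) ⧸ M := (Ideal.Quotient.mk M).comp (algebraMap R _)
    let k : IsLocalRing.ResidueField R →+* (R[X] ⧸ Ideal.span {φ}) ⧸ M :=
      Ideal.Quotient.lift (IsLocalRing.maximalIdeal R) F (by
        intro a ha
        rw [← hc'] at ha
        exact Ideal.Quotient.eq_zero_iff_mem.2 ha)
    have hk : k.comp (IsLocalRing.residue R) = F := by ext a; rfl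
    let E := eval₂RingHom k (Ideal.Quotient.mk M (Ideal.Quotient.mk (Ideal.span {φ}) X))
    have key : ∀ q : R[X], E (q.map (IsLocalRing.residue R))
        = Ideal.Quotient.mk M (Ideal.Quotient.mk _ q) := by
      intro q
      change eval₂ k _ _ = _
      rw [eval₂_map, hk]
      have : (eval₂RingHom F (Ideal.Quotient.mk M (Ideal.Quotient.mk _ X))) =
        (Ideal.Quotient.mk M).comp (Ideal.Quotient.mk (Ideal.span {φ})) := by
        ext <;> simp [F]; rfl
      exact RingHom.congr_fun this q
    obtain ⟨a, b, hab⟩ := h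
    have := congrArg E hab
    rw [map_add, map_mul, map_mul, key, key, map_one, Ideal.Quotient.eq_zero_iff_mem.2 hpM,
      Ideal.Quotient.eq_zero_iff_mem.2 (Ideal.mem_span_singleton_self φ)] at this
    simp at this

lemma FC.map_feebly {A B : Type*} [Ring A] [Ring B] (f : A →+* B) (hf : Function.Surjective f)
    (h : IsFeeblyCleanRing A) : IsFeeblyCleanRing B := by
  intro r
  obtain ⟨a, rfl⟩ := hf r
  obtain ⟨u, e, e', hu, he, he', h0, h1⟩ := h a
  refine ⟨f u, f e, f e', hu.map f, he.map f, he'.map f, by rw [← map_mul, h0, map_zero], ?_⟩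
  rw [h1]; simp

lemma FC.clean_iff {A : Type*} [CommRing A] (hc : ∀ e : A, e * e = e → e = 0 ∨ e = 1) :
    IsCleanRing A ↔ ∀ r : A, IsUnit r ∨ IsUnit (r - 1) := by
  constructor
  · intro h r
    obtain ⟨u, e, hu, he, rfl⟩ := h r
    rcases hc e he with rfl | rfl
    · left; simpa using hu
    · right; simpa using hu
  · intro h r
    rcases h r with h | h
    · exact ⟨r, 0, h, IsIdempotentElem.zero, by simp⟩
    · exact ⟨r - 1, 1, h, IsIdempotentElem.one, by simp⟩

lemma FC.feebly_iff {A : Type*} [CommRing A] (hc : ∀ e : A, e * e = e → e = 0 ∨ e = 1) :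
    IsFeeblyCleanRing A ↔ ∀ r : A, IsUnit r ∨ IsUnit (r - 1) ∨ IsUnit (r + 1) := by
  constructor
  · intro h r
    obtain ⟨u, e, e', hu, he, he', h0, rfl⟩ := h r
    rcases hc e he with rfl | rfl <;> rcases hc e' he' with rfl | rfl
    · left; simpa using hu
    · right; right; simpa using hu
    · right; left; simpa using hu
    · left; simpa using hu
  · intro h r
    rcases h r with h | h | h
    · exact ⟨r, 0, 0, h, IsIdempotentElem.zero, IsIdempotentElem.zero, by simp, by simp⟩
    · exact ⟨r - 1, 1, 0, h, IsIdempotentElem.one, IsIdempotentElem.zero, by simp, by simp⟩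
    · exact ⟨r + 1, 0, 1, h, IsIdempotentElem.zero, IsIdempotentElem.one, by simp, by simp⟩

lemma FC.order_card {K : Type*} [Field K] [Finite K] (d : ℕ) (hd : (d : K) ≠ 0) (P : K[X])
    (hP : P ∣ cyclotomic d K) :
    0 < orderOf (Nat.card K : ZMod d) ∧ ∃ F : Finset K[X], (∀ f ∈ F, Prime f ∧ f ∣ P) ∧
      (∀ p : K[X], ¬ IsCoprime P p → ∃ f ∈ F, f ∣ p) ∧
      (∀ f ∈ F, ∀ g ∈ F, f ≠ g → IsCoprime f g) ∧
      P.natDegree = F.card * orderOf (Nat.card K : ZMod d) := by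
  classical
  have := Fintype.ofFinite K
  obtain ⟨p, hp⟩ := CharP.exists K
  have : Fact p.Prime := ⟨CharP.char_is_prime K p⟩
  obtain ⟨f, hpp, hf⟩ := FiniteField.card K p
  have hcop : p.Coprime d := by
    rw [Nat.Prime.coprime_iff_not_dvd Fact.out]
    rwa [Ne, CharP.cast_eq_zero_iff K p] at hd
  rw [← Nat.card_eq_fintype_card] at hf
  have hord : orderOf (ZMod.unitOfCoprime _ (hcop.pow_left (f : ℕ))) = orderOf (Nat.card K : ZMod d) := by
    rw [← orderOf_units, ZMod.coe_unitOfCoprime, hf]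
  have hd0 : d ≠ 0 := by rintro rfl; simp at hd
  have : NeZero d := ⟨hd0⟩
  have hP0 : P ≠ 0 := ne_zero_of_dvd_ne_zero (cyclotomic_ne_zero d K) hP
  have hsep : P.Separable := by
    have : NeZero (d : K) := ⟨hd⟩
    exact (separable_cyclotomic d K).of_dvd hP
  have hnodup := (UniqueFactorizationMonoid.squarefree_iff_nodup_normalizedFactors hP0).1 hsep.squarefree
  refine ⟨?_, (UniqueFactorizationMonoid.normalizedFactors P).toFinset, ?_, ?_, ?_, ?_⟩
  · rw [← hord]; exact orderOf_pos _
  · intro g hg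
    rw [Multiset.mem_toFinset] at hg
    exact ⟨UniqueFactorizationMonoid.prime_of_normalized_factor g hg,
      UniqueFactorizationMonoid.dvd_of_mem_normalizedFactors hg⟩
  · intro q hq
    rw [← EuclideanDomain.gcd_isUnit_iff] at hq
    have hg0 : EuclideanDomain.gcd P q ≠ 0 := by
      intro h
      exact hP0 (EuclideanDomain.gcd_eq_zero_iff.1 h).1
    obtain ⟨g, hg, hgd⟩ := WfDvdMonoid.exists_irreducible_factor hq hg0
    obtain ⟨g', hg', ha⟩ := UniqueFactorizationMonoid.exists_mem_normalizedFactors_of_dvd hP0 hg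
      (hgd.trans (EuclideanDomain.gcd_dvd_left _ _))
    exact ⟨g', Multiset.mem_toFinset.2 hg', ha.symm.dvd.trans (hgd.trans (EuclideanDomain.gcd_dvd_right _ _))⟩
  · intro g hg g' hg' hne
    rw [Multiset.mem_toFinset] at hg hg'
    have h1 := UniqueFactorizationMonoid.prime_of_normalized_factor g hg
    have h2 := UniqueFactorizationMonoid.prime_of_normalized_factor g' hg'
    by_cases h : g ∣ g'
    swap
    · exact h1.irreducible.coprime_iff_not_dvd.2 h
    · exfalso
      apply hne
      have := h1.irreducible.associated_of_dvd h2.irreducible h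
      rw [← UniqueFactorizationMonoid.normalize_normalized_factor g hg,
        ← UniqueFactorizationMonoid.normalize_normalized_factor g' hg']
      exact normalize_eq_normalize_iff_associated.2 this
  · rw [Multiset.toFinset_card_of_nodup hnodup]
    have H := natDegree_eq_of_degree_eq <| degree_eq_degree_of_associated
      (UniqueFactorizationMonoid.prod_normalizedFactors hP0)
    have hall : ∀ g ∈ UniqueFactorizationMonoid.normalizedFactors P,
        g.natDegree = orderOf (Nat.card K : ZMod d) := by
      intro g hg
      rw [← hord]
      exact natDegree_of_dvd_cyclotomic_of_irreducible (by rw [← Nat.card_eq_fintype_card]; exact hf) hcop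
        ((UniqueFactorizationMonoid.dvd_of_mem_normalizedFactors hg).trans hP)
        (UniqueFactorizationMonoid.irreducible_of_normalized_factor g hg)
    rw [natDegree_multiset_prod _ (UniqueFactorizationMonoid.zero_notMem_normalizedFactors _),
      Multiset.map_congr rfl hall] at H
    rw [← H]; simp

lemma FC.clean_card {K : Type*} [Field K] (P : K[X]) (F : Finset K[X])
    (hF : ∀ f ∈ F, Prime f ∧ f ∣ P) (hF2 : ∀ p : K[X], ¬ IsCoprime P p → ∃ f ∈ F, f ∣ p)
    (hF3 : ∀ f ∈ F, ∀ g ∈ F, f ≠ g → IsCoprime f g) :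
    (∀ p, IsCoprime P p ∨ IsCoprime P (p - 1)) ↔ F.card ≤ 1 := by
  have hn : ∀ f ∈ F, ∀ p, f ∣ p → ¬ IsCoprime P p := fun f hf p hp hc =>
    (hF f hf).1.not_isUnit (hc.isUnit_of_dvd' (hF f hf).2 hp)
  constructor
  · intro h
    by_contra! hc
    obtain ⟨f, hf, g, hg, hfg⟩ := Finset.one_lt_card.1 hc
    obtain ⟨a, b, hab⟩ := hF3 f hf g hg hfg
    rcases h (a * f) with h | h
    · exact hn f hf _ (dvd_mul_left _ _) h
    · exact hn g hg _ ⟨-b, by linear_combination hab⟩ h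
  · intro h p
    by_contra! hc
    obtain ⟨f, hf, hfp⟩ := hF2 _ hc.1
    obtain ⟨g, hg, hgp⟩ := hF2 _ hc.2
    rw [Finset.card_le_one.1 h g hg f hf] at hgp
    exact (hF f hf).1.not_isUnit (isUnit_of_dvd_one (by simpa using dvd_sub hfp hgp))

lemma FC.feebly_card {K : Type*} [Field K] (h2 : (2 : K) ≠ 0) (P : K[X]) (F : Finset K[X])
    (hF : ∀ f ∈ F, Prime f ∧ f ∣ P) (hF2 : ∀ p : K[X], ¬ IsCoprime P p → ∃ f ∈ F, f ∣ p)
    (hF3 : ∀ f ∈ F, ∀ g ∈ F, f ≠ g → IsCoprime f g) :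
    (∀ p, IsCoprime P p ∨ IsCoprime P (p - 1) ∨ IsCoprime P (p + 1)) ↔ F.card ≤ 2 := by
  have hn : ∀ f ∈ F, ∀ p, f ∣ p → ¬ IsCoprime P p := fun f hf p hp hc =>
    (hF f hf).1.not_isUnit (hc.isUnit_of_dvd' (hF f hf).2 hp)
  constructor
  · intro h
    by_contra! hc
    obtain ⟨f, g, k, hf, hg, hk, hfg, hfk, hgk⟩ := Finset.two_lt_card_iff.1 hc
    obtain ⟨a, b, hab⟩ := (hF3 f hf g hg hfg).mul_right (hF3 f hf k hk hfk)
    obtain ⟨c, c', hcc⟩ := hF3 g hg k hk hgk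
    rcases h (a * f * (c' * k - c * g)) with h | h | h
    · exact hn f hf _ ⟨a * (c' * k - c * g), by ring⟩ h
    · exact hn g hg _ ⟨- b * k * (c' * k - c * g) - 2 * c, by
        linear_combination hab * (c' * k - c * g) + hcc⟩ h
    · exact hn k hk _ ⟨- b * g * (c' * k - c * g) + 2 * c', by
        linear_combination hab * (c' * k - c * g) - hcc⟩ h
  · intro h p
    by_contra! hc
    obtain ⟨f, hf, hfp⟩ := hF2 _ hc.1
    obtain ⟨g, hg, hgp⟩ := hF2 _ hc.2.1
    obtain ⟨k, hk, hkp⟩ := hF2 _ hc.2.2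
    have h1 : f ≠ g := by
      rintro rfl
      exact (hF f hf).1.not_isUnit (isUnit_of_dvd_one (by simpa using dvd_sub hfp hgp))
    have h1' : f ≠ k := by
      rintro rfl
      exact (hF f hf).1.not_isUnit (isUnit_of_dvd_one (by simpa using dvd_sub hkp hfp))
    have h1'' : g ≠ k := by
      rintro rfl
      have : g ∣ (C 2 : K[X]) := by
        have := dvd_sub hkp hgp
        rw [show p + 1 - (p - 1) = C 2 by rw [show (C 2 : K[X]) = 2 from rfl]; ring] at this
        exact this
      exact (hF g hg).1.not_isUnit (isUnit_of_dvd_unit this (isUnit_C.2 (IsUnit.mk0 _ h2)))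
    have := Finset.two_lt_card_iff.2 ⟨f, g, k, hf, hg, hk, h1, h1', h1''⟩
    omega

lemma FC.local_main {R : Type*} [CommRing R] [IsDomain R] [IsLocalRing R]
    [Finite (IsLocalRing.ResidueField R)] (h2 : IsUnit (2 : R)) (d : ℕ) (hd : IsUnit (d : R))
    (φ : R[X]) (hm : φ.Monic) (hi : Irreducible φ) (hφ : φ ∣ cyclotomic d R) :
    0 < orderOf ((Nat.card (IsLocalRing.ResidueField R) : ZMod d)) ∧ ∃ k : ℕ,
      φ.natDegree = k * orderOf ((Nat.card (IsLocalRing.ResidueField R) : ZMod d)) ∧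
      (IsCleanRing (R[X] ⧸ Ideal.span {φ}) ↔ k ≤ 1) ∧
      (IsFeeblyCleanRing (R[X] ⧸ Ideal.span {φ}) ↔ k ≤ 2) := by
  have hd' : (d : IsLocalRing.ResidueField R) ≠ 0 := by
    simpa using (hd.map (IsLocalRing.residue R)).ne_zero
  have h2' : (2 : IsLocalRing.ResidueField R) ≠ 0 := by
    have := (h2.map (IsLocalRing.residue R)).ne_zero
    rwa [map_ofNat] at this
  have hP : φ.map (IsLocalRing.residue R) ∣ cyclotomic d (IsLocalRing.ResidueField R) := by
    have := Polynomial.map_dvd (IsLocalRing.residue R) hφ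
    rwa [map_cyclotomic] at this
  obtain ⟨ho, F, hF, hF2, hF3, hdeg⟩ := FC.order_card d hd' _ hP
  have hs : Function.Surjective (Polynomial.map (IsLocalRing.residue R)) :=
    Polynomial.map_surjective _ IsLocalRing.residue_surjective
  refine ⟨ho, F.card, ?_, ?_, ?_⟩
  · rw [← hdeg, hm.natDegree_map]
  · rw [FC.clean_iff (FC.connected φ hm hi), ← FC.clean_card _ F hF hF2 hF3,
      Ideal.Quotient.mk_surjective.forall, hs.forall]
    refine forall_congr' fun p => ?_
    rw [← map_one (Ideal.Quotient.mk _), ← map_sub, FC.isUnit_iff φ hm, FC.isUnit_iff φ hm]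
    simp
  · rw [FC.feebly_iff (FC.connected φ hm hi), ← FC.feebly_card h2' _ F hF hF2 hF3,
      Ideal.Quotient.mk_surjective.forall, hs.forall]
    refine forall_congr' fun p => ?_
    rw [← map_one (Ideal.Quotient.mk _), ← map_sub, ← map_add, FC.isUnit_iff φ hm, FC.isUnit_iff φ hm,
      FC.isUnit_iff φ hm]
    simp

lemma FC.root_unit {S : Type*} [CommRing S] (hc : ∀ e : S, e * e = e → e = 0 ∨ e = 1) (n : ℕ)
    (hn : IsUnit (n : S)) (u : S) (hu : u ^ n = 1) : u = 1 ∨ IsUnit (u - 1) := by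
  have hsep : ((X : S[X]) ^ n - C ((1 : Sˣ) : S)).Separable := separable_X_pow_sub_C_unit 1 hn
  have hfac : ((X : S[X]) ^ n - C ((1 : Sˣ) : S)) = (X - 1) * ∑ i ∈ Finset.range n, X ^ i := by
    rw [mul_geom_sum]; simp
  rw [hfac] at hsep
  obtain ⟨a, b, hab⟩ := hsep.isCoprime
  have h1 := congrArg (eval u) hab
  have h0 := congrArg (eval u) hfac
  simp only [eval_add, eval_mul, eval_sub, eval_X, eval_one, eval_pow, eval_C, Units.val_one, hu,
    sub_self] at h1 h0
  set s := eval u (∑ i ∈ Finset.range n, X ^ i)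
  rcases hc (eval u b * s) (by linear_combination (eval u b * s) * h1 + (eval u b) * (eval u a) * h0) with h | h
  · right
    exact IsUnit.of_mul_eq_one (eval u a) (by linear_combination h1 - h)
  · left
    linear_combination -(u - 1) * h - eval u b * h0

lemma FC.conn_alg {R : Type*} [CommRing R]
    {G : Type*} [CommGroup G] [Finite G] (n : ℕ) (hn : Monoid.exponent G = n) (hu : IsUnit (n : R))
    (φd : ℕ → R[X])
    (hφ : ∀ d, d ∣ n → (φd d).Monic ∧ Irreducible (φd d) ∧ φd d ∣ cyclotomic d R)
    {S : Type*} [CommRing S] [Nontrivial S] [Algebra R S]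
    (hc : ∀ e : S, e * e = e → e = 0 ∨ e = 1) (ρ : G →* S) (hρ : Algebra.adjoin R (Set.range ρ) = ⊤) :
    ∃ d, d ∣ n ∧ ∃ f : (R[X] ⧸ Ideal.span {φd d}) →+* S, Function.Surjective f := by
  obtain ⟨M, hM⟩ := Ideal.exists_maximal S
  let _ : Field (S ⧸ M) := Ideal.Quotient.field M
  let π : S →+* S ⧸ M := Ideal.Quotient.mk M
  have hnS : IsUnit (n : S) := by simpa using hu.map (algebraMap R S)
  let τ : G →* (S ⧸ M) := (π : S →* S ⧸ M).comp ρ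
  have hτ : ∀ g, τ g = 1 → ρ g = 1 := by
    intro g hg
    have : ρ g ^ n = 1 := by rw [← map_pow, ← hn, Monoid.pow_exponent_eq_one, map_one]
    rcases FC.root_unit hc n hnS _ this with h | h
    · exact h
    · exfalso
      have h' := (h.map π).ne_zero
      apply h'
      rw [map_sub, map_one, sub_eq_zero]
      exact hg
  have hτ' : ∀ g h, τ g = τ h → ρ g = ρ h := by
    intro g h hgh
    have h1 : τ (g * h⁻¹) = 1 := by
      rw [map_mul, hgh, ← map_mul, mul_inv_cancel, map_one]
    have := hτ _ h1
    calc ρ g = ρ (g * h⁻¹ * h) := by simp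
      _ = ρ h := by rw [map_mul, this, one_mul]
  let σ : G →* (S ⧸ M)ˣ := τ.toHomUnits
  have hσ : ∀ g, (σ g : S ⧸ M) = τ g := fun g => rfl
  have : Finite σ.range := (Set.finite_range σ).to_subtype
  obtain ⟨⟨_, g, rfl⟩, hg⟩ := IsCyclic.exists_generator (α := σ.range)
  have hg' : ∀ h, ∃ k : ℤ, σ g ^ k = σ h := by
    intro h
    obtain ⟨k, hk⟩ := hg ⟨σ h, h, rfl⟩
    exact ⟨k, congrArg Subtype.val hk⟩
  set d := orderOf (σ g) with hd
  have hdn : d ∣ n := by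
    rw [orderOf_dvd_iff_pow_eq_one, ← map_pow, ← hn, Monoid.pow_exponent_eq_one, map_one]
  refine ⟨d, hdn, ?_⟩
  obtain ⟨hm, hi, hdvd⟩ := hφ d hdn
  have hdR : IsUnit (d : R) := isUnit_of_dvd_unit (Nat.cast_dvd_cast hdn) hu
  have hdK : IsUnit (d : S ⧸ M) := by simpa using (hdR.map (algebraMap R S)).map π
  have : NeZero (d : S ⧸ M) := ⟨hdK.ne_zero⟩
  have : NeZero d := ⟨by rintro h; rw [h] at hdK; simp at hdK⟩
  have hprim : IsPrimitiveRoot (τ g) d := by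
    rw [← hσ, IsPrimitiveRoot.coe_units_iff]
    exact IsPrimitiveRoot.orderOf _
  let α : R →+* S ⧸ M := π.comp (algebraMap R S)
  have hspl : ((φd d).map α).Splits := by
    refine Splits.of_dvd (g := cyclotomic d (S ⧸ M)) ?_ (cyclotomic_ne_zero _ _) ?_
    · rw [cyclotomic_eq_prod_X_sub_primitiveRoots hprim]
      exact Splits.prod fun _ _ => Splits.X_sub_C _
    · have := Polynomial.map_dvd α hdvd
      rwa [map_cyclotomic] at this
  obtain ⟨μ, hμ⟩ := hspl.exists_eval_eq_zero (by
    rw [hm.degree_map]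
    intro h
    apply hi.not_isUnit
    rw [(Polynomial.Monic.natDegree_eq_zero hm).1 (natDegree_eq_of_degree_eq_some h)]
    exact isUnit_one)
  have hμp : IsPrimitiveRoot μ d := by
    rw [← isRoot_cyclotomic_iff]
    have := Polynomial.map_dvd α hdvd
    rw [map_cyclotomic] at this
    exact IsRoot.dvd hμ this
  obtain ⟨a, -, ha⟩ := hprim.eq_pow_of_pow_eq_one hμp.pow_eq_one
  set w := ρ (g ^ a) with hw
  have hwμ : π w = μ := by
    rw [← ha, ← map_pow]; rfl
  have hpow : ∀ h, ∃ i : ℕ, ρ h = w ^ i := by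
    intro h
    have h1 : τ h ^ d = 1 := by
      obtain ⟨k, hk⟩ := hg' h
      have : σ h ^ d = 1 := by
        rw [← hk, ← zpow_natCast, zpow_comm, zpow_natCast, pow_orderOf_eq_one, one_zpow]
      rw [← hσ, ← Units.val_pow_eq_pow_val, this, Units.val_one]
    obtain ⟨i, -, hi'⟩ := hμp.eq_pow_of_pow_eq_one h1
    refine ⟨i, ?_⟩
    rw [hw, ← map_pow]
    apply hτ'
    rw [← hi', ← ha, ← map_pow, ← map_pow]
  have hwd : w ^ d = 1 := by
    rw [hw, ← map_pow]
    apply hτ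
    rw [map_pow, map_pow, ha, hμp.pow_eq_one]
  have hφw : aeval w (φd d) = 0 := by
    have hsep : ((X : R[X]) ^ d - C ((1 : Rˣ) : R)).Separable := separable_X_pow_sub_C_unit 1 hdR
    obtain ⟨ψ, hψ⟩ := hdvd.trans (cyclotomic.dvd_X_pow_sub_one d R)
    have h0 := congrArg (aeval w) hψ
    rw [show (X : R[X]) ^ d - C ((1 : Rˣ) : R) = X ^ d - 1 by simp, hψ] at hsep
    obtain ⟨b, c, hbc⟩ := hsep.isCoprime
    have h1 := congrArg (aeval w) hbc
    simp only [map_add, map_mul, map_sub, map_pow, aeval_X, map_one, hwd, sub_self] at h0 h1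
    rcases hc (aeval w b * aeval w (φd d)) (by
      linear_combination (aeval w b * aeval w (φd d)) * h1 + aeval w b * aeval w c * h0) with h | h
    · linear_combination (-aeval w (φd d)) * h1 + (aeval w (φd d)) * h - aeval w c * h0
    · exfalso
      have hz : π (aeval w (φd d)) = 0 := by
        rw [← hμ, eval_map, ← hwμ, aeval_def, hom_eval₂]
      have := congrArg π h
      rw [map_mul, hz, mul_zero, map_one] at this
      exact zero_ne_one this
  let f : (R[X] ⧸ Ideal.span {φd d}) →+* S := Ideal.Quotient.lift _ (aeval w : R[X] →ₐ[R] S).toRingHom (by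
    intro p hp
    obtain ⟨q, rfl⟩ := Ideal.mem_span_singleton'.1 hp
    simp [hφw])
  refine ⟨f, Ideal.Quotient.lift_surjective_of_surjective _ _ ?_⟩
  have : (aeval w : R[X] →ₐ[R] S).range = ⊤ := by
    rw [eq_top_iff, ← hρ]
    apply Algebra.adjoin_le
    rintro _ ⟨h, rfl⟩
    obtain ⟨i, hi'⟩ := hpow h
    exact ⟨X ^ i, by simp [hi']⟩
  exact AlgHom.range_eq_top _ |>.1 this

lemma FC.exists_char (G : Type*) [CommGroup G] [Finite G] :
    ∃ (H : Subgroup ℂˣ) (χ : G →* H) (g : G), (∀ x, x ∈ Subgroup.zpowers (χ g)) ∧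
      orderOf (χ g) = Monoid.exponent G := by
  have : NeZero (Monoid.exponent G) := ⟨Monoid.exponent_ne_zero_of_finite⟩
  obtain ⟨E⟩ := CommGroup.monoidHom_mulEquiv_of_hasEnoughRootsOfUnity G ℂ
  obtain ⟨g, hg⟩ := Monoid.exists_orderOf_eq_exponent (G := G) (Monoid.ExponentExists.of_finite)
  let χ := E.symm g
  have hχ : orderOf χ = Monoid.exponent G := by rw [← hg]; exact orderOf_injective E.symm.toMonoidHom E.symm.injective g
  have : Finite χ.range := (Set.finite_range χ).to_subtype
  obtain ⟨⟨_, h, rfl⟩, hh⟩ := IsCyclic.exists_generator (α := χ.range)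
  refine ⟨χ.range, χ.rangeRestrict, h, hh, ?_⟩
  apply Nat.dvd_antisymm
  · rw [orderOf_dvd_iff_pow_eq_one, ← map_pow, Monoid.pow_exponent_eq_one, map_one]
  · rw [← hχ, orderOf_dvd_iff_pow_eq_one]
    ext k
    obtain ⟨j, hj⟩ := hh (χ.rangeRestrict k)
    have hj' : χ h ^ j = χ k := congrArg Subtype.val hj
    have h1 : χ h ^ orderOf (χ.rangeRestrict h) = 1 :=
      congrArg Subtype.val (pow_orderOf_eq_one (χ.rangeRestrict h))
    have : χ k ^ orderOf (χ.rangeRestrict h) = 1 := by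
      rw [← hj', ← zpow_natCast, zpow_comm, zpow_natCast, h1, one_zpow]
    simp [MonoidHom.pow_apply, this]

lemma FC.surj {R : Type*} [CommRing R]
    {G : Type*} [CommGroup G] [Finite G] (d : ℕ) (hd : d ∣ Monoid.exponent G)
    (φ : R[X]) (hφ : φ ∣ cyclotomic d R) :
    ∃ f : MonoidAlgebra R G →+* (R[X] ⧸ Ideal.span {φ}), Function.Surjective f := by
  obtain ⟨H, χ, g, hg, ho⟩ := FC.exists_char G
  set x : R[X] ⧸ Ideal.span {φ} := Ideal.Quotient.mk _ X with hx
  have hxd : x ^ d = 1 := by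
    rw [hx, ← map_pow, ← map_one (Ideal.Quotient.mk _), Ideal.Quotient.eq, Ideal.mem_span_singleton]
    exact hφ.trans (cyclotomic.dvd_X_pow_sub_one d R)
  have hd0 : d ≠ 0 := ne_zero_of_dvd_ne_zero Monoid.exponent_ne_zero_of_finite hd
  let u : (R[X] ⧸ Ideal.span {φ})ˣ := Units.ofPowEqOne x d hxd hd0
  have hu : orderOf u ∣ orderOf (χ g) := by
    rw [ho]
    refine dvd_trans ?_ hd
    rw [orderOf_dvd_iff_pow_eq_one]
    ext
    simp [u]
  let θ : G →* (R[X] ⧸ Ideal.span {φ}) :=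
    (Units.coeHom _).comp ((monoidHomOfForallMemZpowers hg hu).comp χ)
  have hθ : θ g = x := by
    change ((monoidHomOfForallMemZpowers hg hu (χ g) : (R[X] ⧸ Ideal.span {φ})ˣ) : R[X] ⧸ Ideal.span {φ}) = x
    rw [monoidHomOfForallMemZpowers_apply_gen]; rfl
  let f := MonoidAlgebra.lift R (R[X] ⧸ Ideal.span {φ}) G θ
  refine ⟨f.toRingHom, ?_⟩
  have hfx : f (MonoidAlgebra.of R G g) = x := by
    rw [MonoidAlgebra.lift_of, hθ]
  intro y
  obtain ⟨p, rfl⟩ := Ideal.Quotient.mk_surjective y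
  refine ⟨aeval (MonoidAlgebra.of R G g) p, ?_⟩
  change f _ = _
  rw [← Polynomial.aeval_algHom_apply, hfx]
  have : (aeval x : R[X] →ₐ[R] _) = Ideal.Quotient.mkₐ R (Ideal.span {φ}) := by
    ext; simp [x]
  rw [this]; rfl

lemma FC.glue {R : Type*} [CommRing R] [IsDomain R] [IsLocalRing R]
    {A : Type*} [CommRing A] [Algebra R A] [Module.Finite R A] [Module.Free R A]
    (hA : ∀ e : A, e * e = e → Nontrivial (A ⧸ Ideal.span {1 - e}) →
      (∀ s : A ⧸ Ideal.span {1 - e}, s * s = s → s = 0 ∨ s = 1) →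
      IsFeeblyCleanRing (A ⧸ Ideal.span {1 - e})) : IsFeeblyCleanRing A := by
  intro r
  have key : ∀ N : ℕ, ∀ e : A, e * e = e → Module.finrank R (Ideal.span {e} : Ideal A) ≤ N →
      ∃ u v e₁ e₂ : A, u * v = e ∧ u * e = u ∧ v * e = v ∧ e₁ * e₁ = e₁ ∧ e₂ * e₂ = e₂ ∧
        e₁ * e = e₁ ∧ e₂ * e = e₂ ∧ e₁ * e₂ = 0 ∧ e * r = u + e₁ - e₂ := by
    intro N
    induction N with
    | zero =>
      intro e he h
      have := FC.span_eq_zero (R := R) e he (by omega)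
      subst this
      exact ⟨0, 0, 0, 0, by simp⟩
    | succ N ih =>
      intro e he hN
      by_cases h0 : e = 0
      · subst h0
        exact ⟨0, 0, 0, 0, by simp⟩
      by_cases hsp : ∃ f : A, f * f = f ∧ f * e = f ∧ f ≠ 0 ∧ f ≠ e
      · obtain ⟨f, hf, hfe, hf0, hfe0⟩ := hsp
        have hg : (e - f) * (e - f) = e - f := by linear_combination he - 2 * hfe + hf
        have hfg : f * (e - f) = 0 := by linear_combination hfe - hf
        have hadd := FC.finrank_add (R := R) f (e - f) hf hg hfg
        rw [add_sub_cancel] at hadd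
        have h1 : Module.finrank R (Ideal.span {f} : Ideal A) ≠ 0 :=
          fun h => hf0 (FC.span_eq_zero (R := R) f hf h)
        have h2 : Module.finrank R (Ideal.span {e - f} : Ideal A) ≠ 0 :=
          fun h => hfe0 (sub_eq_zero.1 (FC.span_eq_zero (R := R) _ hg h)).symm
        obtain ⟨u, v, a, b, i1, i2, i3, i4, i5, i6, i7, i8, i9⟩ := ih f hf (by omega)
        obtain ⟨u', v', a', b', j1, j2, j3, j4, j5, j6, j7, j8, j9⟩ := ih (e - f) hg (by omega)
        generalize hge : e - f = g at *
        have hee : e = f + g := by linear_combination hge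
        subst hee
        have hcr : ∀ x y : A, x * f = x → y * g = y → x * y = 0 := by
          intro x y hx hy
          calc x * y = (x * f) * (y * g) := by rw [hx, hy]
            _ = x * y * (f * g) := by ring
            _ = 0 := by rw [hfg, mul_zero]
        refine ⟨u + u', v + v', a + a', b + b', ?_, ?_, ?_, ?_, ?_, ?_, ?_, ?_, ?_⟩
        · linear_combination i1 + j1 + hcr u v' i2 j3 + hcr v u' i3 j2
        · linear_combination i2 + j2 + hcr u g i2 hg + hcr f u' hf j2
        · linear_combination i3 + j3 + hcr v g i3 hg + hcr f v' hf j3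
        · linear_combination i4 + j4 + 2 * hcr a a' i6 j6
        · linear_combination i5 + j5 + 2 * hcr b b' i7 j7
        · linear_combination i6 + j6 + hcr a g i6 hg + hcr f a' hf j6
        · linear_combination i7 + j7 + hcr b g i7 hg + hcr f b' hf j7
        · linear_combination i8 + j8 + hcr a b' i6 j7 + hcr b a' i7 j6
        · linear_combination i9 + j9
      · push Not at hsp
        have hz : ∀ y, y ∈ Ideal.span {1 - e} ↔ e * y = 0 := by
          intro y
          rw [Ideal.mem_span_singleton']
          constructor
          · rintro ⟨a, rfl⟩
            linear_combination -a * he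
          · intro h
            exact ⟨y, by linear_combination -h⟩
        have hnt : Nontrivial (A ⧸ Ideal.span {1 - e}) := by
          rw [Ideal.Quotient.nontrivial_iff, Ne, Ideal.eq_top_iff_one, hz, mul_one]
          exact h0
        have hconn : ∀ s : A ⧸ Ideal.span {1 - e}, s * s = s → s = 0 ∨ s = 1 := by
          intro s hs
          obtain ⟨a, rfl⟩ := Ideal.Quotient.mk_surjective s
          rw [← map_mul, Ideal.Quotient.eq, hz] at hs
          rw [← map_one (Ideal.Quotient.mk _), Ideal.Quotient.eq, Ideal.Quotient.eq_zero_iff_mem, hz, hz]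
          by_cases h : e * a = 0
          · exact Or.inl h
          · right
            have := hsp (e * a) (by linear_combination (a * a) * he + hs) (by linear_combination a * he) h
            linear_combination this
        have hfc := (FC.feebly_iff hconn).1 (hA e he hnt hconn)
        have hlift : ∀ c : A, IsUnit (Ideal.Quotient.mk (Ideal.span {1 - e}) c) →
            ∃ v, (e * c) * v = e ∧ v * e = v := by
          intro c hc
          obtain ⟨b, hb⟩ := isUnit_iff_exists_inv.1 hc
          obtain ⟨v, rfl⟩ := Ideal.Quotient.mk_surjective b
          rw [← map_mul, ← map_one (Ideal.Quotient.mk _), Ideal.Quotient.eq, hz] at hb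
          exact ⟨e * v, by linear_combination hb + c * v * he, by linear_combination v * he⟩
        rcases hfc (Ideal.Quotient.mk _ r) with h | h | h
        · obtain ⟨v, hv, hv'⟩ := hlift r h
          exact ⟨e * r, v, 0, 0, hv, by linear_combination r * he, hv', by simp, by simp, by simp,
            by simp, by simp, by simp⟩
        · rw [← map_one (Ideal.Quotient.mk _), ← map_sub] at h
          obtain ⟨v, hv, hv'⟩ := hlift _ h
          exact ⟨e * (r - 1), v, e, 0, hv, by linear_combination (r - 1) * he, hv', he, by simp, he,
            by simp, by simp, by ring⟩
        · rw [← map_one (Ideal.Quotient.mk _), ← map_add] at h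
          obtain ⟨v, hv, hv'⟩ := hlift _ h
          exact ⟨e * (r + 1), v, 0, e, hv, by linear_combination (r + 1) * he, hv', by simp, he,
            by simp, he, by simp, by ring⟩
  obtain ⟨u, v, a, b, i1, i2, i3, i4, i5, i6, i7, i8, i9⟩ := key _ 1 (by simp) le_rfl
  exact ⟨u, a, b, IsUnit.of_mul_eq_one v i1, i4, i5, i8, by rw [← i9, one_mul]⟩

end

/-- Let `(R, 𝔪)` be a commutative local domain with finite residue field in which `2`
is a unit, `G` a finite abelian group whose exponent `n` is a unit in `R`, and for each
divisor `d` of `n` let `φd d` be a monic irreducible divisor of the `d`-th cyclotomic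
polynomial over `R`. Then (i) `R[x]/(φd d)` is feebly clean but not clean iff
`deg (φd d) = 2 · ord_d |R/𝔪|`, and (ii) `R[G]` is feebly clean iff
`deg (φd d) ≤ 2 · ord_d |R/𝔪|` for all divisors `d` of `n`. -/
theorem feeblyClean_quotient_and_feeblyClean_monoidAlgebra_iff
    (R : Type*) [CommRing R] [IsDomain R] [IsLocalRing R]
    [Finite (IsLocalRing.ResidueField R)]
    (G : Type*) [CommGroup G] [Fintype G]
    (n : ℕ) (hn : Monoid.exponent G = n) (hu : IsUnit (n : R))
    (h2 : IsUnit (2 : R))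
    (φd : ℕ → Polynomial R)
    (hφ : ∀ d, d ∣ n → (φd d).Monic ∧ Irreducible (φd d) ∧ φd d ∣ Polynomial.cyclotomic d R) :
    (∀ d, d ∣ n →
      ((IsFeeblyCleanRing (Polynomial R ⧸ Ideal.span {φd d}) ∧
          ¬ IsCleanRing (Polynomial R ⧸ Ideal.span {φd d})) ↔
        (φd d).natDegree = 2 * orderOf ((Nat.card (IsLocalRing.ResidueField R) : ZMod d)))) ∧
    (IsFeeblyCleanRing (MonoidAlgebra R G) ↔
      ∀ d, d ∣ n →
        (φd d).natDegree ≤ 2 * orderOf ((Nat.card (IsLocalRing.ResidueField R) : ZMod d))) := by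
  have hdR : ∀ d, d ∣ n → IsUnit (d : R) := fun d hd => isUnit_of_dvd_unit (Nat.cast_dvd_cast hd) hu
  have hfe : ∀ d, d ∣ n → (IsFeeblyCleanRing (Polynomial R ⧸ Ideal.span {φd d}) ↔
      (φd d).natDegree ≤ 2 * orderOf ((Nat.card (IsLocalRing.ResidueField R) : ZMod d))) := by
    intro d hd
    obtain ⟨hm, hi, hdv⟩ := hφ d hd
    obtain ⟨ho, k, hk, -, h⟩ := FC.local_main h2 d (hdR d hd) (φd d) hm hi hdv
    rw [h, hk, Nat.mul_le_mul_right_iff ho]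
  refine ⟨?_, ?_, ?_⟩
  · intro d hd
    obtain ⟨hm, hi, hdv⟩ := hφ d hd
    obtain ⟨ho, k, hk, hc, hf⟩ := FC.local_main h2 d (hdR d hd) (φd d) hm hi hdv
    rw [hf, hc, hk, Nat.mul_left_inj ho.ne']
    omega
  · intro h d hd
    rw [← hfe d hd]
    obtain ⟨f, hf⟩ := FC.surj (R := R) (G := G) d (hn ▸ hd) (φd d) (hφ d hd).2.2
    exact FC.map_feebly f hf h
  · intro h
    refine FC.glue (R := R) ?_
    intro e he hnt hconn
    let q := Ideal.Quotient.mkₐ R (Ideal.span {1 - e})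
    have hq : Function.Surjective q := Ideal.Quotient.mkₐ_surjective R _
    obtain ⟨d, hd, f, hf⟩ := FC.conn_alg n hn hu φd hφ hconn
      ((q : MonoidAlgebra R G →* _).comp (MonoidAlgebra.of R G)) (by
        have h1 : Algebra.adjoin R (Set.range (MonoidAlgebra.of R G)) = ⊤ := by
          rw [eq_top_iff]
          rintro x -
          induction x using MonoidAlgebra.induction_on with
          | of g => exact Algebra.subset_adjoin ⟨g, rfl⟩
          | add a b ha hb => exact add_mem ha hb
          | smul r a ha => exact Subalgebra.smul_mem _ ha r
        have h2 := congrArg (Subalgebra.map q) h1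
        rw [AlgHom.map_adjoin, ← Set.range_comp, Algebra.map_top, (AlgHom.range_eq_top q).2 hq] at h2
        exact h2)
    exact FC.map_feebly f hf ((hfe d hd).2 (h d hd))
end

section
/- Let (R, 𝔪) be a commutative local domain whose residue field R/𝔪 is finite, let G be a finite abelian group whose exponent n is a unit in R, assume 2 is not a unit in R, and for each divisor d of n let φ_d(x) be a monic irreducible divisor of the d-th cyclotomic polynomial Φ_d(x) over R. Then: (i) for each divisor d of n, the ring R[x]/(φ_d(x)) is feebly clean if and only if it is weakly clean, if and only if it is clean; and (ii) the group ring R[G] is feebly clean if and only if it is weakly clean, if and only if it is clean. -/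
/-- A ring is *weakly clean* if every element is a sum or a difference of a unit
and an idempotent. -/
def IsWeaklyCleanRing (R : Type*) [Ring R] : Prop :=
  ∀ r : R, ∃ u e : R, IsUnit u ∧ IsIdempotentElem e ∧ (r = u + e ∨ r = u - e)

theorem two_mem_jac (R S : Type*) [CommRing R] [IsLocalRing R] [CommRing S] [Algebra R S]
    [Algebra.IsIntegral R S] (h2 : ¬ IsUnit (2 : R)) :
    (2 : S) ∈ Ideal.jacobson (⊥ : Ideal S) := by
  rw [Ideal.jacobson, Ideal.mem_sInf]
  rintro M ⟨-, hM⟩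
  have h := Ideal.isMaximal_comap_of_isIntegral_of_isMaximal (R := R) M
  have h' := IsLocalRing.eq_maximalIdeal h
  have : (2 : R) ∈ M.comap (algebraMap R S) := by
    rw [h']
    exact (IsLocalRing.mem_maximalIdeal _).2 h2
  rwa [Ideal.mem_comap, map_ofNat] at this

theorem clean_of_feebly (S : Type*) [CommRing S] (h : (2 : S) ∈ Ideal.jacobson (⊥ : Ideal S))
    (hS : IsFeeblyCleanRing S) : IsCleanRing S := by
  intro r
  obtain ⟨u, e, f, ⟨v, rfl⟩, he, hf, hef, rfl⟩ := hS r
  refine ⟨v - 2 * f, e + f, ?_, ?_, by ring⟩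
  · have h1 := Ideal.mem_jacobson_bot.1 h (-(f * (↑v⁻¹ : S)))
    have h3 : (v : S) - 2 * f = v * (2 * (-(f * (↑v⁻¹ : S))) + 1) := by
      linear_combination (2 * f) * v.mul_inv
    rw [h3]
    exact v.isUnit.mul h1
  · unfold IsIdempotentElem at *
    linear_combination he + hf + 2 * hef

theorem clean_iffs (S : Type*) [CommRing S] (h : (2 : S) ∈ Ideal.jacobson (⊥ : Ideal S)) :
    (IsFeeblyCleanRing S ↔ IsWeaklyCleanRing S) ∧ (IsWeaklyCleanRing S ↔ IsCleanRing S) := by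
  have h1 := clean_of_feebly S h
  have h2 : IsCleanRing S → IsWeaklyCleanRing S := by
    intro hS r
    obtain ⟨u, e, hu, he, hr⟩ := hS r
    exact ⟨u, e, hu, he, Or.inl hr⟩
  have h3 : IsWeaklyCleanRing S → IsFeeblyCleanRing S := by
    intro hS r
    obtain ⟨u, e, hu, he, hr | hr⟩ := hS r
    · exact ⟨u, e, 0, hu, he, IsIdempotentElem.zero, by simp, by simp [hr]⟩
    · exact ⟨u, 0, e, hu, IsIdempotentElem.zero, he, by simp, by simp [hr]⟩
  tauto

/-- Let `(R, 𝔪)` be a commutative local domain with finite residue field in which `2`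
is *not* a unit, `G` a finite abelian group whose exponent `n` is a unit in `R`, and for
each divisor `d` of `n` let `φd d` be a monic irreducible divisor of the `d`-th cyclotomic
polynomial over `R`. Then (i) for each divisor `d` of `n`, `R[x]/(φd d)` is feebly clean
iff it is weakly clean iff it is clean; and (ii) `R[G]` is feebly clean iff it is weakly
clean iff it is clean. -/
theorem feeblyClean_iff_weaklyClean_iff_clean_of_two_not_unit
    (R : Type*) [CommRing R] [IsDomain R] [IsLocalRing R]
    [Finite (IsLocalRing.ResidueField R)]
    (G : Type*) [CommGroup G] [Fintype G]
    (n : ℕ) (hn : Monoid.exponent G = n) (hu : IsUnit (n : R))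
    (h2 : ¬ IsUnit (2 : R))
    (φd : ℕ → Polynomial R)
    (hφ : ∀ d, d ∣ n → (φd d).Monic ∧ Irreducible (φd d) ∧ φd d ∣ Polynomial.cyclotomic d R) :
    (∀ d, d ∣ n →
      ((IsFeeblyCleanRing (Polynomial R ⧸ Ideal.span {φd d}) ↔
          IsWeaklyCleanRing (Polynomial R ⧸ Ideal.span {φd d})) ∧
        (IsWeaklyCleanRing (Polynomial R ⧸ Ideal.span {φd d}) ↔
          IsCleanRing (Polynomial R ⧸ Ideal.span {φd d})))) ∧
    ((IsFeeblyCleanRing (MonoidAlgebra R G) ↔ IsWeaklyCleanRing (MonoidAlgebra R G)) ∧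
      (IsWeaklyCleanRing (MonoidAlgebra R G) ↔ IsCleanRing (MonoidAlgebra R G))) := by
  refine ⟨fun d hd => clean_iffs _ ?_, clean_iffs _ ?_⟩
  · have := (hφ d hd).1.finite_quotient
    exact two_mem_jac R _ h2
  · have : Module.Finite R (MonoidAlgebra R G) := inferInstance
    exact two_mem_jac R _ h2
end

section
/- Let n be a positive integer and let p be an odd prime with p ∤ n. Then φ(n) = 2·ord_n(p) if and only if one of the following holds: (a) n = 4 and p ≡ 1 (mod 4), or n = 8 and p ≢ 1 (mod 8); (b) n = 2^r with r ≥ 4 and p ≡ ±3 or ±5 (mod 16); (c) n = q^r or n = 2q^r for some odd prime q and r ≥ 1, and ord_{q^{ε(r)}}(p) = q^{ε(r)−1}(q−1)/2; (d) n = 4q^r for some odd prime q and r ≥ 1, and either p is a primitive root of q^{ε(r)}, or p ≡ 3 (mod 4), q ≡ 3 (mod 4) and ord_{q^{ε(r)}}(p) = q^{ε(r)−1}(q−1)/2; (e) n = q₁^{r₁}q₂^{r₂} or n = 2q₁^{r₁}q₂^{r₂} for distinct odd primes q₁, q₂ and r₁, r₂ ≥ 1 with q₂ ≡ 3 (mod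 4) and gcd(q₁^{ε(r₁)−1}(q₁−1), q₂^{ε(r₂)−1}(q₂−1)) = 2, and either p is a primitive root of both q₁^{ε(r₁)} and q₂^{ε(r₂)}, or p is a primitive root of q₁^{ε(r₁)} and ord_{q₂^{ε(r₂)}}(p) = q₂^{ε(r₂)−1}(q₂−1)/2. -/
/-- `eps r = 1` if `r = 1` and `eps r = 2` if `r ≥ 2`. -/
def eps (r : ℕ) : ℕ := if r = 1 then 1 else 2

lemma ord_one_iff (p n k : ℕ) : orderOf (p : ZMod n) ∣ k ↔ (n:ℤ) ∣ (p:ℤ)^k - 1 := by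
  rw [orderOf_dvd_iff_pow_eq_one, ← ZMod.intCast_zmod_eq_zero_iff_dvd]
  push_cast
  rw [sub_eq_zero]

lemma ord_mul (p a b : ℕ) (h : Nat.Coprime a b) :
    orderOf (p : ZMod (a*b)) = Nat.lcm (orderOf (p : ZMod a)) (orderOf (p : ZMod b)) := by
  have := orderOf_injective (ZMod.chineseRemainder h).toRingHom.toMonoidHom (ZMod.chineseRemainder h).injective (p : ZMod (a*b))
  rw [← this, Prod.orderOf]
  simp

lemma ord_dvd (p n : ℕ) (h : Nat.Coprime p n) : orderOf (p : ZMod n) ∣ Nat.totient n := by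
  rw [orderOf_dvd_iff_pow_eq_one]
  have := congrArg (Units.val) (ZMod.pow_totient (ZMod.unitOfCoprime p h))
  rwa [Units.val_pow_eq_pow_val, ZMod.coe_unitOfCoprime, Units.val_one] at this

lemma ord_two (p : ℕ) (h : ¬ 2 ∣ p) : orderOf (p : ZMod 2) = 1 := by
  rw [orderOf_eq_one_iff]
  have : ((p:ℕ):ZMod 2) = ((1:ℕ): ZMod 2) := by
    rw [ZMod.natCast_eq_natCast_iff']; omega
  simpa using this

lemma arith (A B x y : ℕ) (hA : 0 < A) (hB : 0 < B) (eA : 2 ∣ A) (eB : 2 ∣ B) (hx : x ∣ A) (hy : y ∣ B) :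
    A * B = 2 * Nat.lcm x y ↔ Nat.gcd A B = 2 ∧ ((x = A ∧ y = B) ∨ (x = A ∧ B = 2 * y ∧ y % 2 = 1) ∨
      (A = 2 * x ∧ y = B ∧ x % 2 = 1)) := by
  have key : ∀ x y : ℕ, x % 2 = 1 → Nat.gcd (2*x) y = 2 → Nat.gcd x y = 1 := by
    intro x y h1 h2
    have h3 : Nat.gcd x y ∣ 2 := h2 ▸ Nat.gcd_dvd_gcd_mul_left_left ..
    rcases (Nat.dvd_prime Nat.prime_two).1 h3 with h | h
    · exact h
    · have := h ▸ Nat.gcd_dvd_left x y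
      omega
  have key2 : ∀ x y : ℕ, 2 ∣ y → Nat.gcd x y = 1 → Nat.gcd (2*x) y = 2 := by
    intro x y h1 h2
    rw [Nat.Coprime.gcd_mul_right_cancel 2 h2]
    exact Nat.gcd_eq_left h1
  have odd : ∀ x y : ℕ, 2 ∣ y → Nat.gcd x y = 1 → x % 2 = 1 := by
    intro x y h1 h2
    by_contra h
    have : 2 ∣ Nat.gcd x y := Nat.dvd_gcd (by omega) h1
    omega
  obtain ⟨s, rfl⟩ := hx
  obtain ⟨t, rfl⟩ := hy
  have hx0 : 0 < x := Nat.pos_of_mul_pos_right hA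
  have hy0 : 0 < y := Nat.pos_of_mul_pos_right hB
  have hl : 0 < Nat.lcm x y := Nat.lcm_pos hx0 hy0
  have hgl := Nat.gcd_mul_lcm x y
  have h1 : x * s * (y * t) = 2 * Nat.lcm x y ↔ Nat.gcd x y * (s * t) = 2 := by
    have e : x * s * (y * t) = Nat.lcm x y * (Nat.gcd x y * (s * t)) := by
      calc _ = (x * y) * (s * t) := by ring
        _ = _ := by rw [← hgl]; ring
    rw [e, mul_comm 2]
    exact Nat.mul_right_inj hl.ne'
  rw [h1]
  constructor
  · intro h
    have hg : Nat.gcd x y ∣ 2 := ⟨_, h.symm⟩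
    rcases (Nat.dvd_prime Nat.prime_two).1 hg with hg | hg
    · rw [hg, one_mul] at h
      have hs : s ∣ 2 := ⟨_, h.symm⟩
      rcases (Nat.dvd_prime Nat.prime_two).1 hs with hs | hs
      · have ht : t = 2 := by rw [hs] at h; omega
        subst hs ht
        simp only [mul_one] at *
        have hg' : Nat.gcd y x = 1 := by rwa [Nat.gcd_comm]
        refine ⟨?_, Or.inr (Or.inl ⟨by trivial, mul_comm _ _, odd _ _ eA hg'⟩)⟩
        rw [Nat.gcd_comm, mul_comm]; exact key2 _ _ eA hg'
      · have ht : t = 1 := by rw [hs] at h; omega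
        subst hs ht
        simp only [mul_one] at *
        refine ⟨?_, Or.inr (Or.inr ⟨mul_comm _ _, by trivial, odd _ _ eB hg⟩)⟩
        rw [mul_comm]; exact key2 _ _ eB hg
    · rw [hg] at h
      have h : s * t = 1 := by omega
      obtain ⟨rfl, rfl⟩ := mul_eq_one.1 h
      simp only [mul_one]
      exact ⟨hg, Or.inl ⟨by trivial, by trivial⟩⟩
  · rintro ⟨hg, ⟨h2, h3⟩ | ⟨h2, h3, h4⟩ | ⟨h2, h3, h4⟩⟩
    · have hs : s = 1 := by nlinarith
      have ht : t = 1 := by nlinarith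
      subst hs ht; simpa using hg
    · have hs : s = 1 := by nlinarith
      have ht : t = 2 := by nlinarith
      subst hs ht
      rw [mul_one, Nat.gcd_comm, mul_comm y] at hg
      rw [Nat.gcd_comm, key _ _ h4 hg]
    · have hs : s = 2 := by nlinarith
      have ht : t = 1 := by nlinarith
      subst hs ht
      rw [mul_one, mul_comm x] at hg
      rw [key _ _ h4 hg]

lemma tot_even (n : ℕ) (h : 2 < n) : 2 ∣ Nat.totient n := (Nat.totient_even h).two_dvd

lemma keyK (p a b : ℕ) (h : Nat.Coprime a b) (ha : 2 < a) (hb : 2 < b) (pa : Nat.Coprime p a)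
    (pb : Nat.Coprime p b) : Nat.totient (a*b) = 2 * orderOf (p : ZMod (a*b)) ↔
    Nat.gcd (Nat.totient a) (Nat.totient b) = 2 ∧
    ((orderOf (p : ZMod a) = Nat.totient a ∧ orderOf (p : ZMod b) = Nat.totient b) ∨
     (orderOf (p : ZMod a) = Nat.totient a ∧ Nat.totient b = 2 * orderOf (p : ZMod b) ∧ orderOf (p : ZMod b) % 2 = 1) ∨
     (Nat.totient a = 2 * orderOf (p : ZMod a) ∧ orderOf (p : ZMod b) = Nat.totient b ∧ orderOf (p : ZMod a) % 2 = 1)) := by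
  rw [ord_mul _ _ _ h, Nat.totient_mul h]
  exact arith _ _ _ _ (Nat.totient_pos.2 (by omega)) (Nat.totient_pos.2 (by omega)) (tot_even _ ha) (tot_even _ hb)
    (ord_dvd _ _ pa) (ord_dvd _ _ pb)

lemma not_prim (p a b : ℕ) (h : Nat.Coprime a b) (ha : 2 < a) (hb : 2 < b) (pa : Nat.Coprime p a)
    (pb : Nat.Coprime p b) : orderOf (p : ZMod (a*b)) ≠ Nat.totient (a * b) := by
  rw [ord_mul _ _ _ h, Nat.totient_mul h]
  intro h1
  obtain ⟨A, hA⟩ := tot_even _ ha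
  obtain ⟨B, hB⟩ := tot_even _ hb
  have h2 : Nat.lcm (orderOf (p : ZMod a)) (orderOf (p : ZMod b)) ∣ 2 * A * B := by
    apply Nat.lcm_dvd
    · rw [← hA]; exact (ord_dvd _ _ pa).mul_right _
    · exact (ord_dvd _ _ pb).trans (hB ▸ ⟨A, by ring⟩)
  have := Nat.totient_pos.2 (show 0 < a by omega)
  have := Nat.totient_pos.2 (show 0 < b by omega)
  have hA0 : 0 < A := by omega
  have hB0 : 0 < B := by omega
  rw [h1, hA, hB] at h2
  have := Nat.le_of_dvd (by positivity) h2
  nlinarith [Nat.mul_pos hA0 hB0]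

lemma two_mul_red (p m : ℕ) (hm : ¬ 2 ∣ m) (hp : ¬ 2 ∣ p) :
    Nat.totient (2*m) = Nat.totient m ∧ orderOf (p : ZMod (2*m)) = orderOf (p : ZMod m) := by
  have hc : Nat.Coprime 2 m := (Nat.Prime.coprime_iff_not_dvd Nat.prime_two).2 hm
  constructor
  · rw [Nat.totient_mul hc]; simp
  · rw [ord_mul _ _ _ hc, ord_two _ hp]; simp

lemma lift_dvd (q a j : ℕ) (x : ℤ) (ha : 1 ≤ a) (h : (q:ℤ)^a ∣ x - 1) : (q:ℤ)^(a+j) ∣ x^(q^j) - 1 := by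
  induction j with
  | zero => simpa using h
  | succ j ih =>
    have h1 : (q:ℤ) ∣ x^(q^j) - 1 := (dvd_pow_self _ (by omega)).trans ih
    rw [pow_succ, pow_mul]
    set y := x^(q^j)
    rw [← geom_sum_mul, mul_comm, show a + (j+1) = (a+j)+1 by ring, pow_succ]
    apply mul_dvd_mul ih
    have : ∑ i ∈ Finset.range q, y^i = ∑ i ∈ Finset.range q, (y^i - 1) + q := by
      simp
    rw [this]
    apply dvd_add _ dvd_rfl
    apply Finset.dvd_sum
    intro i _
    exact h1.trans (by simpa using sub_dvd_pow_sub_pow y 1 i)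

lemma two_pow_le (p r : ℕ) (hp : ¬ 2 ∣ p) (hr : 3 ≤ r) : orderOf (p : ZMod (2^r)) ∣ 2^(r-2) := by
  obtain ⟨j, rfl⟩ := Nat.exists_eq_add_of_le hr
  rw [show 3 + j - 2 = j + 1 by omega, pow_succ, mul_comm, ord_one_iff]
  push_cast
  rw [pow_mul]
  apply lift_dvd 2 3 j _ (by norm_num)
  have : Odd (p:ℤ) := by rw [Int.odd_iff]; omega
  simpa using Int.eight_dvd_sq_sub_one_of_odd this

lemma two_pow_iff (p r : ℕ) (hp : ¬ 2 ∣ p) (hr : 4 ≤ r) :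
    Nat.totient (2^r) = 2 * orderOf (p : ZMod (2^r)) ↔
      (p % 16 = 3 ∨ p % 16 = 13 ∨ p % 16 = 5 ∨ p % 16 = 11) := by
  rw [Nat.totient_prime_pow Nat.prime_two (by omega)]
  obtain ⟨j, rfl⟩ := Nat.exists_eq_add_of_le hr
  rw [show 4 + j - 1 = j + 1 + 1 + 1 by omega]
  have hm : ∀ m : ℕ, p % 16 = m → (p^2 % 16 = m^2 % 16) := by
    intro m h; subst h; simp [Nat.pow_mod]
  constructor
  · intro h
    by_contra hne
    have h16 : (2:ℤ)^4 ∣ (p:ℤ)^2 - 1 := by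
      have : p^2 % 16 = 1 := by
        have : p % 16 = 1 ∨ p % 16 = 7 ∨ p % 16 = 9 ∨ p % 16 = 15 := by omega
        rcases this with h | h | h | h <;> simp [hm _ h]
      zify at this
      omega
    have := lift_dvd 2 4 j _ (by norm_num) h16
    rw [← pow_mul] at this
    have h2 : orderOf (p : ZMod (2^(4+j))) ∣ 2 * 2^j := by
      rw [ord_one_iff]; push_cast; exact_mod_cast this
    have := Nat.le_of_dvd (by positivity) h2
    have : 0 < 2^j := by positivity
    rw [pow_succ, pow_succ, pow_succ] at h
    omega
  · intro h
    have h9 : p^2 % 16 = 9 := by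
      rcases h with h | h | h | h <;> simp [hm _ h]
    obtain ⟨a, ha⟩ : ∃ a, p^2 = 1 + 8 * a := ⟨p^2/8, by omega⟩
    have h1 := ZMod.orderOf_one_add_mul_prime_pow Nat.prime_two 3 (by norm_num) (by norm_num) (a:ℤ) (by omega) (j+1)
    have h2 : (1 + ((2:ℕ):ZMod (2^(j+1+3)))^3 * ((a:ℤ):ZMod (2^(j+1+3)))) = (p : ZMod (2^(j+1+3)))^2 := by
      rw [← Nat.cast_pow p, ha]; push_cast; norm_num
    rw [h2, show j+1+3 = 4 + j by ring, orderOf_pow' _ (by norm_num)] at h1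
    set o := orderOf (p : ZMod (2^(4+j)))
    have hg : Nat.gcd o 2 ∣ 2 := Nat.gcd_dvd_right _ _
    rcases (Nat.dvd_prime Nat.prime_two).1 hg with hg | hg
    · rw [hg, Nat.div_one] at h1
      have : 2 ∣ Nat.gcd o 2 := Nat.dvd_gcd (h1 ▸ dvd_pow_self 2 (by omega)) dvd_rfl
      omega
    · have := Nat.gcd_dvd_left o 2
      rw [hg] at this h1
      rw [pow_succ 2 (j+1+1), pow_succ 2 (j+1)]
      omega

/-- The order at a prime power, when `p` is not a Wieferich-like base. -/
lemma ord_A (p q : ℕ) (hq : q.Prime) (hq2 : q ≠ 2) (hpq : Nat.Coprime p q)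
    (h : ¬ (q:ℤ)^2 ∣ (p:ℤ)^(orderOf (p : ZMod q)) - 1) (r : ℕ) (hr : 1 ≤ r) :
    orderOf (p : ZMod (q^r)) = q^(r-1) * orderOf (p : ZMod q) := by
  obtain ⟨j, rfl⟩ := Nat.exists_eq_add_of_le' hr
  simp only [Nat.add_sub_cancel]
  have h0 : (q:ℤ) ∣ (p:ℤ)^(orderOf (p : ZMod q)) - 1 := (ord_one_iff _ _ _).1 dvd_rfl
  apply Nat.dvd_antisymm
  · rw [ord_one_iff, mul_comm, pow_mul]
    push_cast
    rw [add_comm]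
    exact lift_dvd q 1 j _ le_rfl (by simpa using h0)
  · apply Nat.Coprime.mul_dvd_of_dvd_of_dvd
    · apply Nat.Coprime.pow_left
      rw [Nat.Prime.coprime_iff_not_dvd hq]
      intro h1
      have h2 := h1.trans (ord_dvd p q hpq)
      rw [Nat.totient_prime hq] at h2
      have := Nat.le_of_dvd (by have := hq.two_le; omega) h2
      have := hq.two_le
      omega
    · obtain ⟨u, hu⟩ := h0
      have hqu : ¬ (q:ℤ) ∣ u := by
        rintro ⟨v, rfl⟩
        exact h ⟨v, by rw [hu]; ring⟩
      rw [← ZMod.orderOf_one_add_mul_prime hq hq2 u hqu j]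
      have : (1 + (q : ZMod (q^(j+1))) * (u : ZMod (q^(j+1)))) = (p : ZMod (q^(j+1)))^(orderOf (p : ZMod q)) := by
        have := congrArg (Int.cast : ℤ → ZMod (q^(j+1))) hu
        push_cast at this
        rw [← this]; ring
      rw [this]
      exact orderOf_pow_dvd _
    · rw [ord_one_iff]
      have : ((q^(j+1) : ℕ):ℤ) ∣ _ := (ord_one_iff p (q^(j+1)) _).1 dvd_rfl
      refine dvd_trans ?_ this
      push_cast
      exact dvd_pow_self _ (by omega)

lemma pp_iff_aux (p q k : ℕ) (hq : q.Prime) (hq2 : q ≠ 2) (hpq : Nat.Coprime p q)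
    (hk : k = 1 ∨ k = 2) (r : ℕ) (hr : 2 ≤ r) :
    Nat.totient (q^r) = k * orderOf (p : ZMod (q^r)) ↔
      (¬ (q:ℤ)^2 ∣ (p:ℤ)^(orderOf (p : ZMod q)) - 1 ∧ q - 1 = k * orderOf (p : ZMod q)) := by
  have hq0 := hq.two_le
  by_cases h : (q:ℤ)^2 ∣ (p:ℤ)^(orderOf (p : ZMod q)) - 1
  · simp only [h, not_true_eq_false, false_and, iff_false]
    intro h1
    obtain ⟨j, rfl⟩ := Nat.exists_eq_add_of_le hr
    have h2 : orderOf (p : ZMod (q^(2+j))) ∣ orderOf (p : ZMod q) * q^j := by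
      rw [ord_one_iff, pow_mul]
      push_cast
      exact lift_dvd q 2 j _ (by norm_num) h
    have h3 := mul_dvd_mul_left k h2
    rw [← h1, Nat.totient_prime_pow hq (by omega), show 2 + j - 1 = j + 1 by omega, pow_succ, 
      ← mul_assoc, mul_comm (k * _), mul_assoc] at h3
    have h4 := Nat.dvd_of_mul_dvd_mul_left (by positivity) h3
    have h5 : q ∣ k * orderOf (p : ZMod q) := (dvd_mul_right _ _).trans h4
    rcases (Nat.Prime.dvd_mul hq).1 h5 with h6 | h6
    · have := Nat.le_of_dvd (by omega) h6
      omega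
    · have h2 := h6.trans (ord_dvd p q hpq)
      rw [Nat.totient_prime hq] at h2
      have := Nat.le_of_dvd (by omega) h2
      omega
  · simp only [h, not_false_eq_true, true_and]
    rw [ord_A p q hq hq2 hpq h r (by omega), Nat.totient_prime_pow hq (by omega),
      show k * (q^(r-1) * orderOf (p : ZMod q)) = q^(r-1) * (k * orderOf (p : ZMod q)) by ring]
    exact Nat.mul_right_inj (by positivity)

lemma pp_iff (p q k : ℕ) (hq : q.Prime) (hq2 : q ≠ 2) (hpq : Nat.Coprime p q)
    (hk : k = 1 ∨ k = 2) (r : ℕ) (hr : 1 ≤ r) :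
    Nat.totient (q^eps r) = k * orderOf (p : ZMod (q^eps r)) ↔
    Nat.totient (q^r) = k * orderOf (p : ZMod (q^r)) := by
  by_cases h : r = 1
  · subst h; rfl
  · rw [show eps r = 2 by simp [eps, h], pp_iff_aux p q k hq hq2 hpq hk r (by omega),
      pp_iff_aux p q k hq hq2 hpq hk 2 le_rfl]

lemma eps_pos (r : ℕ) : 0 < eps r := by unfold eps; split_ifs <;> norm_num

lemma prim_iff (p q : ℕ) (hq : q.Prime) (hq2 : q ≠ 2) (hpq : Nat.Coprime p q)
    (r : ℕ) (hr : 1 ≤ r) :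
    orderOf (p : ZMod (q^eps r)) = Nat.totient (q^eps r) ↔
    orderOf (p : ZMod (q^r)) = Nat.totient (q^r) := by
  have := pp_iff p q 1 hq hq2 hpq (Or.inl rfl) r hr
  rw [one_mul, one_mul] at this
  rw [eq_comm, this, eq_comm]

lemma half_iff (p q : ℕ) (hq : q.Prime) (hq2 : q ≠ 2) (hpq : Nat.Coprime p q)
    (r : ℕ) (hr : 1 ≤ r) :
    orderOf (p : ZMod (q^eps r)) = q ^ (eps r - 1) * (q - 1) / 2 ↔
    Nat.totient (q^r) = 2 * orderOf (p : ZMod (q^r)) := by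
  rw [← pp_iff p q 2 hq hq2 hpq (Or.inr rfl) r hr, Nat.totient_prime_pow hq (eps_pos r)]
  have : 2 ∣ q ^ (eps r - 1) * (q - 1) := by
    apply Dvd.dvd.mul_left
    have := hq.eq_two_or_odd
    omega
  omega

lemma gcd_aux (q r B : ℕ) (hq : q.Prime) (hq2 : q ≠ 2) (hr : 1 ≤ r) :
    Nat.gcd (q ^ (eps r - 1) * (q - 1)) B = 2 ↔ Nat.gcd (Nat.totient (q^r)) B = 2 := by
  rw [Nat.totient_prime_pow hq hr]
  by_cases h : r = 1
  · subst h; rfl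
  · rw [show eps r = 2 by simp [eps, h]]
    have key : ∀ j, 1 ≤ j → (Nat.gcd (q ^ j * (q - 1)) B = 2 ↔ Nat.Coprime q B ∧ Nat.gcd (q-1) B = 2) := by
      intro j hj
      by_cases hc : Nat.Coprime q B
      · rw [Nat.Coprime.gcd_mul_left_cancel _ (hc.pow_left j)]
        exact ⟨fun h => ⟨hc, h⟩, fun h => h.2⟩
      · simp only [hc, false_and, iff_false]
        intro h1
        have h2 : q ∣ B := by
          by_contra h3
          exact hc ((Nat.Prime.coprime_iff_not_dvd hq).2 h3)
        have h3 : q ∣ 2 := h1 ▸ Nat.dvd_gcd ((dvd_pow_self _ (by omega)).mul_right _) h2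
        exact hq2 ((Nat.prime_dvd_prime_iff_eq hq Nat.prime_two).1 h3)
    rw [key _ (by omega), key _ (by omega)]

lemma gcd_iff (q₁ r₁ q₂ r₂ : ℕ) (hq₁ : q₁.Prime) (hq₁2 : q₁ ≠ 2) (hr₁ : 1 ≤ r₁)
    (hq₂ : q₂.Prime) (hq₂2 : q₂ ≠ 2) (hr₂ : 1 ≤ r₂) :
    Nat.gcd (q₁ ^ (eps r₁ - 1) * (q₁ - 1)) (q₂ ^ (eps r₂ - 1) * (q₂ - 1)) = 2 ↔
    Nat.gcd (Nat.totient (q₁^r₁)) (Nat.totient (q₂^r₂)) = 2 := by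
  rw [gcd_aux _ _ _ hq₁ hq₁2 hr₁, Nat.gcd_comm, gcd_aux _ _ _ hq₂ hq₂2 hr₂, Nat.gcd_comm]

lemma odd_pow_mod4 (q r : ℕ) (hq : q.Prime) (hq2 : q ≠ 2) (hr : 1 ≤ r) :
    Nat.totient (q^r) % 4 = 2 ↔ q % 4 = 3 := by
  rw [Nat.totient_prime_pow hq hr]
  have ho := hq.eq_two_or_odd
  have h1 : Odd (q^(r-1)) := Odd.pow (Nat.odd_iff.2 (by omega))
  obtain ⟨m, hm⟩ := h1
  rw [hm]
  obtain ⟨t, ht⟩ : ∃ t, q - 1 = 2 * t := ⟨(q-1)/2, by have := hq.two_le; omega⟩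
  rw [ht, show (2*m+1)*(2*t) = 4 * (m*t) + 2*t by ring]
  have := hq.two_le
  omega

lemma ord_four_one (p : ℕ) (h : p % 4 = 1) : orderOf (p : ZMod 4) = 1 := by
  rw [← Nat.dvd_one, ord_one_iff, pow_one]; push_cast; omega

lemma ord_four_three (p : ℕ) (h : p % 4 = 3) : orderOf (p : ZMod 4) = 2 := by
  have : (p : ZMod 4) = ((3:ℕ) : ZMod 4) := by
    rw [ZMod.natCast_eq_natCast_iff']; omega
  rw [this]
  exact orderOf_eq_prime (by decide) (by decide)

lemma eight_iff (p : ℕ) (hp : ¬ 2 ∣ p) : Nat.totient 8 = 2 * orderOf (p : ZMod 8) ↔ p % 8 ≠ 1 := by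
  have h8 : Nat.totient 8 = 4 := by decide
  have h1 : orderOf (p : ZMod 8) ∣ 2 := two_pow_le p 3 hp le_rfl
  have h2 : orderOf (p : ZMod 8) ∣ 1 ↔ p % 8 = 1 := by
    rw [ord_one_iff, pow_one]; push_cast; omega
  rw [Nat.dvd_one] at h2
  rw [h8]
  rcases (Nat.dvd_prime Nat.prime_two).1 h1 with h | h <;> rw [h] at h2 ⊢ <;> omega

lemma pow_gt (q r : ℕ) (hq : q.Prime) (hq2 : q ≠ 2) (hr : 1 ≤ r) : 2 < q^r := by
  have h1 := hq.two_le
  have h2 := Nat.le_self_pow (show r ≠ 0 by omega) q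
  omega

lemma odd_pow (q r : ℕ) (hq : q.Prime) (hq2 : q ≠ 2) : ¬ 2 ∣ q^r := by
  intro h
  exact hq2 ((Nat.prime_dvd_prime_iff_eq Nat.prime_two hq).1 (Nat.prime_two.dvd_of_dvd_pow h)).symm

lemma d_iff (p q r : ℕ) (hp : ¬ 2 ∣ p) (hq : q.Prime) (hq2 : q ≠ 2) (hr : 1 ≤ r) (hpq : Nat.Coprime p q) :
    Nat.totient (4 * q^r) = 2 * orderOf (p : ZMod (4 * q^r)) ↔
      (orderOf ((p : ZMod (q ^ eps r))) = Nat.totient (q ^ eps r) ∨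
          (p % 4 = 3 ∧ q % 4 = 3 ∧
            orderOf ((p : ZMod (q ^ eps r))) = q ^ (eps r - 1) * (q - 1) / 2)) := by
  rw [prim_iff p q hq hq2 hpq r hr, half_iff p q hq hq2 hpq r hr]
  have h2 : Nat.Coprime 2 (q^r) := (Nat.Prime.coprime_iff_not_dvd Nat.prime_two).2 (odd_pow q r hq hq2)
  have hc : Nat.Coprime 4 (q^r) := h2.pow_left 2
  have hp2 : Nat.Coprime 2 p := (Nat.Prime.coprime_iff_not_dvd Nat.prime_two).2 hp
  have hp4 : Nat.Coprime p 4 := (hp2.pow_left 2).symm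
  have hgt := pow_gt q r hq hq2 hr
  rw [keyK p 4 (q^r) hc (by norm_num) hgt hp4 (hpq.pow_right r), show Nat.totient 4 = 2 by decide,
    Nat.gcd_eq_left (tot_even _ hgt), ← odd_pow_mod4 q r hq hq2 hr]
  have : p % 4 = 1 ∨ p % 4 = 3 := by omega
  rcases this with h | h
  · rw [ord_four_one p h]; omega
  · rw [ord_four_three p h]; omega

lemma e_fwd (p q₁ r₁ q₂ r₂ : ℕ) (hq₁ : q₁.Prime) (hq₁2 : q₁ ≠ 2) (hr₁ : 1 ≤ r₁)
    (hq₂ : q₂.Prime) (hq₂2 : q₂ ≠ 2) (hr₂ : 1 ≤ r₂) (hne : q₁ ≠ q₂) (hp1 : Nat.Coprime p q₁)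
    (hp2 : Nat.Coprime p q₂) :
    (Nat.totient (q₁ ^ r₁ * q₂ ^ r₂) = 2 * orderOf (p : ZMod (q₁ ^ r₁ * q₂ ^ r₂))) ↔
    Nat.gcd (Nat.totient (q₁^r₁)) (Nat.totient (q₂^r₂)) = 2 ∧
    ((q₂ % 4 = 3 ∧ ((orderOf ((p : ZMod (q₁ ^ eps r₁))) = Nat.totient (q₁ ^ eps r₁) ∧
            orderOf ((p : ZMod (q₂ ^ eps r₂))) = Nat.totient (q₂ ^ eps r₂)) ∨
          (orderOf ((p : ZMod (q₁ ^ eps r₁))) = Nat.totient (q₁ ^ eps r₁) ∧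
            orderOf ((p : ZMod (q₂ ^ eps r₂))) = q₂ ^ (eps r₂ - 1) * (q₂ - 1) / 2))) ∨
    (q₁ % 4 = 3 ∧ ((orderOf ((p : ZMod (q₂ ^ eps r₂))) = Nat.totient (q₂ ^ eps r₂) ∧
            orderOf ((p : ZMod (q₁ ^ eps r₁))) = Nat.totient (q₁ ^ eps r₁)) ∨
          (orderOf ((p : ZMod (q₂ ^ eps r₂))) = Nat.totient (q₂ ^ eps r₂) ∧
            orderOf ((p : ZMod (q₁ ^ eps r₁))) = q₁ ^ (eps r₁ - 1) * (q₁ - 1) / 2)))) := by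
  rw [prim_iff p q₁ hq₁ hq₁2 hp1 r₁ hr₁, half_iff p q₁ hq₁ hq₁2 hp1 r₁ hr₁,
    prim_iff p q₂ hq₂ hq₂2 hp2 r₂ hr₂, half_iff p q₂ hq₂ hq₂2 hp2 r₂ hr₂]
  have hc : Nat.Coprime (q₁^r₁) (q₂^r₂) := Nat.coprime_pow_primes _ _ hq₁ hq₂ hne
  have g1 := pow_gt q₁ r₁ hq₁ hq₁2 hr₁
  have g2 := pow_gt q₂ r₂ hq₂ hq₂2 hr₂
  rw [keyK p _ _ hc g1 g2 (hp1.pow_right _) (hp2.pow_right _),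
    ← odd_pow_mod4 q₁ r₁ hq₁ hq₁2 hr₁, ← odd_pow_mod4 q₂ r₂ hq₂ hq₂2 hr₂]
  have e1 := tot_even _ g1
  have e2 := tot_even _ g2
  apply and_congr_right
  intro hg
  have h4 : ¬ (4 ∣ Nat.totient (q₁^r₁) ∧ 4 ∣ Nat.totient (q₂^r₂)) := by
    rintro ⟨a, b⟩
    have := Nat.dvd_gcd a b
    rw [hg] at this
    omega
  omega

lemma fwd_aux (n p : ℕ) (hn : 0 < n) (hp : p.Prime) (hp2 : p ≠ 2) (hpn : ¬ p ∣ n)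
    (h : Nat.totient n = 2 * orderOf ((p : ZMod n))) :
    (∃ r, n = 2^r) ∨ (∃ q r : ℕ, q.Prime ∧ q ≠ 2 ∧ 1 ≤ r ∧ (n = q ^ r ∨ n = 2 * q ^ r ∨ n = 4 * q^r)) ∨
    (∃ q₁ q₂ r₁ r₂ : ℕ, q₁.Prime ∧ q₂.Prime ∧ q₁ ≠ 2 ∧ q₂ ≠ 2 ∧ q₁ ≠ q₂ ∧
        1 ≤ r₁ ∧ 1 ≤ r₂ ∧ (n = q₁ ^ r₁ * q₂ ^ r₂ ∨ n = 2 * (q₁ ^ r₁ * q₂ ^ r₂))) := by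
  have hp2' : ¬ 2 ∣ p := fun h => hp2 ((Nat.prime_dvd_prime_iff_eq Nat.prime_two hp).1 h).symm
  have hcn : Nat.Coprime p n := (Nat.Prime.coprime_iff_not_dvd hp).2 hpn
  -- splitting off an odd prime, or a power of two
  have split : ∀ m : ℕ, 0 < m → (∃ r, m = 2^r) ∨ ∃ q r m', q.Prime ∧ q ≠ 2 ∧ 1 ≤ r ∧ m = q^r * m' ∧ ¬ q ∣ m' ∧ 0 < m' := by
    intro m hm
    by_cases hex : ∃ q, q.Prime ∧ q ≠ 2 ∧ q ∣ m
    · right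
      obtain ⟨q, hq, hq2, hqm⟩ := hex
      obtain ⟨r, m', h1, h2⟩ := Nat.exists_eq_pow_mul_and_not_dvd hm.ne' q hq.ne_one
      refine ⟨q, r, m', hq, hq2, ?_, h2, h1, ?_⟩
      · by_contra hr
        have : r = 0 := by omega
        subst this
        rw [h2] at hqm
        simp at hqm
        exact h1 hqm
      · rcases Nat.eq_zero_or_pos m' with h | h
        · simp [h] at h1
        · exact h
    · left
      push Not at hex
      exact ⟨_, Nat.eq_prime_pow_of_unique_prime_dvd hm.ne' (fun {d} hd hdm => by
        by_contra h; exact hex d hd h hdm)⟩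
  rcases split n hn with h1 | ⟨q, r, m, hq, hq2, hr, hnm, hqm, hm⟩
  · exact Or.inl h1
  right
  have gq := pow_gt q r hq hq2 hr
  by_cases hm2 : m ≤ 2
  · left
    refine ⟨q, r, hq, hq2, hr, ?_⟩
    interval_cases m
    · left; simpa using hnm
    · right; left; rw [hnm, mul_comm]
  have hc : Nat.Coprime (q^r) m := ((Nat.Prime.coprime_iff_not_dvd hq).2 hqm).pow_left r
  have hpm : Nat.Coprime p m := Nat.Coprime.coprime_dvd_right (hnm ▸ dvd_mul_left _ _) hcn
  have hpq : Nat.Coprime p (q^r) := Nat.Coprime.coprime_dvd_right (hnm ▸ dvd_mul_right _ _) hcn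
  rw [hnm, keyK p _ _ hc gq (by omega) hpq hpm] at h
  have h' : orderOf (p : ZMod m) = Nat.totient m ∨ Nat.totient m % 4 = 2 ∧ Nat.totient m = 2 * orderOf (p : ZMod m) := by
    omega
  clear h
  rcases split m hm with ⟨a, rfl⟩ | ⟨q₂, s, m', hq', hq2', hs, hnm', hqm', hm'⟩
  · left
    refine ⟨q, r, hq, hq2, hr, Or.inr (Or.inr ?_)⟩
    have ha : 2 ≤ a := by
      by_contra hlt
      have : a = 0 ∨ a = 1 := by omega
      rcases this with rfl | rfl <;> simp at hm2
    rcases Nat.eq_or_lt_of_le ha with rfl | ha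
    · rw [hnm, mul_comm]; norm_num
    exfalso
    obtain ⟨b, rfl⟩ := Nat.exists_eq_add_of_le ha
    have hle := Nat.le_of_dvd (by positivity) (two_pow_le p _ hp2' ha)
    rw [Nat.totient_prime_pow Nat.prime_two (by omega), Nat.succ_eq_add_one,
      show 2 + 1 + b - 1 = b + 1 + 1 by omega] at h'
    rw [Nat.succ_eq_add_one, show 2 + 1 + b - 2 = b + 1 by omega] at hle
    have : 0 < 2^b := by positivity
    rw [pow_succ, pow_succ] at h'
    rw [pow_succ] at hle
    omega
  · right
    refine ⟨q, q₂, r, s, hq, hq', hq2, hq2', ?_, hr, hs, ?_⟩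
    · rintro rfl
      exact hqm (hnm' ▸ (dvd_pow_self _ (by omega)).mul_right _)
    by_cases hm2' : m' ≤ 2
    · interval_cases m'
      · left; rw [hnm, hnm']; ring
      · right; rw [hnm, hnm']; ring
    exfalso
    have g' := pow_gt q₂ s hq' hq2' hs
    have hc' : Nat.Coprime (q₂^s) m' := ((Nat.Prime.coprime_iff_not_dvd hq').2 hqm').pow_left s
    rcases h' with h' | h'
    · subst hnm'
      exact not_prim p _ _ hc' g' (by omega) (Nat.Coprime.coprime_dvd_right (dvd_mul_right _ _) hpm)
        (Nat.Coprime.coprime_dvd_right (dvd_mul_left _ _) hpm) h'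
    · have h4 : 2 * 2 ∣ Nat.totient m := by
        rw [hnm', Nat.totient_mul hc']
        exact mul_dvd_mul (tot_even _ g') (tot_even _ (by omega))
      omega

lemma odd_mul (a b : ℕ) (ha : ¬ 2 ∣ a) (hb : ¬ 2 ∣ b) : ¬ 2 ∣ a * b := by
  rw [Nat.Prime.dvd_mul Nat.prime_two]; tauto

/-- For an odd prime `p` and a positive integer `n` with `p ∤ n`, the characterization of
`φ(n) = 2·ord_n(p)`. -/
theorem totient_eq_two_mul_orderOf_iff (n : ℕ) (hn : 0 < n) (p : ℕ) (hp : p.Prime)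
    (hp2 : p ≠ 2) (hpn : ¬ p ∣ n) :
    Nat.totient n = 2 * orderOf ((p : ZMod n)) ↔
      -- (a)
      (((n = 4 ∧ p % 4 = 1) ∨ (n = 8 ∧ p % 8 ≠ 1)) ∨
      -- (b)
      (∃ r : ℕ, 4 ≤ r ∧ n = 2 ^ r ∧
        (p % 16 = 3 ∨ p % 16 = 13 ∨ p % 16 = 5 ∨ p % 16 = 11)) ∨
      -- (c)
      (∃ q r : ℕ, q.Prime ∧ q ≠ 2 ∧ 1 ≤ r ∧ (n = q ^ r ∨ n = 2 * q ^ r) ∧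
        orderOf ((p : ZMod (q ^ eps r))) = q ^ (eps r - 1) * (q - 1) / 2) ∨
      -- (d)
      (∃ q r : ℕ, q.Prime ∧ q ≠ 2 ∧ 1 ≤ r ∧ n = 4 * q ^ r ∧
        (orderOf ((p : ZMod (q ^ eps r))) = Nat.totient (q ^ eps r) ∨
          (p % 4 = 3 ∧ q % 4 = 3 ∧
            orderOf ((p : ZMod (q ^ eps r))) = q ^ (eps r - 1) * (q - 1) / 2))) ∨
      -- (e)
      (∃ q₁ q₂ r₁ r₂ : ℕ, q₁.Prime ∧ q₂.Prime ∧ q₁ ≠ 2 ∧ q₂ ≠ 2 ∧ q₁ ≠ q₂ ∧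
        1 ≤ r₁ ∧ 1 ≤ r₂ ∧ q₂ % 4 = 3 ∧
        Nat.gcd (q₁ ^ (eps r₁ - 1) * (q₁ - 1)) (q₂ ^ (eps r₂ - 1) * (q₂ - 1)) = 2 ∧
        (n = q₁ ^ r₁ * q₂ ^ r₂ ∨ n = 2 * (q₁ ^ r₁ * q₂ ^ r₂)) ∧
        ((orderOf ((p : ZMod (q₁ ^ eps r₁))) = Nat.totient (q₁ ^ eps r₁) ∧
            orderOf ((p : ZMod (q₂ ^ eps r₂))) = Nat.totient (q₂ ^ eps r₂)) ∨
          (orderOf ((p : ZMod (q₁ ^ eps r₁))) = Nat.totient (q₁ ^ eps r₁) ∧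
            orderOf ((p : ZMod (q₂ ^ eps r₂))) = q₂ ^ (eps r₂ - 1) * (q₂ - 1) / 2)))) := by
  have hp2' : ¬ 2 ∣ p := fun h => hp2 ((Nat.prime_dvd_prime_iff_eq Nat.prime_two hp).1 h).symm
  have hcn : Nat.Coprime p n := (Nat.Prime.coprime_iff_not_dvd hp).2 hpn
  have cop : ∀ q r : ℕ, 1 ≤ r → q^r ∣ n → Nat.Coprime p q := fun q r hr h =>
    Nat.Coprime.coprime_dvd_right ((dvd_pow_self q (by omega)).trans h) hcn
  constructor
  · intro h
    rcases fwd_aux n p hn hp hp2 hpn h with ⟨r, rfl⟩ | ⟨q, r, hq, hq2, hr, hnm⟩ |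
        ⟨q₁, q₂, r₁, r₂, hq₁, hq₂, hq₁2, hq₂2, hne, hr₁, hr₂, hnm⟩
    · by_cases hr : 4 ≤ r
      · exact Or.inr (Or.inl ⟨r, hr, rfl, (two_pow_iff p r hp2' hr).1 h⟩)
      · left
        have : r = 0 ∨ r = 1 ∨ r = 2 ∨ r = 3 := by omega
        rcases this with rfl | rfl | rfl | rfl
        · simp at h; omega
        · simp at h; omega
        · left
          refine ⟨rfl, ?_⟩
          by_contra h1
          have h3 : p % 4 = 3 := by omega
          have h4 := ord_four_three p h3
          have h5 : Nat.totient 4 = 2 := by decide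
          change Nat.totient 4 = 2 * orderOf (p : ZMod 4) at h
          omega
        · right
          exact ⟨rfl, (eight_iff p hp2').1 h⟩
    · have hpq : Nat.Coprime p q := cop q r hr (by
        rcases hnm with h | h | h <;> rw [h]
        · exact dvd_mul_left _ _
        · exact dvd_mul_left _ _)
      rcases hnm with rfl | rfl | rfl
      · exact Or.inr (Or.inr (Or.inl ⟨q, r, hq, hq2, hr, Or.inl rfl, (half_iff p q hq hq2 hpq r hr).2 h⟩))
      · obtain ⟨h1, h2⟩ := two_mul_red p (q^r) (odd_pow q r hq hq2) hp2'
        rw [h1, h2] at h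
        exact Or.inr (Or.inr (Or.inl ⟨q, r, hq, hq2, hr, Or.inr rfl, (half_iff p q hq hq2 hpq r hr).2 h⟩))
      · exact Or.inr (Or.inr (Or.inr (Or.inl ⟨q, r, hq, hq2, hr, rfl, (d_iff p q r hp2' hq hq2 hr hpq).1 h⟩)))
    · have hdvd : q₁ ^ r₁ * q₂ ^ r₂ ∣ n := by
        rcases hnm with h | h <;> rw [h]
        exact dvd_mul_left _ _
      have hp1 := cop q₁ r₁ hr₁ ((dvd_mul_right _ _).trans hdvd)
      have hp2 := cop q₂ r₂ hr₂ ((dvd_mul_left _ _).trans hdvd)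
      have h' : Nat.totient (q₁ ^ r₁ * q₂ ^ r₂) = 2 * orderOf (p : ZMod (q₁ ^ r₁ * q₂ ^ r₂)) := by
        rcases hnm with rfl | rfl
        · exact h
        · obtain ⟨h1, h2⟩ := two_mul_red p (q₁ ^ r₁ * q₂ ^ r₂)
            (odd_mul _ _ (odd_pow q₁ r₁ hq₁ hq₁2) (odd_pow q₂ r₂ hq₂ hq₂2)) hp2'
          rwa [h1, h2] at h
      rw [e_fwd p q₁ r₁ q₂ r₂ hq₁ hq₁2 hr₁ hq₂ hq₂2 hr₂ hne hp1 hp2] at h'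
      obtain ⟨hg, ⟨h3, h4⟩ | ⟨h3, h4⟩⟩ := h'
      · exact Or.inr (Or.inr (Or.inr (Or.inr ⟨q₁, q₂, r₁, r₂, hq₁, hq₂, hq₁2, hq₂2, hne, hr₁, hr₂, h3,
          (gcd_iff _ _ _ _ hq₁ hq₁2 hr₁ hq₂ hq₂2 hr₂).2 hg, hnm, h4⟩)))
      · rw [Nat.gcd_comm] at hg
        rw [mul_comm (q₁ ^ r₁)] at hnm
        exact Or.inr (Or.inr (Or.inr (Or.inr ⟨q₂, q₁, r₂, r₁, hq₂, hq₁, hq₂2, hq₁2, hne.symm, hr₂, hr₁, h3,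
          (gcd_iff _ _ _ _ hq₂ hq₂2 hr₂ hq₁ hq₁2 hr₁).2 hg, hnm, h4⟩)))
  · rintro ((⟨rfl, h⟩ | ⟨rfl, h⟩) | ⟨r, hr, rfl, h⟩ | ⟨q, r, hq, hq2, hr, hnm, h⟩ | ⟨q, r, hq, hq2, hr, rfl, h⟩ |
      ⟨q₁, q₂, r₁, r₂, hq₁, hq₂, hq₁2, hq₂2, hne, hr₁, hr₂, h3, hg, hnm, h4⟩)
    · rw [ord_four_one p h]; decide
    · exact (eight_iff p hp2').2 h
    · exact (two_pow_iff p r hp2' hr).2 h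
    · have hpq : Nat.Coprime p q := cop q r hr (by
        rcases hnm with h | h <;> rw [h]
        exact dvd_mul_left _ _)
      rw [half_iff p q hq hq2 hpq r hr] at h
      rcases hnm with rfl | rfl
      · exact h
      · obtain ⟨h1, h2⟩ := two_mul_red p (q^r) (odd_pow q r hq hq2) hp2'
        rwa [h1, h2]
    · exact (d_iff p q r hp2' hq hq2 hr (cop q r hr (dvd_mul_left _ _))).2 h
    · have hdvd : q₁ ^ r₁ * q₂ ^ r₂ ∣ n := by
        rcases hnm with h | h <;> rw [h]
        exact dvd_mul_left _ _
      have hp1 := cop q₁ r₁ hr₁ ((dvd_mul_right _ _).trans hdvd)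
      have hp2 := cop q₂ r₂ hr₂ ((dvd_mul_left _ _).trans hdvd)
      have h' := (e_fwd p q₁ r₁ q₂ r₂ hq₁ hq₁2 hr₁ hq₂ hq₂2 hr₂ hne hp1 hp2).2
        ⟨(gcd_iff _ _ _ _ hq₁ hq₁2 hr₁ hq₂ hq₂2 hr₂).1 hg, Or.inl ⟨h3, h4⟩⟩
      rcases hnm with rfl | rfl
      · exact h'
      · obtain ⟨h1, h2⟩ := two_mul_red p (q₁ ^ r₁ * q₂ ^ r₂)
          (odd_mul _ _ (odd_pow q₁ r₁ hq₁ hq₁2) (odd_pow q₂ r₂ hq₂ hq₂2)) hp2'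
        rwa [h1, h2]
end

section
/- Let n be a positive integer and let p be an odd prime with p ∤ n. Then ord_n(p) = φ(n)/2 with φ(n)/2 odd if and only if one of the following holds: (a) n = 4 and p ≡ 1 (mod 4); (b) n = q^r or n = 2q^r for some odd prime q with q ≡ 3 (mod 4) and r ≥ 1, and ord_{q^{ε(r)}}(p) = q^{ε(r)−1}(q−1)/2. -/
theorem ord_dvd_iff (n p k : ℕ) : orderOf ((p : ZMod n)) ∣ k ↔ (n : ℤ) ∣ (p : ℤ) ^ k - 1 := by
  rw [orderOf_dvd_iff_pow_eq_one, ← CharP.intCast_eq_zero_iff (ZMod n) n]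
  push_cast
  rw [sub_eq_zero]

theorem ord_dvd_totient (n p : ℕ) (h : p.Coprime n) :
    orderOf ((p : ZMod n)) ∣ Nat.totient n := by
  rw [orderOf_dvd_iff_pow_eq_one]
  have := congrArg (Units.val) (ZMod.pow_totient (ZMod.unitOfCoprime p h))
  rwa [Units.val_pow_eq_pow_val, ZMod.coe_unitOfCoprime, Units.val_one] at this

theorem lift_step (q s k : ℕ) (x : ℤ) (h : (q : ℤ) ^ (s + 1) ∣ x - 1) :
    (q : ℤ) ^ (s + 1 + k) ∣ x ^ (q ^ k) - 1 := by
  induction k with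
  | zero => simpa using h
  | succ k ih =>
    have h1 : (q : ℤ) ∣ x ^ (q ^ k) - 1 := dvd_trans (dvd_pow_self _ (by omega)) ih
    have h2 := dvd_geom_sum₂_self h1
    have h3 := Commute.geom_sum₂_mul (Commute.all (x ^ (q ^ k)) 1) q
    rw [one_pow] at h3
    rw [pow_succ q k, pow_mul, ← h3, ← add_assoc, pow_succ', ]
    exact mul_dvd_mul h2 ih

theorem key_fwd (q h s p : ℕ) (hq : q.Prime) (hqh : q = 2 * h + 1) (hh : Odd h)
    (hc : p.Coprime q) (H : orderOf ((p : ZMod (q ^ (s + 2)))) = q ^ (s + 1) * h) :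
    orderOf ((p : ZMod (q ^ 2))) = q * h := by
  have hqo : Odd q := ⟨h, hqh⟩
  have h1 : orderOf ((p : ZMod (q ^ 2))) ∣ q ^ (s + 1) * h := by
    rw [← H, ord_dvd_iff]
    refine dvd_trans ?_ ((ord_dvd_iff (q ^ (s + 2)) p _).1 dvd_rfl)
    push_cast
    exact pow_dvd_pow _ (by omega)
  have h2 : orderOf ((p : ZMod (q ^ 2))) ∣ q * (2 * h) := by
    have := ord_dvd_totient (q ^ 2) p (hc.pow_right 2)
    rw [Nat.totient_prime_pow hq (by norm_num)] at this
    have e : q - 1 = 2 * h := by omega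
    simpa [e] using this
  have h3 : q ^ (s + 1) * h ∣ orderOf ((p : ZMod (q ^ 2))) * q ^ s := by
    rw [← H, ord_dvd_iff, pow_mul]
    have := (ord_dvd_iff (q ^ 2) p _).1 dvd_rfl
    push_cast at this
    have := lift_step q 1 s _ this
    push_cast
    convert this using 2
    ring
  have h4 : q * h ∣ orderOf ((p : ZMod (q ^ 2))) := by
    have e : q ^ (s + 1) * h = q * h * q ^ s := by ring
    rw [e] at h3
    exact Nat.dvd_of_mul_dvd_mul_right (pow_pos hq.pos s) h3
  have h5 : Odd (orderOf ((p : ZMod (q ^ 2)))) :=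
    Odd.of_dvd_nat ((hqo.pow).mul hh) h1
  apply Nat.dvd_antisymm _ h4
  have e : q * (2 * h) = 2 * (q * h) := by ring
  rw [e] at h2
  exact (Nat.Coprime.dvd_mul_left (Nat.coprime_two_right.2 h5)).1 h2

theorem key_bwd (q h s p : ℕ) (hq : q.Prime) (hqh : q = 2 * h + 1) (hh : Odd h)
    (hc : p.Coprime q) (H : orderOf ((p : ZMod (q ^ 2))) = q * h) :
    orderOf ((p : ZMod (q ^ (s + 2)))) = q ^ (s + 1) * h := by
  have hhp : 0 < h := hh.pos
  have hcop : Nat.Coprime q h := by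
    rw [hq.coprime_iff_not_dvd]
    intro hd
    have := Nat.le_of_dvd hhp hd
    omega
  have hlast : orderOf ((p : ZMod (q ^ (s + 2)))) ∣ q ^ (s + 1) * h := by
    have := (ord_dvd_iff (q ^ 2) p _).1 dvd_rfl
    rw [H] at this
    push_cast at this
    have := lift_step q 1 s _ this
    rw [← pow_mul] at this
    rw [ord_dvd_iff]
    push_cast
    convert this using 2
    · ring
    · congr 1; ring
  have hge : q * h ∣ orderOf ((p : ZMod (q ^ (s + 2)))) := by
    rw [← H, ord_dvd_iff]
    refine dvd_trans ?_ ((ord_dvd_iff (q ^ (s + 2)) p _).1 dvd_rfl)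
    push_cast
    exact pow_dvd_pow _ (by omega)
  have hq1 : orderOf ((p : ZMod q)) ∣ h := by
    have a1 : orderOf ((p : ZMod q)) ∣ q * h := by
      rw [← H, ord_dvd_iff]
      refine dvd_trans ?_ ((ord_dvd_iff (q ^ 2) p _).1 dvd_rfl)
      push_cast
      exact dvd_pow_self _ (by omega)
    have a2 := ord_dvd_totient q p hc
    rw [Nat.totient_prime hq] at a2
    refine Nat.Coprime.dvd_of_dvd_mul_left ?_ a1
    refine Nat.Coprime.coprime_dvd_left a2 ?_
    rw [Nat.coprime_comm]
    have : q = (q - 1) + 1 := by have := hq.pos; omega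
    conv_lhs => rw [this]
    simp
  obtain ⟨a, ha⟩ := (ord_dvd_iff q p h).1 hq1
  have hna : ¬ (q : ℤ) ∣ a := by
    rintro ⟨b, rfl⟩
    have : orderOf ((p : ZMod (q ^ 2))) ∣ h := by
      rw [ord_dvd_iff, ha]
      exact ⟨b, by push_cast; ring⟩
    rw [H] at this
    have := Nat.le_of_dvd hhp this
    nlinarith [hq.two_le]
  have ho := ZMod.orderOf_one_add_mul_prime hq (by omega) a hna (s + 1)
  have hx : (1 + q * a : ZMod (q ^ (s + 1 + 1))) = (p : ZMod (q ^ (s + 2))) ^ h := by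
    have : (1 + q * a : ℤ) = (p : ℤ) ^ h := by linarith
    have := congrArg (Int.cast : ℤ → ZMod (q ^ (s + 2))) this
    push_cast at this
    exact this
  rw [hx] at ho
  have hpow : q ^ (s + 1) ∣ orderOf ((p : ZMod (q ^ (s + 2)))) := by
    rw [← ho]
    exact orderOf_pow_dvd h
  exact Nat.dvd_antisymm hlast
    ((hcop.pow_left _).mul_dvd_of_dvd_of_dvd hpow ((Dvd.intro_left _ rfl).trans hge))

theorem prime_pow_case (q r p : ℕ) (hq : q.Prime) (hq4 : q % 4 = 3) (hr : 1 ≤ r)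
    (hc : p.Coprime q) :
    (2 * orderOf ((p : ZMod (q ^ r))) = Nat.totient (q ^ r) ∧
      Odd (orderOf ((p : ZMod (q ^ r))))) ↔
      orderOf ((p : ZMod (q ^ eps r))) = q ^ (eps r - 1) * (q - 1) / 2 := by
  obtain ⟨h, hqh⟩ : ∃ h, q = 2 * h + 1 := ⟨q / 2, by omega⟩
  have hh : Odd h := by rw [Nat.odd_iff]; omega
  have hqo : Odd q := ⟨h, hqh⟩
  have e1 : q - 1 = 2 * h := by omega
  have key : (2 * orderOf ((p : ZMod (q ^ r))) = Nat.totient (q ^ r) ∧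
      Odd (orderOf ((p : ZMod (q ^ r))))) ↔
      orderOf ((p : ZMod (q ^ r))) = q ^ (r - 1) * h := by
    rw [Nat.totient_prime_pow hq hr, e1, mul_left_comm]
    constructor
    · rintro ⟨a, _⟩
      omega
    · intro a
      rw [a]
      exact ⟨rfl, hqo.pow.mul hh⟩
  rw [key, e1, mul_left_comm, Nat.mul_div_cancel_left _ (by norm_num)]
  by_cases h1 : r = 1
  · subst h1
    have e : eps 1 = 1 := rfl
    rw [e, Nat.sub_self, pow_zero]
  · obtain ⟨s, rfl⟩ : ∃ s, r = s + 2 := ⟨r - 2, by omega⟩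
    simp only [eps, h1, if_false]
    norm_num
    exact ⟨key_fwd q h s p hq hqh hh hc, key_bwd q h s p hq hqh hh hc⟩

theorem ord_two_mul (m p : ℕ) (hm : Odd m) (hp : Odd p) :
    orderOf ((p : ZMod (2 * m))) = orderOf ((p : ZMod m)) := by
  refine Nat.dvd_right_iff_eq.1 fun k => ?_
  rw [ord_dvd_iff, ord_dvd_iff]
  push_cast
  constructor
  · exact fun h => (Dvd.intro_left _ rfl).trans h
  · intro h
    refine IsCoprime.mul_dvd ?_ ?_ h
    · have := Nat.isCoprime_iff_coprime.2 (Nat.coprime_two_left.2 hm)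
      exact_mod_cast this
    · have : Odd ((p : ℤ) ^ k) := Odd.pow (by exact_mod_cast hp)
      exact (this.sub_odd odd_one).two_dvd

theorem cyclic_of_half (n p : ℕ) (hn : 2 < n) (hc : p.Coprime n)
    (h : 2 * orderOf ((p : ZMod n)) = Nat.totient n) (ho : Odd (orderOf ((p : ZMod n)))) :
    IsCyclic (ZMod n)ˣ := by
  have : NeZero n := ⟨by omega⟩
  have : Fact (2 < n) := ⟨hn⟩
  set g := ZMod.unitOfCoprime p hc with hg
  have hgo : orderOf g = orderOf ((p : ZMod n)) := by
    rw [← orderOf_units]; simp [hg]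
  have h2 : orderOf (-1 : (ZMod n)ˣ) = 2 := by
    apply orderOf_eq_prime (by simp)
    intro e
    have := congrArg Units.val e
    simp at this
    exact ZMod.neg_one_ne_one this
  apply isCyclic_of_orderOf_eq_card ((-1) * g)
  rw [(Commute.all _ _).orderOf_mul_eq_mul_orderOf_of_coprime, h2, hgo, h,
    Nat.card_eq_fintype_card, ZMod.card_units_eq_totient]
  rw [h2, hgo]
  exact Nat.coprime_two_left.2 ho

/-- For an odd prime `p` and a positive integer `n` with `p ∤ n`, one has
`ord_n(p) = φ(n)/2` with `φ(n)/2` odd iff (a) `n = 4` and `p ≡ 1 (mod 4)`, or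
(b) `n = q^r` or `2·q^r` for an odd prime `q ≡ 3 (mod 4)` and `r ≥ 1`, with
`ord_{q^(eps r)}(p) = q^(eps r - 1)(q-1)/2`. -/
theorem orderOf_eq_half_totient_odd_iff (n : ℕ) (hn : 0 < n) (p : ℕ) (hp : p.Prime)
    (hp2 : p ≠ 2) (hpn : ¬ p ∣ n) :
    (2 * orderOf ((p : ZMod n)) = Nat.totient n ∧ Odd (orderOf ((p : ZMod n)))) ↔
      ((n = 4 ∧ p % 4 = 1) ∨
        (∃ q r : ℕ, q.Prime ∧ q ≠ 2 ∧ q % 4 = 3 ∧ 1 ≤ r ∧ (n = q ^ r ∨ n = 2 * q ^ r) ∧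
          orderOf ((p : ZMod (q ^ eps r))) = q ^ (eps r - 1) * (q - 1) / 2)) := by
  have hpo : Odd p := hp.odd_of_ne_two hp2
  have hcn : p.Coprime n := (hp.coprime_iff_not_dvd).2 hpn
  have big : ∀ q r : ℕ, q.Prime → q % 4 = 3 → 1 ≤ r → (n = q ^ r ∨ n = 2 * q ^ r) →
      ((2 * orderOf ((p : ZMod n)) = Nat.totient n ∧ Odd (orderOf ((p : ZMod n)))) ↔
        orderOf ((p : ZMod (q ^ eps r))) = q ^ (eps r - 1) * (q - 1) / 2) := by
    intro q r hq hq4 hr hnq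
    have hqo : Odd q := by rw [Nat.odd_iff]; omega
    have hqn : q ∣ n := by
      rcases hnq with rfl | rfl
      · exact dvd_pow_self _ (by omega)
      · exact (dvd_pow_self _ (by omega)).mul_left _
    rw [← prime_pow_case q r p hq hq4 hr (hcn.coprime_dvd_right hqn)]
    rcases hnq with e | e
    · rw [e]
    · rw [e, ord_two_mul _ _ hqo.pow hpo, Nat.totient_two_mul_of_odd hqo.pow]
  constructor
  · rintro ⟨h, ho⟩
    have hn2 : 2 < n := by
      by_contra hlt
      have : n = 1 ∨ n = 2 := by omega
      rcases this with e | e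
      · have : Nat.totient n = 1 := by rw [e]; rfl
        omega
      · have : Nat.totient n = 1 := by rw [e]; rfl
        omega
    have hcyc := cyclic_of_half n p hn2 hcn h ho
    rw [ZMod.isCyclic_units_iff] at hcyc
    rcases hcyc with e | e | e | e | ⟨q, r, hq, hqo, hr, hnq⟩
    · omega
    · omega
    · omega
    · left
      refine ⟨e, ?_⟩
      have h4 : Nat.totient n = 2 := by rw [e]; rfl
      have : orderOf ((p : ZMod n)) ∣ 1 := by
        have : orderOf ((p : ZMod n)) = 1 := by omega
        rw [this]
      rw [ord_dvd_iff, e, pow_one] at this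
      omega
    · right
      have hq4 : q % 4 = 3 := by
        have ht : Nat.totient n = q ^ (r - 1) * (q - 1) := by
          rcases hnq with e | e
          · rw [e, Nat.totient_prime_pow hq (by omega)]
          · rw [e, Nat.totient_two_mul_of_odd (hqo.pow), Nat.totient_prime_pow hq (by omega)]
        by_contra hne
        have hd : 4 ∣ q - 1 := by
          have := Nat.odd_iff.1 hqo
          omega
        have : 4 ∣ Nat.totient n := by rw [ht]; exact hd.mul_left _
        have := Nat.odd_iff.1 ho
        omega
      exact ⟨q, r, hq, by omega, hq4, by omega, hnq, (big q r hq hq4 (by omega) hnq).1 ⟨h, ho⟩⟩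
  · rintro (⟨e, h4⟩ | ⟨q, r, hq, _, hq4, hr, hnq, H⟩)
    · have h1 : orderOf ((p : ZMod n)) = 1 := by
        apply Nat.dvd_one.1
        rw [ord_dvd_iff, e, pow_one]
        omega
      rw [h1, e]
      exact ⟨rfl, odd_one⟩
    · exact (big q r hq hq4 hr hnq).2 H
end

section
/- Let n be a positive integer and let p be an odd prime with p ∤ n. Then ord_n(p) = φ(n)/2 and ord_m(p) = φ(m) for every divisor m of n with m ≠ n, if and only if one of the following holds: (a) n = 4 and p ≡ 1 (mod 4), or n = 8 and p ≡ 3 (mod 4); (b) n = q is an odd prime and ord_q(p) = (q−1)/2; (c) n = 4q for some odd prime q, p ≡ 3 (mod 4), and p is a primitive root of q; (d) n = q₁q₂ is a product of two distinct primes, p is a primitive root of both q₁ and q₂, and gcd(q₁−1, q₂−1) = 2. -/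
theorem aux_mul (a b p : ℕ) (h : a.Coprime b) :
    orderOf (p : ZMod (a * b)) = Nat.lcm (orderOf (p : ZMod a)) (orderOf (p : ZMod b)) := by
  have := orderOf_injective (ZMod.chineseRemainder h : ZMod (a * b) →* ZMod a × ZMod b)
    (ZMod.chineseRemainder h).injective (p : ZMod (a * b))
  rw [← this, Prod.orderOf]
  simp

theorem aux_dvd_s8 (m n p : ℕ) (h : m ∣ n) :
    orderOf (p : ZMod m) ∣ orderOf (p : ZMod n) := by
  have := orderOf_map_dvd (ZMod.castHom h (ZMod m) : ZMod n →* ZMod m) (p : ZMod n)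
  simpa using this

theorem aux_one (p : ℕ) : orderOf (p : ZMod 1) = 1 := by
  rw [orderOf_eq_one_iff]; exact Subsingleton.elim _ _

theorem aux_two (p : ℕ) (hp : p % 2 = 1) : orderOf (p : ZMod 2) = 1 := by
  rw [orderOf_eq_one_iff, ← ZMod.natCast_mod, hp]; rfl

theorem aux_four1 (p : ℕ) (hp : p % 4 = 1) : orderOf (p : ZMod 4) = 1 := by
  rw [orderOf_eq_one_iff, ← ZMod.natCast_mod, hp]; rfl

theorem aux_four3 (p : ℕ) (hp : p % 4 = 3) : orderOf (p : ZMod 4) = 2 := by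
  rw [← ZMod.natCast_mod, hp]
  exact orderOf_eq_prime (by decide) (by decide)

theorem aux_eight_sq (p : ℕ) (hp : p % 2 = 1) : orderOf (p : ZMod 8) ∣ 2 := by
  rw [orderOf_dvd_iff_pow_eq_one, ← ZMod.natCast_mod]
  have : p % 8 = 1 ∨ p % 8 = 3 ∨ p % 8 = 5 ∨ p % 8 = 7 := by omega
  rcases this with h | h | h | h <;> rw [h] <;> decide

theorem aux_eight3 (p : ℕ) (hp : p % 4 = 3) : orderOf (p : ZMod 8) = 2 := by
  refine Nat.dvd_antisymm (aux_eight_sq p (by omega)) ?_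
  rw [← aux_four3 p hp]
  exact aux_dvd_s8 4 8 p (by norm_num)

theorem aux_tot4 : Nat.totient 4 = 2 := by decide
theorem aux_tot8 : Nat.totient 8 = 4 := by decide

/-- `p` is not primitive modulo a product of two coprime numbers larger than two. -/
theorem aux_not_prim (a b p : ℕ) (h : a.Coprime b) (ha : 2 < a) (hb : 2 < b)
    (h1 : orderOf (p : ZMod a) = Nat.totient a) (h2 : orderOf (p : ZMod b) = Nat.totient b)
    (h3 : orderOf (p : ZMod (a * b)) = Nat.totient (a * b)) : False := by
  rw [aux_mul a b p h, h1, h2, Nat.totient_mul h] at h3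
  have e := Nat.gcd_mul_lcm (Nat.totient a) (Nat.totient b)
  have g : 2 ∣ Nat.gcd (Nat.totient a) (Nat.totient b) :=
    Nat.dvd_gcd (Nat.totient_even ha).two_dvd (Nat.totient_even hb).two_dvd
  have pa := Nat.totient_pos.2 (show 0 < a by omega)
  have pb := Nat.totient_pos.2 (show 0 < b by omega)
  have pm := Nat.mul_pos pa pb
  have pg := Nat.gcd_pos_of_pos_left (Nat.totient b) pa
  have := Nat.le_of_dvd pg g
  rw [h3] at e
  nlinarith

theorem aux_two_pow (m : ℕ) (hm : m ≠ 0) (h : ∀ r : ℕ, r.Prime → r ≠ 2 → ¬ r ∣ m) :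
    m = 1 ∨ m = 2 ∨ m = 4 ∨ 8 ∣ m := by
  have e : m = 2 ^ m.primeFactorsList.length := by
    refine Nat.eq_prime_pow_of_unique_prime_dvd hm ?_
    intro d hd hdm
    by_contra h2
    exact h d hd h2 hdm
  generalize m.primeFactorsList.length = k at e
  match k with
  | 0 => simp_all
  | 1 => simp_all
  | 2 => simp_all
  | k + 3 => right; right; right; rw [e, pow_add]; exact Dvd.intro_left _ rfl

theorem aux_forward (n : ℕ) (hn : 0 < n) (p : ℕ) (hp1 : p % 2 = 1)
    (H : 2 * orderOf ((p : ZMod n)) = Nat.totient n)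
    (D : ∀ m : ℕ, m ∣ n → m ≠ n → orderOf ((p : ZMod m)) = Nat.totient m) :
      (((n = 4 ∧ p % 4 = 1) ∨ (n = 8 ∧ p % 4 = 3)) ∨
        (n.Prime ∧ n ≠ 2 ∧ orderOf ((p : ZMod n)) = (n - 1) / 2) ∨
        (∃ q : ℕ, q.Prime ∧ q ≠ 2 ∧ n = 4 * q ∧ p % 4 = 3 ∧
          orderOf ((p : ZMod q)) = Nat.totient q) ∨
        (∃ q₁ q₂ : ℕ, q₁.Prime ∧ q₂.Prime ∧ q₁ ≠ q₂ ∧ n = q₁ * q₂ ∧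
          orderOf ((p : ZMod q₁)) = Nat.totient q₁ ∧
          orderOf ((p : ZMod q₂)) = Nat.totient q₂ ∧
          Nat.gcd (q₁ - 1) (q₂ - 1) = 2)) := by
  have p4 : p % 4 = 1 ∨ p % 4 = 3 := by omega
  have K : ∀ m : ℕ, m ∣ n → m ≠ n → 2 * Nat.totient m ∣ Nat.totient n := by
    intro m h1 h2
    rw [← H, ← D m h1 h2]
    exact Nat.mul_dvd_mul_left 2 (aux_dvd_s8 m n p h1)
  by_cases hq : ∃ q : ℕ, q.Prime ∧ q ≠ 2 ∧ q ∣ n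
  · obtain ⟨q, qp, q2, m, rfl⟩ := hq
    have qg : 2 < q := lt_of_le_of_ne qp.two_le (Ne.symm q2)
    have qodd : Odd q := qp.odd_of_ne_two q2
    have m0 : 0 < m := Nat.pos_of_mul_pos_left hn
    by_cases hqm : q ∣ m
    · exfalso
      have k := K m (Dvd.intro_left _ rfl) (by nlinarith)
      rw [Nat.totient_mul_of_prime_of_dvd qp hqm] at k
      have := Nat.dvd_of_mul_dvd_mul_right (Nat.totient_pos.2 m0) k
      exact (Nat.not_even_iff_odd.2 qodd) (even_iff_two_dvd.2 this)
    have cop : q.Coprime m := (Nat.Prime.coprime_iff_not_dvd qp).2 hqm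
    by_cases hm1 : m = 1
    · subst hm1
      rw [mul_one] at *
      right; left
      refine ⟨qp, q2, ?_⟩
      rw [Nat.totient_prime qp] at H
      omega
    have Dq := D q (Dvd.intro _ rfl) (by
      intro h; apply hm1; exact Nat.eq_of_mul_eq_mul_left qp.pos (by omega))
    by_cases hr : ∃ r : ℕ, r.Prime ∧ r ≠ 2 ∧ r ∣ m
    · obtain ⟨r, rp, r2, hrm⟩ := hr
      have rg : 2 < r := lt_of_le_of_ne rp.two_le (Ne.symm r2)
      have hqr : q ≠ r := by rintro rfl; exact hqm hrm
      have cqr : q.Coprime r := (Nat.coprime_primes qp rp).2 hqr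
      have Dr := D r (hrm.trans (Dvd.intro_left _ rfl)) (by
        intro h
        have := Nat.le_of_dvd m0 hrm
        nlinarith)
      by_cases hmr : m = r
      · subst hmr
        right; right; right
        refine ⟨q, m, qp, rp, hqr, rfl, Dq, Dr, ?_⟩
        rw [aux_mul q m p cqr, Dq, Dr, Nat.totient_mul cqr,
          ← Nat.gcd_mul_lcm (Nat.totient q) (Nat.totient m)] at H
        have lp : 0 < Nat.lcm (Nat.totient q) (Nat.totient m) :=
          Nat.lcm_pos (Nat.totient_pos.2 qp.pos) (Nat.totient_pos.2 m0)
        have := Nat.eq_of_mul_eq_mul_right lp H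
        rw [Nat.totient_prime qp, Nat.totient_prime rp] at this
        exact this.symm
      · exfalso
        refine aux_not_prim q r p cqr qg rg Dq Dr (D _ (Nat.mul_dvd_mul_left q hrm) ?_)
        intro h
        exact hmr (Nat.eq_of_mul_eq_mul_left qp.pos h).symm
    · have c2 : Nat.Coprime q 2 := Nat.coprime_two_right.2 qodd
      have c4 : Nat.Coprime q 4 := by
        have := Nat.Coprime.pow_right 2 c2
        simpa using this
      rcases aux_two_pow m m0.ne' (fun r h1 h2 h3 => hr ⟨r, h1, h2, h3⟩) with h | h | h | h
      · exact absurd h hm1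
      · exfalso
        subst h
        have k := K q (Dvd.intro _ rfl) (by omega)
        rw [Nat.totient_mul c2, Nat.totient_two, mul_one] at k
        have pq := Nat.totient_pos.2 qp.pos
        have := Nat.le_of_dvd pq k
        omega
      · subst h
        right; right; left
        refine ⟨q, qp, q2, by ring, ?_, Dq⟩
        have D4 := D 4 (Dvd.intro_left _ rfl) (by omega)
        rcases p4 with h | h
        · rw [aux_four1 p h, aux_tot4] at D4
          omega
        · exact h
      · exfalso
        have h4 : 4 ∣ m := (show 4 ∣ 8 by norm_num).trans h
        have m8 := Nat.le_of_dvd m0 h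
        refine aux_not_prim q 4 p c4 qg (by norm_num) Dq (D 4 (h4.trans (Dvd.intro_left _ rfl)) ?_)
          (D _ (Nat.mul_dvd_mul_left q h4) ?_)
        · nlinarith
        · intro h
          have := Nat.eq_of_mul_eq_mul_left qp.pos h
          omega
  · rcases aux_two_pow n hn.ne' (fun r h1 h2 h3 => hq ⟨r, h1, h2, h3⟩) with h | h | h | h
    · subst h
      rw [Nat.totient_one] at H
      omega
    · subst h
      rw [Nat.totient_two] at H
      omega
    · subst h
      rcases p4 with h | h
      · exact Or.inl (Or.inl ⟨rfl, h⟩)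
      · rw [aux_four3 p h, aux_tot4] at H
        omega
    · by_cases h8 : n = 8
      · subst h8
        have D4 := D 4 (by norm_num) (by norm_num)
        rcases p4 with h | h
        · rw [aux_four1 p h, aux_tot4] at D4
          omega
        · exact Or.inl (Or.inr ⟨rfl, h⟩)
      · exfalso
        have D8 := D 8 h (Ne.symm h8)
        have := Nat.le_of_dvd (by norm_num) (aux_eight_sq p hp1)
        rw [D8, aux_tot8] at this
        omega

/-- For an odd prime `p` and a positive integer `n` with `p ∤ n`, one has
`ord_n(p) = φ(n)/2` and `ord_m(p) = φ(m)` for every proper divisor `m` of `n` iff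
(a) `n = 4` and `p ≡ 1 (mod 4)`, or `n = 8` and `p ≡ 3 (mod 4)`;
(b) `n = q` is an odd prime and `ord_q(p) = (q-1)/2`;
(c) `n = 4q` for an odd prime `q`, `p ≡ 3 (mod 4)`, and `p` is a primitive root of `q`;
(d) `n = q₁q₂` is a product of two distinct primes, `p` is a primitive root of both,
and `gcd(q₁-1, q₂-1) = 2`. -/
theorem orderOf_eq_half_totient_and_primitive_on_proper_divisors_iff
    (n : ℕ) (hn : 0 < n) (p : ℕ) (hp : p.Prime) (hp2 : p ≠ 2) (hpn : ¬ p ∣ n) :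
    (2 * orderOf ((p : ZMod n)) = Nat.totient n ∧
        ∀ m : ℕ, m ∣ n → m ≠ n → orderOf ((p : ZMod m)) = Nat.totient m) ↔
      (((n = 4 ∧ p % 4 = 1) ∨ (n = 8 ∧ p % 4 = 3)) ∨
        (n.Prime ∧ n ≠ 2 ∧ orderOf ((p : ZMod n)) = (n - 1) / 2) ∨
        (∃ q : ℕ, q.Prime ∧ q ≠ 2 ∧ n = 4 * q ∧ p % 4 = 3 ∧
          orderOf ((p : ZMod q)) = Nat.totient q) ∨
        (∃ q₁ q₂ : ℕ, q₁.Prime ∧ q₂.Prime ∧ q₁ ≠ q₂ ∧ n = q₁ * q₂ ∧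
          orderOf ((p : ZMod q₁)) = Nat.totient q₁ ∧
          orderOf ((p : ZMod q₂)) = Nat.totient q₂ ∧
          Nat.gcd (q₁ - 1) (q₂ - 1) = 2)) := by
  have hp1 : p % 2 = 1 := Nat.odd_iff.1 (hp.odd_of_ne_two hp2)
  constructor
  · rintro ⟨H, D⟩
    exact aux_forward n hn p hp1 H D
  · rintro ((⟨rfl, h⟩ | ⟨rfl, h⟩) | ⟨np, n2, h⟩ | ⟨q, qp, q2, rfl, h, hq⟩ |
      ⟨q, r, qp, rp, hqr, rfl, h1, h2, hg⟩)
    · refine ⟨by rw [aux_four1 p h, aux_tot4], ?_⟩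
      intro m hm hm4
      have := Nat.le_of_dvd hn hm
      interval_cases m
      · omega
      · rw [aux_one, Nat.totient_one]
      · rw [aux_two p hp1, Nat.totient_two]
      · omega
      · omega
    · refine ⟨by rw [aux_eight3 p h, aux_tot8], ?_⟩
      intro m hm hm4
      have := Nat.le_of_dvd hn hm
      interval_cases m
      · omega
      · rw [aux_one, Nat.totient_one]
      · rw [aux_two p hp1, Nat.totient_two]
      · omega
      · rw [aux_four3 p h, aux_tot4]
      · omega
      · omega
      · omega
      · omega
    · have := Nat.odd_iff.1 (np.odd_of_ne_two n2)
      refine ⟨by rw [h, Nat.totient_prime np]; omega, ?_⟩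
      intro m hm hmn
      rcases (Nat.dvd_prime np).1 hm with rfl | h'
      · rw [aux_one, Nat.totient_one]
      · exact absurd h' hmn
    · have qodd := qp.odd_of_ne_two q2
      have c2 : Nat.Coprime 2 q := Nat.coprime_two_left.2 qodd
      have c4 : Nat.Coprime 4 q := by
        have := Nat.Coprime.pow_left 2 c2
        simpa using this
      have hqe : 2 ∣ Nat.totient q :=
        (Nat.totient_even (lt_of_le_of_ne qp.two_le (Ne.symm q2))).two_dvd
      refine ⟨?_, ?_⟩
      · rw [aux_mul 4 q p c4, aux_four3 p h, hq, Nat.totient_mul c4, aux_tot4,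
          Nat.lcm_eq_right hqe]
      · intro m hm hmn
        obtain ⟨k, l, hk, hl, rfl⟩ := (Nat.dvd_mul).1 hm
        have k4 := Nat.le_of_dvd (by norm_num) hk
        rcases (Nat.dvd_prime qp).1 hl with rfl | rfl
        · rw [mul_one]
          interval_cases k
          · omega
          · rw [aux_one, Nat.totient_one]
          · rw [aux_two p hp1, Nat.totient_two]
          · omega
          · rw [aux_four3 p h, aux_tot4]
        · interval_cases k
          · omega
          · rw [one_mul, hq]
          · rw [aux_mul 2 _ p c2, aux_two p hp1, hq, Nat.totient_mul c2, Nat.totient_two,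
              Nat.lcm_one_left, one_mul]
          · omega
          · exact absurd rfl hmn
    · have cqr : q.Coprime r := (Nat.coprime_primes qp rp).2 hqr
      refine ⟨?_, ?_⟩
      · rw [aux_mul q r p cqr, h1, h2, Nat.totient_mul cqr,
          ← Nat.gcd_mul_lcm (Nat.totient q) (Nat.totient r), Nat.totient_prime qp,
          Nat.totient_prime rp, hg]
      · intro m hm hmn
        obtain ⟨k, l, hk, hl, rfl⟩ := (Nat.dvd_mul).1 hm
        rcases (Nat.dvd_prime qp).1 hk with rfl | rfl <;>
          rcases (Nat.dvd_prime rp).1 hl with rfl | rfl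
        · rw [mul_one, aux_one, Nat.totient_one]
        · rw [one_mul, h2]
        · rw [mul_one, h1]
        · exact absurd rfl hmn
end
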